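/- Let Y be a one-sided 2-connected ladder and R = R_2(Y) the associated ladder determinantal ring over a field k. Then R has at most two semidualizing modules up to isomorphism: among any three semidualizing R-modules, two are isomorphic. -/

import Mathlib

set_option maxHeartbeats 1000000
set_option synthInstance.maxHeartbeats 1000000

open CategoryTheory

namespace LadderDet

/-- The position `p` lies in the `m × n` grid `{1,…,m} × {1,…,n}`. -/
def InGrid (m n : ℕ) (p : ℕ × ℕ) : Prop :=
  1 ≤ p.1 ∧ p.1 ≤ m ∧ 1 ≤ p.2 ∧ p.2 ≤ n

/-- `Y` is a ladder in the `m × n` grid. -/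
def IsLadder (m n : ℕ) (Y : Set (ℕ × ℕ)) : Prop :=
  (∀ p ∈ Y, InGrid m n p) ∧
  ∀ i j p q : ℕ, (i, j) ∈ Y → (p, q) ∈ Y → i ≤ p → j ≤ q → (i, q) ∈ Y ∧ (p, j) ∈ Y

/-- A ladder together with the standard nontriviality assumptions:
`(1,n), (m,1) ∈ Y` and every row and every column of the grid meets `Y`. -/
def StdLadder (m n : ℕ) (Y : Set (ℕ × ℕ)) : Prop :=
  IsLadder m n Y ∧ (1, n) ∈ Y ∧ (m, 1) ∈ Y ∧
  (∀ i, 1 ≤ i → i ≤ m → ∃ j, (i, j) ∈ Y) ∧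
  (∀ j, 1 ≤ j → j ≤ n → ∃ i, (i, j) ∈ Y)

/-- Two positions differ by exactly `1` in exactly one coordinate. -/
def AdjStep (p q : ℕ × ℕ) : Prop :=
  (p.1 = q.1 ∧ (p.2 + 1 = q.2 ∨ q.2 + 1 = p.2)) ∨
  (p.2 = q.2 ∧ (p.1 + 1 = q.1 ∨ q.1 + 1 = p.1))

/-- There is a path in `Y` from `p` to `q`. -/
def HasPath (Y : Set (ℕ × ℕ)) (p q : ℕ × ℕ) : Prop :=
  p ∈ Y ∧ q ∈ Y ∧
    Relation.ReflTransGen (fun a b => a ∈ Y ∧ b ∈ Y ∧ AdjStep a b) p q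

/-- `Y` is path-connected. -/
def PathConnected (Y : Set (ℕ × ℕ)) : Prop :=
  ∀ p ∈ Y, ∀ q ∈ Y, HasPath Y p q

/-- `M` is (the set of entries of) a `t × t` minor of `Y`. -/
def IsMinor (t : ℕ) (Y : Set (ℕ × ℕ)) (M : Set (ℕ × ℕ)) : Prop :=
  ∃ r c : Fin t → ℕ, StrictMono r ∧ StrictMono c ∧
    (∀ u v, (r u, c v) ∈ Y) ∧ M = {p | ∃ u v, p = (r u, c v)}

/-- `Y` is `t`-disconnected. -/
def TDisconnected (m n t : ℕ) (Y : Set (ℕ × ℕ)) : Prop :=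
  ∃ Z₁ Z₂ : Set (ℕ × ℕ), Z₁.Nonempty ∧ Z₂.Nonempty ∧
    IsLadder m n Z₁ ∧ IsLadder m n Z₂ ∧ Z₁ ∩ Z₂ = ∅ ∧ Z₁ ∪ Z₂ = Y ∧
    ∀ M, IsMinor t Y M → M ⊆ Z₁ ∨ M ⊆ Z₂

/-- `Y` is `t`-connected. -/
def TConnected (m n t : ℕ) (Y : Set (ℕ × ℕ)) : Prop := ¬ TDisconnected m n t Y

/-- `p` is a lower inside corner of `Y`. -/
def IsLowerCorner (Y : Set (ℕ × ℕ)) (p : ℕ × ℕ) : Prop :=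
  p ∈ Y ∧ (p.1 - 1, p.2) ∈ Y ∧ (p.1, p.2 - 1) ∈ Y ∧ (p.1 - 1, p.2 - 1) ∉ Y

/-- `p` is an upper inside corner of `Y`. -/
def IsUpperCorner (Y : Set (ℕ × ℕ)) (p : ℕ × ℕ) : Prop :=
  p ∈ Y ∧ (p.1 + 1, p.2) ∈ Y ∧ (p.1, p.2 + 1) ∈ Y ∧ (p.1 + 1, p.2 + 1) ∉ Y

/-- `Y` is one-sided: path-connected and with no lower or no upper inside corners. -/
def OneSided (Y : Set (ℕ × ℕ)) : Prop :=
  PathConnected Y ∧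
  ((∀ p, ¬ IsLowerCorner Y p) ∨ (∀ p, ¬ IsUpperCorner Y p))

/-- `Y` is two-sided: path-connected with at least one lower and one upper inside corner. -/
def TwoSided (Y : Set (ℕ × ℕ)) : Prop :=
  PathConnected Y ∧ (∃ p, IsLowerCorner Y p) ∧ (∃ p, IsUpperCorner Y p)

section Algebra

variable (k : Type) [Field k]

/-- The `t × t` minor of the generic matrix determined by rows `r` and columns `c`,
as an element of the polynomial ring `k[Y]`. -/
noncomputable def minorPoly {t : ℕ} {Y : Set (ℕ × ℕ)} (r c : Fin t → ℕ)
    (h : ∀ u v, (r u, c v) ∈ Y) : MvPolynomial Y k :=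
  (Matrix.of fun u v : Fin t =>
    (MvPolynomial.X ⟨(r u, c v), h u v⟩ : MvPolynomial Y k)).det

/-- The ideal `I_t(Y) ⊆ k[Y]` generated by all `t × t` minors of `X` lying in `Y`. -/
noncomputable def minorIdeal (t : ℕ) (Y : Set (ℕ × ℕ)) : Ideal (MvPolynomial Y k) :=
  Ideal.span {f | ∃ (r c : Fin t → ℕ) (_ : StrictMono r) (_ : StrictMono c)
    (h : ∀ u v, (r u, c v) ∈ Y), f = minorPoly k r c h}

/-- The ladder determinantal ring `R_t(Y) = k[Y]/I_t(Y)`. -/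
abbrev LadderRing (t : ℕ) (Y : Set (ℕ × ℕ)) : Type :=
  MvPolynomial Y k ⧸ minorIdeal k t Y

/-- The residue `x_{ij}` of the variable `X_{ij}` in `R_t(Y)`. -/
noncomputable def xres (t : ℕ) {Y : Set (ℕ × ℕ)} (p : ℕ × ℕ) (hp : p ∈ Y) :
    LadderRing k t Y :=
  Ideal.Quotient.mk (minorIdeal k t Y) (MvPolynomial.X ⟨p, hp⟩)

/-- The ideal of `R_2(Y)` generated by the residues of the variables in row `r`
(an ideal of type `𝔮`). -/
noncomputable def rowIdeal (Y : Set (ℕ × ℕ)) (r : ℕ) : Ideal (LadderRing k 2 Y) :=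
  Ideal.span {z | ∃ q, ∃ h : (r, q) ∈ Y, z = xres k 2 (r, q) h}

/-- The ideal of `R_2(Y)` generated by the residues of the variables in column `b`
(an ideal of type `𝔮'`). -/
noncomputable def colIdeal (Y : Set (ℕ × ℕ)) (b : ℕ) : Ideal (LadderRing k 2 Y) :=
  Ideal.span {z | ∃ p, ∃ h : (p, b) ∈ Y, z = xres k 2 (p, b) h}

/-- The ideal `𝔭` of `R_2(Y)` generated by the residues of the variables weakly
northwest of the position `(c, d)`. -/
noncomputable def cornerIdeal (Y : Set (ℕ × ℕ)) (c d : ℕ) : Ideal (LadderRing k 2 Y) :=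
  Ideal.span {z | ∃ p q, ∃ h : (p, q) ∈ Y, p ≤ c ∧ q ≤ d ∧ z = xres k 2 (p, q) h}

end Algebra

/-- An ideal of `k[Y]` is a monomial ideal if it is generated by monomials. -/
def IsMonomialIdeal {k : Type} [Field k] {Y : Set (ℕ × ℕ)}
    (M : Ideal (MvPolynomial Y k)) : Prop :=
  ∃ S : Set (Y →₀ ℕ), M = Ideal.span ((fun d => MvPolynomial.monomial d (1 : k)) '' S)

/-- A finitely generated module `C` over a commutative ring `R` is semidualizing if
the natural homothety map `R → Hom_R(C, C)` is bijective and `Ext^i_R(C, C) = 0` for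
all `i ≥ 1`. -/
def IsSemidualizing {R : Type} [CommRing R] (C : ModuleCat.{0} R) : Prop :=
  Module.Finite R C ∧
  Function.Bijective (LinearMap.lsmul R C) ∧
  ∀ i : ℕ, 1 ≤ i →
    Subsingleton (((Ext R (ModuleCat.{0} R) i).obj (Opposite.op C)).obj C)

/-- `C` has finite injective dimension: for some `n`, `Ext^i_R(M, C) = 0` for all
modules `M` and all `i > n`. -/
def HasFiniteInjDim {R : Type} [CommRing R] (C : ModuleCat.{0} R) : Prop :=
  ∃ n : ℕ, ∀ i : ℕ, n < i → ∀ M : ModuleCat.{0} R,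
    Subsingleton (((Ext R (ModuleCat.{0} R) i).obj (Opposite.op M)).obj C)



set_option linter.unusedSectionVars false
set_option linter.style.haveILetI false

section
open scoped Pointwise

/-- A projective resolution in elementary form. -/
structure Res (R : Type) [CommRing R] (C : Type) [AddCommGroup C] [Module R C] where
  X : ℕ → Type
  acg : ∀ n, AddCommGroup (X n)
  mod : ∀ n, Module R (X n)
  proj : ∀ n, Module.Projective R (X n)
  d : ∀ n, X (n + 1) →ₗ[R] X n
  ε : X 0 →ₗ[R] C
  surj : Function.Surjective ε
  ex0 : ∀ x, ε x = 0 ↔ ∃ y, d 0 y = x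
  dd : ∀ n x, d n (d (n + 1) x) = 0

attribute [instance] Res.acg Res.mod Res.proj

/-- `Ext^{≥1}(C, M) = 0` in elementary form. -/
def ExtVan {R : Type} [CommRing R] {C : Type} [AddCommGroup C] [Module R C] (P : Res R C)
    (M : Type) [AddCommGroup M] [Module R M] : Prop :=
  ∀ n, ∀ φ : P.X (n + 1) →ₗ[R] M, φ ∘ₗ P.d (n + 1) = 0 → ∃ θ : P.X n →ₗ[R] M, φ = θ ∘ₗ P.d n

/-- Elementary semidualizing. -/
structure SD (R : Type) [CommRing R] (C : Type) [AddCommGroup C] [Module R C] : Prop where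
  fin : Module.Finite R C
  hom : ∀ φ : C →ₗ[R] C, ∃ r : R, ∀ c, φ c = r • c
  faithful : ∀ r : R, (∀ c : C, r • c = 0) → r = 0
  res : ∃ P : Res R C, ExtVan P C

theorem sd_res {R : Type} [CommRing R] {C : ModuleCat.{0} R}
    (h3 : ∀ i : ℕ, 1 ≤ i →
    Subsingleton (((Ext R (ModuleCat.{0} R) i).obj (Opposite.op C)).obj C)) :
    ∃ P : Res R C, ExtVan P C := by
  let P := projectiveResolution C
  have hp : ∀ n, Module.Projective R (P.complex.X n) := fun n => by
    have := P.projective n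
    exact (IsProjective.iff_projective (R := R) (P.complex.X n)).2 this
  have hs : Function.Surjective (P.π.f 0).hom := by
    have : Epi (P.π.f 0) := inferInstance
    exact (ModuleCat.epi_iff_surjective _).1 this
  have hex : ∀ x, (P.π.f 0).hom x = 0 ↔ ∃ y, (P.complex.d 1 0).hom y = x := by
    intro x
    constructor
    · intro hx
      exact (ShortComplex.moduleCat_exact_iff _).1 P.exact₀ x hx
    · rintro ⟨y, rfl⟩
      have := P.complex_d_comp_π_f_zero
      exact congrArg (fun f => f.hom y) this
  have hdd : ∀ n x, (P.complex.d (n+1) n).hom ((P.complex.d (n+2) (n+1)).hom x) = 0 := by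
    intro n x
    have := P.complex.d_comp_d (n+2) (n+1) n
    exact congrArg (fun f => f.hom x) this
  refine ⟨{ X := fun n => P.complex.X n
            acg := fun n => inferInstance
            mod := fun n => inferInstance
            proj := hp
            d := fun n => (P.complex.d (n+1) n).hom
            ε := (P.π.f 0).hom
            surj := hs
            ex0 := hex
            dd := hdd }, ?_⟩
  intro n φ hφ
  have h4 := h3 (n+1) (by omega)
  have h5 : Subsingleton ((P.complex.linearYonedaObj R C).homology (n+1)) :=
    ((P.isoExt (R := R) (n+1) C).toLinearEquiv.toEquiv.subsingleton_congr).1 h4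
  have h6 : (P.complex.linearYonedaObj R C).ExactAt (n+1) := by
    rw [HomologicalComplex.exactAt_iff_isZero_homology]
    exact ModuleCat.isZero_of_subsingleton _
  have h7 := (HomologicalComplex.exactAt_iff' _ n (n+1) (n+2) (by simp) (by simp)).1 h6
  rw [ShortComplex.moduleCat_exact_iff] at h7
  obtain ⟨θ, hθ⟩ := h7 (ModuleCat.ofHom φ : P.complex.X (n+1) ⟶ C) (by
    refine ModuleCat.hom_ext (M := P.complex.X (n+2)) (N := C) (LinearMap.ext fun x => ?_)
    exact congrArg (fun f => f x) hφ)
  refine ⟨ModuleCat.Hom.hom (show P.complex.X n ⟶ C from θ), ?_⟩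
  ext x
  exact (congrArg (fun f : P.complex.X (n+1) ⟶ C => f.hom x) hθ).symm

theorem IsSemidualizing.sd {R : Type} [CommRing R] {C : ModuleCat.{0} R}
    (h : IsSemidualizing C) : SD R C := by
  obtain ⟨h1, h2, h3⟩ := h
  refine ⟨h1, ?_, ?_, sd_res h3⟩
  · intro φ
    obtain ⟨r, hr⟩ := h2.2 φ
    exact ⟨r, fun c => by rw [← hr]; rfl⟩
  · intro r hr
    apply h2.1
    refine LinearMap.ext fun c => ?_
    rw [map_zero]
    exact hr c

theorem SD.congr {R : Type} [CommRing R] {C D : Type} [AddCommGroup C] [Module R C]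
    [AddCommGroup D] [Module R D] (h : SD R C) (e : C ≃ₗ[R] D) : SD R D := by
  obtain ⟨h1, h2, h3, P, h4⟩ := h
  refine ⟨Module.Finite.equiv e, ?_, ?_, ?_⟩
  · intro φ
    obtain ⟨r, hr⟩ := h2 (e.symm.toLinearMap ∘ₗ φ ∘ₗ e.toLinearMap)
    refine ⟨r, fun c => ?_⟩
    have := hr (e.symm c)
    simp at this
    rw [← map_smul, e.symm.injective.eq_iff] at this
    exact this
  · intro r hr
    apply h3
    intro c
    apply e.injective
    simp [hr]
  · refine ⟨⟨P.X, P.acg, P.mod, P.proj, P.d, e.toLinearMap ∘ₗ P.ε, e.surjective.comp P.surj,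
      fun x => by simpa using P.ex0 x, P.dd⟩, ?_⟩
    intro n φ hφ
    obtain ⟨θ, hθ⟩ := h4 n (e.symm.toLinearMap ∘ₗ φ) (by
      rw [LinearMap.comp_assoc]; erw [hφ]; simp)
    refine ⟨e.toLinearMap ∘ₗ θ, ?_⟩
    ext x
    have := congrArg (fun f => e (f x)) hθ
    simpa using this

/-- `M` behaves like `C / 𝔞 C`. -/
structure Good {R : Type} [CommRing R] {C : Type} [AddCommGroup C] [Module R C] (P : Res R C)
    (𝔞 : Ideal R) {M : Type} [AddCommGroup M] [Module R M] (π : C →ₗ[R] M) : Prop where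
  surj : Function.Surjective π
  ker : LinearMap.ker π = 𝔞 • ⊤
  hom : ∀ φ : C →ₗ[R] M, ∃ r : R, ∀ c, φ c = r • π c
  faithful : ∀ r : R, (∀ c : C, r • π c = 0) → r ∈ 𝔞
  ext : ExtVan P M

section
variable {R : Type} [CommRing R] {C : Type} [AddCommGroup C] [Module R C]

theorem Good.of_sd (h : SD R C) : ∃ P : Res R C, Good P ⊥ (LinearMap.id : C →ₗ[R] C) := by
  obtain ⟨h1, h2, h3, P, h4⟩ := h
  exact ⟨P, fun c => ⟨c, rfl⟩, by simp, h2, fun r hr => by simpa using h3 r hr, h4⟩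

theorem Good.smul_eq_zero {P : Res R C} {𝔞 : Ideal R} {M : Type} [AddCommGroup M] [Module R M]
    {π : C →ₗ[R] M} (h : Good P 𝔞 π) {r : R} (hr : r ∈ 𝔞) (m : M) : r • m = 0 := by
  obtain ⟨c, rfl⟩ := h.surj m
  rw [← map_smul, ← LinearMap.mem_ker, h.ker]
  exact Submodule.smul_mem_smul hr trivial

/-- divide a map landing in `x M` by a regular `x`. -/
theorem exists_div {M N : Type} [AddCommGroup M] [Module R M] [AddCommGroup N] [Module R N]
    {x : R} (hx : IsSMulRegular M x) (φ : N →ₗ[R] M) (h : ∀ n, ∃ m, φ n = x • m) :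
    ∃ χ : N →ₗ[R] M, ∀ n, φ n = x • χ n := by
  choose f hf using h
  refine ⟨⟨⟨f, fun a b => hx ?_⟩, fun r a => hx ?_⟩, hf⟩
  · simp only [smul_add, ← hf, map_add]
  · simp only [RingHom.id_apply, ← hf, map_smul, smul_comm x r]

theorem mem_quotSMulTop {M : Type} [AddCommGroup M] [Module R M] {x : R} {m : M}
    (h : (Submodule.mkQ (x • (⊤ : Submodule R M))) m = 0) : ∃ m', m = x • m' := by
  simp only [Submodule.mkQ_apply, Submodule.Quotient.mk_eq_zero] at h
  obtain ⟨m', _, h⟩ := (Submodule.mem_smul_pointwise_iff_exists m x ⊤).1 h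
  exact ⟨m', h.symm⟩

theorem quotSMulTop_smul {M : Type} [AddCommGroup M] [Module R M] {x : R} (m : M) :
    (Submodule.mkQ (x • (⊤ : Submodule R M))) (x • m) = 0 := by
  simp only [Submodule.mkQ_apply, Submodule.Quotient.mk_eq_zero]
  exact Submodule.smul_mem_pointwise_smul m x ⊤ trivial

theorem Good.step {P : Res R C} {𝔞 : Ideal R} {M : Type} [AddCommGroup M] [Module R M]
    {π : C →ₗ[R] M} (h : Good P 𝔞 π) {x : R} (hx : IsSMulRegular M x) :
    Good P (𝔞 ⊔ Ideal.span {x})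
      ((Submodule.mkQ (x • (⊤ : Submodule R M)) ∘ₗ π : C →ₗ[R] QuotSMulTop x M)) := by
  set q : M →ₗ[R] QuotSMulTop x M := Submodule.mkQ (x • (⊤ : Submodule R M)) with hq
  have hqs : Function.Surjective q := Submodule.mkQ_surjective _
  have hqx : ∀ m : M, q (x • m) = 0 := fun m => quotSMulTop_smul m
  have hqk : ∀ m : M, q m = 0 → ∃ m', m = x • m' := fun m hm => mem_quotSMulTop hm
  -- general lifting of a cocycle
  have lift : ∀ n, ∀ φ : P.X n →ₗ[R] QuotSMulTop x M, φ ∘ₗ P.d n = 0 →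
      ∃ η : P.X n →ₗ[R] M, q ∘ₗ η = φ ∧ η ∘ₗ P.d n = 0 := by
    intro n φ hφ
    obtain ⟨φ', hφ'⟩ := Module.projective_lifting_property q φ hqs
    obtain ⟨χ, hχ⟩ := exists_div hx (φ' ∘ₗ P.d n) (fun y => hqk _ (by
      have := congrArg (fun f => f y) hφ
      rw [← hφ'] at this
      simpa using this))
    obtain ⟨θ, hθ⟩ := h.ext n χ (by
      ext y
      apply hx
      simp only [LinearMap.comp_apply, LinearMap.zero_apply, smul_zero]
      rw [← hχ]
      simp [P.dd])
    refine ⟨φ' - x • θ, ?_, ?_⟩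
    · ext y
      simp [hqx, ← hφ']
    · ext y
      have := hχ y
      simp only [LinearMap.comp_apply] at this
      simp [this, hθ]
  refine ⟨hqs.comp h.surj, ?_, ?_, ?_, ?_⟩
  · apply le_antisymm
    · intro c hc
      obtain ⟨m, hm⟩ := hqk (π c) hc
      obtain ⟨c', rfl⟩ := h.surj m
      have h1 : c - x • c' ∈ LinearMap.ker π := by simp [hm]
      rw [h.ker] at h1
      rw [Submodule.sup_smul]
      have : c = (c - x • c') + x • c' := by abel
      rw [this]
      exact Submodule.add_mem_sup h1
        (Submodule.smul_mem_smul (Ideal.mem_span_singleton_self x) trivial)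
    · rw [Submodule.sup_smul]
      refine sup_le ?_ ?_
      · rw [← h.ker]
        intro c hc
        have : π c = 0 := hc
        simp [this]
      · rw [Submodule.smul_le]
        intro r hr c _
        obtain ⟨a, rfl⟩ := Ideal.mem_span_singleton'.1 hr
        rw [LinearMap.mem_ker, LinearMap.comp_apply, mul_comm, mul_smul, map_smul, hqx]
  · intro φ
    obtain ⟨η, h1, h2⟩ := lift 0 (φ ∘ₗ P.ε) (by
      ext y
      have := (P.ex0 (P.d 0 y)).2 ⟨y, rfl⟩
      simp [this])
    have h3 : LinearMap.ker P.ε ≤ LinearMap.ker η := by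
      intro y hy
      obtain ⟨z, rfl⟩ := (P.ex0 y).1 hy
      exact congrArg (fun f => f z) h2
    have h4 : ∃ η' : C →ₗ[R] M, ∀ y, η' (P.ε y) = η y := by
      choose s hs using P.surj
      have hη : ∀ y y', P.ε y = P.ε y' → η y = η y' := by
        intro y y' hy
        have : y - y' ∈ LinearMap.ker P.ε := by simp [hy]
        have := h3 this
        simpa [sub_eq_zero] using this
      refine ⟨⟨⟨fun c => η (s c), fun a b => ?_⟩, fun r a => ?_⟩, fun y => ?_⟩
      · rw [← map_add]; exact hη _ _ (by simp [hs])
      · simp only [RingHom.id_apply]; rw [← map_smul]; exact hη _ _ (by simp [hs])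
      · exact hη _ _ (by simp [hs])
    obtain ⟨η', h5⟩ := h4
    obtain ⟨r, hr⟩ := h.hom η'
    refine ⟨r, fun c => ?_⟩
    obtain ⟨y, rfl⟩ := P.surj c
    have := congrArg (fun f => f y) h1
    simp only [LinearMap.comp_apply] at this
    rw [← this, ← h5, hr, map_smul]
    rfl
  · intro r hr
    obtain ⟨η, hη⟩ := exists_div hx (r • π) (fun c => hqk _ (by simpa using hr c))
    obtain ⟨s, hs⟩ := h.hom η
    have : r - s * x ∈ 𝔞 := h.faithful _ (fun c => by
      have := hη c
      rw [hs] at this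
      simp only [LinearMap.smul_apply] at this
      rw [sub_smul, this, mul_comm, mul_smul, sub_self])
    have h2 : r = (r - s * x) + s * x := by ring
    rw [h2]
    exact Submodule.add_mem_sup this (Ideal.mem_span_singleton'.2 ⟨s, rfl⟩)
  · intro n φ hφ
    obtain ⟨η, h1, h2⟩ := lift (n+1) φ hφ
    obtain ⟨θ, hθ⟩ := h.ext n η h2
    exact ⟨q ∘ₗ θ, by rw [LinearMap.comp_assoc, ← hθ, h1]⟩

end

end

section
open scoped Pointwise

section
variable {R : Type} [CommRing R]

theorem exists_hom_quot {C : Type} [AddCommGroup C] [Module R C] [Module.Finite R C]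
    (hf : ∀ r : R, (∀ c : C, r • c = 0) → r = 0) (𝔭 : Ideal R) [𝔭.IsPrime] :
    ∃ (θ : C →ₗ[R] R ⧸ 𝔭) (c : C), θ c ≠ 0 := by
  classical
  have h1 : (⟨𝔭, inferInstance⟩ : PrimeSpectrum R) ∈ Module.support R C := by
    rw [Module.support_eq_zeroLocus]
    intro r hr
    have : r = 0 := hf r (fun c => Module.mem_annihilator.1 hr c)
    simp [this]
  rw [Module.mem_support_iff_nontrivial_residueField_tensorProduct] at h1
  let K := 𝔭.ResidueField
  have h1' : Nontrivial (TensorProduct R K C) := h1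
  obtain ⟨v, hv⟩ := exists_ne (0 : TensorProduct R K C)
  obtain ⟨φ, hφ⟩ : ∃ φ : Module.Dual K (TensorProduct R K C), φ v ≠ 0 := by
    by_contra! h
    exact hv ((Module.forall_dual_apply_eq_zero_iff K v).1 h)
  let g : C →ₗ[R] K := (φ.restrictScalars R) ∘ₗ (TensorProduct.mk R K C 1)
  obtain ⟨c, hc⟩ : ∃ c, g c ≠ 0 := by
    by_contra! h
    apply hφ
    have : φ = 0 := by
      apply TensorProduct.AlgebraTensorModule.curry_injective
      ext c
      exact h c
    rw [this]; rfl
  obtain ⟨t, ht⟩ := (Module.Finite.fg_top : (⊤ : Submodule R C).FG)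
  obtain ⟨b, hb⟩ := IsLocalization.exist_integer_multiples_of_finset (nonZeroDivisors (R ⧸ 𝔭))
    (t.image g)
  obtain ⟨b', hb'⟩ := Ideal.Quotient.mk_surjective (b : R ⧸ 𝔭)
  let ψ : (R ⧸ 𝔭) →ₗ[R] K := (Algebra.linearMap (R ⧸ 𝔭) K).restrictScalars R
  have hψ : Function.Injective ψ := IsFractionRing.injective (R ⧸ 𝔭) K
  have hbs : ∀ y : K, b' • y = (b : R ⧸ 𝔭) • y := fun y => by
    rw [← hb', ← Ideal.Quotient.algebraMap_eq, algebraMap_smul]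
  have hr : ∀ c, (b' • g) c ∈ LinearMap.range ψ := by
    intro c
    have hc : c ∈ Submodule.span R (t : Set C) := by rw [ht]; trivial
    induction hc using Submodule.span_induction with
    | mem x hx =>
      obtain ⟨y, hy⟩ := hb (g x) (Finset.mem_image_of_mem g hx)
      refine ⟨y, ?_⟩
      rw [LinearMap.smul_apply, hbs]
      exact hy
    | zero => simp
    | add x y _ _ hx hy => rw [map_add]; exact add_mem hx hy
    | smul a x _ hx => rw [map_smul]; exact Submodule.smul_mem _ _ hx
  let e := LinearEquiv.ofInjective ψ hψ
  refine ⟨e.symm.toLinearMap ∘ₗ (b' • g).codRestrict _ hr, c, ?_⟩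
  intro h0
  have h2 : (b' • g).codRestrict _ hr c = 0 := by simpa using h0
  have h3 : b' • g c = 0 := congrArg Subtype.val h2
  rw [hbs, Algebra.smul_def, mul_eq_zero] at h3
  rcases h3 with h3 | h3
  · exact nonZeroDivisors.coe_ne_zero b (hψ (by rw [map_zero]; exact h3))
  · exact hc h3

/-- associated primes of `C/𝔞C` are associated primes of `R/𝔞`. -/
theorem Good.assoc {C : Type} [AddCommGroup C] [Module R C] [Module.Finite R C]
    (hf : ∀ r : R, (∀ c : C, r • c = 0) → r = 0)
    {P : Res R C} {𝔞 : Ideal R} {M : Type} [AddCommGroup M] [Module R M]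
    {π : C →ₗ[R] M} (h : Good P 𝔞 π) (𝔭 : Ideal R) [𝔭.IsPrime] (m : M)
    (hm : ∀ s, s ∈ 𝔭 ↔ s • m = 0) : ∃ r : R, ∀ s, s ∈ 𝔭 ↔ s * r ∈ 𝔞 := by
  obtain ⟨θ, c, hc⟩ := exists_hom_quot hf 𝔭
  let ι : (R ⧸ 𝔭) →ₗ[R] M := 𝔭.liftQ (LinearMap.toSpanSingleton R M m) (by
    intro s hs
    simpa using (hm s).1 hs)
  have hι : Function.Injective ι := by
    rw [injective_iff_map_eq_zero]
    intro y hy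
    obtain ⟨s, rfl⟩ := Submodule.Quotient.mk_surjective _ y
    rw [Submodule.Quotient.mk_eq_zero, hm]
    exact hy
  obtain ⟨r, hr⟩ := h.hom (ι ∘ₗ θ)
  refine ⟨r, fun s => ⟨fun hs => h.faithful _ fun c => ?_, fun hs => ?_⟩⟩
  · rw [mul_smul, ← hr, ← map_smul]
    obtain ⟨y, hy⟩ := Ideal.Quotient.mk_surjective (θ c)
    have : θ (s • c) = 0 := by
      rw [map_smul, ← hy, Algebra.smul_def, Ideal.Quotient.algebraMap_eq, ← map_mul,
        Ideal.Quotient.eq_zero_iff_mem]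
      exact Ideal.mul_mem_right _ _ hs
    rw [LinearMap.comp_apply, this, map_zero]
  · have h1 : ι (s • θ c) = 0 := by
      have := hr c
      rw [LinearMap.comp_apply] at this
      rw [map_smul, this, ← mul_smul, h.smul_eq_zero hs]
    have h2 : s • θ c = 0 := hι (by rw [h1, map_zero])
    rw [Algebra.smul_def, mul_eq_zero] at h2
    rcases h2 with h2 | h2
    · rwa [Ideal.Quotient.algebraMap_eq, Ideal.Quotient.eq_zero_iff_mem] at h2
    · exact absurd h2 hc

/-- a prime annihilator avoiding the powers of `x`. -/
theorem exists_prime_ann [IsNoetherianRing R] {M : Type} [AddCommGroup M] [Module R M]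
    (x : R) (m : M) (hx : ∀ j : ℕ, x ^ j • m ≠ 0) :
    ∃ (b : R) (𝔭 : Ideal R), 𝔭.IsPrime ∧ (∀ s, s ∈ 𝔭 ↔ s • (b • m) = 0) ∧ x ∉ 𝔭 := by
  obtain ⟨𝔭, ⟨b, hb, rfl⟩, h3⟩ := set_has_maximal_iff_noetherian.mpr
    (inferInstanceAs (IsNoetherian R R))
    {P : Ideal R | ∃ b : R, (∀ j : ℕ, x ^ j • b • m ≠ 0) ∧
      P = LinearMap.ker (LinearMap.toSpanSingleton R M (b • m))}
      ⟨_, 1, by simpa using hx, rfl⟩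
  have key : ∀ c : R, (∀ j : ℕ, x ^ j • (c * b) • m ≠ 0) → ∀ t : R, t • (c * b) • m = 0 →
      t • b • m = 0 := by
    intro c hc t ht
    by_contra hn
    refine h3 _ ⟨c * b, hc, rfl⟩ (lt_of_le_of_ne ?_ ?_)
    · intro s hs
      simp only [LinearMap.mem_ker, LinearMap.toSpanSingleton_apply] at hs ⊢
      rw [mul_smul, smul_comm, hs, smul_zero]
    · intro he
      have : t ∈ LinearMap.ker (LinearMap.toSpanSingleton R M ((c * b) • m)) := by simpa using ht
      rw [← he] at this
      exact hn (by simpa using this)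
  have hxp : x ∉ LinearMap.ker (LinearMap.toSpanSingleton R M (b • m)) := by
    intro h
    apply hb 1
    simpa using h
  refine ⟨b, _, ⟨?_, ?_⟩, fun s => by simp, hxp⟩
  · intro h; rw [h] at hxp; exact hxp trivial
  · intro s t hst
    simp only [LinearMap.mem_ker, LinearMap.toSpanSingleton_apply] at hst ⊢
    by_cases hs : ∀ j : ℕ, x ^ j • (s * b) • m ≠ 0
    · right
      apply key s hs
      rw [mul_smul, ← mul_smul, mul_comm, hst]
    · left
      push Not at hs
      obtain ⟨j, hj⟩ := hs
      apply key (x ^ j)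
      · intro i
        rw [mul_smul, ← mul_smul, ← pow_add]
        exact hb _
      · rw [mul_smul, smul_comm, ← mul_smul s b, hj]

/-- regularity transfers from `R/𝔞` to `C/𝔞C` -/
theorem Good.regular [IsNoetherianRing R] {C : Type} [AddCommGroup C] [Module R C]
    [Module.Finite R C]
    (hf : ∀ r : R, (∀ c : C, r • c = 0) → r = 0)
    {P : Res R C} {𝔞 : Ideal R} {M : Type} [AddCommGroup M] [Module R M]
    {π : C →ₗ[R] M} (h : Good P 𝔞 π) {y : R} (hy : ∀ r, y * r ∈ 𝔞 → r ∈ 𝔞) :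
    IsSMulRegular M y := by
  rw [isSMulRegular_iff_right_eq_zero_of_smul]
  intro m hm
  by_contra hm0
  obtain ⟨b, 𝔭, hp, h1, -⟩ := exists_prime_ann (1 : R) m (by simpa using hm0)
  obtain ⟨r, hr⟩ := h.assoc hf 𝔭 (b • m) h1
  have h2 : y ∈ 𝔭 := (h1 y).2 (by rw [smul_comm, hm, smul_zero])
  have h3 := hy r ((hr y).1 h2)
  exact hp.ne_top ((Ideal.eq_top_iff_one _).2 ((hr 1).2 (by simpa using h3)))

end

end

section
open scoped Pointwise

section
variable {k R : Type} [Field k] [CommRing R] [Algebra k R]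

/-- `y 0, …, y (c-1)` is weakly regular on `U / V` with finite dimensional quotient. -/
def WReg (k : Type) [Field k] {R : Type} [CommRing R] {M : Type} [AddCommGroup M] [Module R M]
    [Module k M] : ℕ → (ℕ → R) → Submodule R M → Submodule R M → Prop
  | 0, _, U, V => ∃ t : Finset M, (∀ w ∈ t, w ∈ U) ∧ ∀ u ∈ U, ∃ w ∈ Submodule.span k (t : Set M), u - w ∈ V
  | (c + 1), y, U, V => (∀ u ∈ U, y 0 • u ∈ V → u ∈ V) ∧
      WReg k c (fun i => y (i + 1)) U (V ⊔ U.map (LinearMap.lsmul R M (y 0)))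

variable {M M' : Type} [AddCommGroup M] [Module R M] [Module k M] [IsScalarTower k R M]
  [AddCommGroup M'] [Module R M'] [Module k M'] [IsScalarTower k R M']

theorem mem_sup_lsmul {U V : Submodule R M} {y : R} {u : M} :
    u ∈ V ⊔ U.map (LinearMap.lsmul R M y) ↔ ∃ w ∈ U, u - y • w ∈ V := by
  rw [Submodule.mem_sup]
  constructor
  · rintro ⟨v, hv, z, ⟨w, hw, rfl⟩, rfl⟩
    exact ⟨w, hw, by simpa using hv⟩
  · rintro ⟨w, hw, h⟩
    exact ⟨_, h, _, ⟨w, hw, rfl⟩, by simp⟩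

theorem WReg.transfer (f : M →ₗ[R] M') : ∀ (c : ℕ) (y : ℕ → R) {U V : Submodule R M}
    {U' V' : Submodule R M'} (_ : ∀ u ∈ U, f u ∈ U') (_ : ∀ v ∈ V, f v ∈ V')
    (_ : ∀ u' ∈ U', ∃ u ∈ U, u' - f u ∈ V') (_ : ∀ u ∈ U, f u ∈ V' → u ∈ V),
    WReg k c y U V → WReg k c y U' V'
  | 0, y, U, V, U', V', hU, hV, h1, h2, h => by
    classical
    obtain ⟨t, ht0, ht⟩ := h
    refine ⟨t.image f, fun w hw => ?_, fun u' hu' => ?_⟩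
    · obtain ⟨v, hv, rfl⟩ := Finset.mem_image.1 hw
      exact hU _ (ht0 _ hv)
    obtain ⟨u, hu, hv⟩ := h1 u' hu'
    obtain ⟨w, hw, hw'⟩ := ht u hu
    refine ⟨f w, ?_, ?_⟩
    · rw [Finset.coe_image]
      exact (Submodule.map_span (f.restrictScalars k) (t : Set M)) ▸ Submodule.mem_map_of_mem hw
    · have := add_mem hv (hV _ hw')
      rw [map_sub] at this
      simpa using this
  | (c+1), y, U, V, U', V', hU, hV, h1, h2, h => by
    refine ⟨fun u' hu' hy => ?_, WReg.transfer f c _ hU ?_ ?_ ?_ h.2⟩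
    · obtain ⟨u, hu, hv⟩ := h1 u' hu'
      have h3 : u ∈ V := h.1 u hu (h2 _ (U.smul_mem _ hu) (by
        have := sub_mem hy (V'.smul_mem (y 0) hv)
        rw [map_smul]
        simpa [smul_sub] using this))
      have := add_mem hv (hV _ h3)
      simpa using this
    · intro v hv
      rw [mem_sup_lsmul] at hv ⊢
      obtain ⟨w, hw, h4⟩ := hv
      exact ⟨f w, hU _ hw, by simpa using hV _ h4⟩
    · intro u' hu'
      obtain ⟨u, hu, hv⟩ := h1 u' hu'
      exact ⟨u, hu, Submodule.mem_sup_left hv⟩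
    · intro u hu hv
      rw [mem_sup_lsmul] at hv ⊢
      obtain ⟨w', hw', h4⟩ := hv
      obtain ⟨w, hw, h5⟩ := h1 w' hw'
      refine ⟨w, hw, h2 _ (U.sub_mem hu (U.smul_mem _ hw)) ?_⟩
      have := add_mem h4 (V'.smul_mem (y 0) h5)
      rw [map_sub, map_smul]
      simpa [smul_sub] using this

theorem WReg.transfer_rev (f : M →ₗ[R] M') : ∀ (c : ℕ) (y : ℕ → R) {U V : Submodule R M}
    {U' V' : Submodule R M'} (_ : ∀ u ∈ U, f u ∈ U') (_ : ∀ v ∈ V, f v ∈ V')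
    (_ : ∀ u' ∈ U', ∃ u ∈ U, u' - f u ∈ V') (_ : ∀ u ∈ U, f u ∈ V' → u ∈ V),
    WReg k c y U' V' → WReg k c y U V
  | 0, y, U, V, U', V', hU, hV, h1, h2, h => by
    classical
    obtain ⟨t, ht0, ht⟩ := h
    choose! g hg using h1
    have key : ∀ w ∈ Submodule.span k (t : Set M'), ∃ v ∈ Submodule.span k
        ((t.image g : Finset M) : Set M), v ∈ U ∧ w - f v ∈ V' := by
      intro w hw
      induction hw using Submodule.span_induction with
      | zero => exact ⟨0, zero_mem _, zero_mem _, by simp⟩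
      | mem x hx =>
        exact ⟨g x, Submodule.subset_span (by simpa using ⟨x, hx, rfl⟩), hg x (ht0 x hx)⟩
      | add x z _ _ hx hz =>
        obtain ⟨a, ha, ha', ha''⟩ := hx
        obtain ⟨b, hb, hb', hb''⟩ := hz
        exact ⟨a + b, add_mem ha hb, add_mem ha' hb', by
          rw [map_add, add_sub_add_comm]; exact add_mem ha'' hb''⟩
      | smul r x _ hx =>
        obtain ⟨a, ha, ha', ha''⟩ := hx
        have e1 : ∀ a : M, r • a = algebraMap k R r • a := fun a => by rw [algebraMap_smul]
        have e2 : ∀ a : M', r • a = algebraMap k R r • a := fun a => by rw [algebraMap_smul]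
        refine ⟨r • a, Submodule.smul_mem _ _ ha, ?_, ?_⟩
        · rw [e1]; exact U.smul_mem _ ha'
        · rw [e1, e2, map_smul, ← smul_sub]; exact V'.smul_mem _ ha''
    refine ⟨t.image g, fun w hw => ?_, fun u hu => ?_⟩
    · obtain ⟨v, hv, rfl⟩ := Finset.mem_image.1 hw
      exact (hg _ (ht0 _ hv)).1
    · obtain ⟨w', hw', h3⟩ := ht (f u) (hU _ hu)
      obtain ⟨v, hv, hv', h4⟩ := key w' hw'
      refine ⟨v, hv, h2 _ (sub_mem hu hv') ?_⟩
      have := add_mem h3 h4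
      rw [map_sub]
      simpa using this
  | (c+1), y, U, V, U', V', hU, hV, h1, h2, h => by
    refine ⟨fun u hu hy => ?_, WReg.transfer_rev f c _ hU ?_ ?_ ?_ h.2⟩
    · refine h2 _ hu (h.1 _ (hU _ hu) ?_)
      rw [← map_smul]
      exact hV _ hy
    · intro v hv
      rw [mem_sup_lsmul] at hv ⊢
      obtain ⟨w, hw, h4⟩ := hv
      exact ⟨f w, hU _ hw, by simpa using hV _ h4⟩
    · intro u' hu'
      obtain ⟨u, hu, hv⟩ := h1 u' hu'
      exact ⟨u, hu, Submodule.mem_sup_left hv⟩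
    · intro u hu hv
      rw [mem_sup_lsmul] at hv ⊢
      obtain ⟨w', hw', h4⟩ := hv
      obtain ⟨w, hw, h5⟩ := h1 w' hw'
      refine ⟨w, hw, h2 _ (U.sub_mem hu (U.smul_mem _ hw)) ?_⟩
      have := add_mem h4 (V'.smul_mem (y 0) h5)
      rw [map_sub, map_smul]
      simpa [smul_sub] using this

/-- finite dimensionality of the final quotient -/
theorem WReg.finite : ∀ (c : ℕ) (y : ℕ → R) {U V : Submodule R M}, WReg k c y U V →
    ∃ t : Finset M, (∀ w ∈ t, w ∈ U) ∧ ∀ u ∈ U, ∃ w ∈ Submodule.span k (t : Set M),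
      u - w ∈ V ⊔ Ideal.span (y '' Set.Iio c) • U
  | 0, y, U, V, ⟨t, h0, h⟩ => ⟨t, h0, fun u hu => by
      obtain ⟨w, hw, h1⟩ := h u hu
      exact ⟨w, hw, Submodule.mem_sup_left h1⟩⟩
  | (c+1), y, U, V, h => by
    obtain ⟨t, h0, h1⟩ := WReg.finite c _ h.2
    refine ⟨t, h0, fun u hu => ?_⟩
    obtain ⟨w, hw, h2⟩ := h1 u hu
    refine ⟨w, hw, Set.mem_of_mem_of_subset h2 (SetLike.coe_subset_coe.2
      (sup_le (sup_le le_sup_left ?_) ?_))⟩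
    · rintro _ ⟨w, hw, rfl⟩
      exact Submodule.mem_sup_right (Submodule.smul_mem_smul
        (Ideal.subset_span ⟨0, by simp, rfl⟩) hw)
    · refine le_trans (Submodule.smul_mono_left (Ideal.span_mono ?_)) le_sup_right
      rintro _ ⟨i, hi, rfl⟩
      exact ⟨i + 1, by simpa using hi, rfl⟩

theorem WReg.ext : ∀ (c : ℕ) (y : ℕ → R) {U V W : Submodule R M} (_ : V ≤ W) (_ : W ≤ U),
    WReg k c y W V → WReg k c y U W → WReg k c y U V
  | 0, y, U, V, W, hVW, hWU, h1, h2 => by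
    classical
    obtain ⟨t, ht0, ht⟩ := h1
    obtain ⟨s, hs0, hs⟩ := h2
    refine ⟨t ∪ s, fun w hw => (Finset.mem_union.1 hw).elim (fun h => hWU (ht0 _ h)) (hs0 _),
      fun u hu => ?_⟩
    obtain ⟨w, hw, h3⟩ := hs u hu
    obtain ⟨w', hw', h4⟩ := ht _ h3
    refine ⟨w + w', ?_, by rw [← sub_sub]; exact h4⟩
    rw [Finset.coe_union, Submodule.span_union]
    exact add_mem (Submodule.mem_sup_right hw) (Submodule.mem_sup_left hw')
  | (c+1), y, U, V, W, hVW, hWU, h1, h2 => by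
    refine ⟨fun u hu hy => h1.1 u (h2.1 u hu (hVW hy)) hy, ?_⟩
    refine WReg.ext c _ (W := W ⊔ U.map (LinearMap.lsmul R M (y 0)))
      (sup_le_sup_right hVW _) (sup_le hWU ?_) ?_ h2.2
    · rintro _ ⟨w, hw, rfl⟩
      exact U.smul_mem _ hw
    · refine WReg.transfer LinearMap.id c _ ?_ ?_ ?_ ?_ h1.2
      · exact fun u hu => Submodule.mem_sup_left hu
      · exact fun u hu => sup_le_sup_left (Submodule.map_mono hWU) V hu
      · intro u hu
        obtain ⟨w, hw, h⟩ := mem_sup_lsmul.1 hu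
        refine ⟨u - y 0 • w, h, ?_⟩
        exact mem_sup_lsmul.2 ⟨w, hw, by simp⟩
      · intro u hu hv
        obtain ⟨w, hw, h⟩ := mem_sup_lsmul.1 hv
        refine mem_sup_lsmul.2 ⟨w, h2.1 w hw ?_, h⟩
        have := sub_mem hu (hVW h)
        simpa using this

theorem WReg.succ (c : ℕ) (y : ℕ → R) {U V V' : Submodule R M} (x : R)
    (hx : ∀ u ∈ U, y 0 • u - x • u ∈ V) (hr : ∀ u ∈ U, x • u ∈ V → u ∈ V)
    (hV' : ∀ u, u ∈ V' ↔ ∃ w ∈ U, u - x • w ∈ V)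
    (h : WReg k c (fun i => y (i + 1)) U V') : WReg k (c + 1) y U V := by
  refine ⟨fun u hu hy => hr u hu ?_, ?_⟩
  · have := sub_mem hy (hx u hu)
    simpa using this
  · have : V ⊔ U.map (LinearMap.lsmul R M (y 0)) = V' := by
      ext u
      rw [mem_sup_lsmul, hV']
      constructor
      · rintro ⟨w, hw, h⟩
        refine ⟨w, hw, ?_⟩
        have := add_mem h (hx w hw)
        simpa using this
      · rintro ⟨w, hw, h⟩
        refine ⟨w, hw, ?_⟩
        have := sub_mem h (hx w hw)
        simpa using this
    rw [this]; exact h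

theorem WReg.independent {ι : Type} [Fintype ι] (e : ι → M) :
    ∀ (c : ℕ) (y : ℕ → R) (V : Submodule R M), WReg k c y ⊤ V →
    (∀ a : ι → k, ∑ i, a i • e i ∈ V ⊔ Ideal.span (y '' Set.Iio c) • (⊤ : Submodule R M) → a = 0) →
    ∀ p : ι → MvPolynomial (Fin c) k,
      ∑ i, MvPolynomial.aeval (fun j : Fin c => y j) (p i) • e i ∈ V → p = 0
  | 0, y, V, h, ha, p, hp => by
    have h1 : ∀ i, p i = MvPolynomial.C (MvPolynomial.constantCoeff (p i)) := by
      intro i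
      exact (MvPolynomial.eq_C_of_isEmpty (p i))
    have h2 := ha (fun i => MvPolynomial.constantCoeff (p i)) (Submodule.mem_sup_left (by
      convert hp using 2 with i
      conv_rhs => rw [h1 i]
      simp))
    funext i
    rw [h1 i, congrFun h2 i]
    simp
  | (c+1), y, V, h, ha, p, hp => by
    have ih := WReg.independent e c _ _ h.2 (fun a h3 => ha a (by
      refine Set.mem_of_mem_of_subset h3 (SetLike.coe_subset_coe.2
        (sup_le (sup_le le_sup_left ?_) ?_))
      · rintro _ ⟨w, hw, rfl⟩
        exact Submodule.mem_sup_right (Submodule.smul_mem_smul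
          (Ideal.subset_span ⟨0, by simp, rfl⟩) trivial)
      · refine le_trans (Submodule.smul_mono_left (Ideal.span_mono ?_)) le_sup_right
        rintro _ ⟨i, hi, rfl⟩
        exact ⟨i+1, by simpa using hi, rfl⟩))
    have key : ∀ (n : ℕ) (F : ι → Polynomial (MvPolynomial (Fin c) k)),
        (∀ i, (F i).natDegree < n ∨ F i = 0) →
        ∑ i, MvPolynomial.aeval (fun j : Fin (c+1) => y j)
          ((MvPolynomial.finSuccEquiv k c).symm (F i)) • e i ∈ V → F = 0 := by
      intro n
      induction n with
      | zero =>
        intro F hF _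
        funext i
        simpa using hF i
      | succ n ihn =>
        intro F hF hV
        have e1 : ∀ i, MvPolynomial.aeval (fun j : Fin (c+1) => y j)
            ((MvPolynomial.finSuccEquiv k c).symm (F i)) =
            MvPolynomial.aeval (fun j : Fin c => y (j+1)) ((F i).coeff 0) +
            y 0 * MvPolynomial.aeval (fun j : Fin (c+1) => y j)
            ((MvPolynomial.finSuccEquiv k c).symm ((F i).divX)) := by
          intro i
          conv_lhs => rw [← Polynomial.divX_mul_X_add (F i)]
          have e2 : (MvPolynomial.finSuccEquiv k c).symm Polynomial.X = MvPolynomial.X 0 := by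
            rw [AlgEquiv.symm_apply_eq, MvPolynomial.finSuccEquiv_X_zero]
          have e3 : (MvPolynomial.finSuccEquiv k c).symm (Polynomial.C ((F i).coeff 0)) =
              MvPolynomial.rename Fin.succ ((F i).coeff 0) := by
            rw [AlgEquiv.symm_apply_eq]
            induction (F i).coeff 0 using MvPolynomial.induction_on with
            | C a => simp [MvPolynomial.finSuccEquiv_apply]
            | add p q hp hq => simp only [map_add, hp, hq]
            | mul_X p j hp =>
              simp only [map_mul, hp, MvPolynomial.rename_X, MvPolynomial.finSuccEquiv_X_succ]
          rw [map_add, map_mul, map_add, map_mul, e2, e3, MvPolynomial.aeval_X,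
            MvPolynomial.aeval_rename, add_comm, mul_comm]
          rfl
        have h0 : (fun i => (F i).coeff 0) = 0 := by
          apply ih
          rw [mem_sup_lsmul]
          refine ⟨-∑ i, MvPolynomial.aeval (fun j : Fin (c+1) => y j)
            ((MvPolynomial.finSuccEquiv k c).symm ((F i).divX)) • e i, trivial, ?_⟩
          convert hV using 1
          rw [smul_neg, sub_neg_eq_add, Finset.smul_sum, ← Finset.sum_add_distrib]
          refine Finset.sum_congr rfl fun i _ => ?_
          rw [e1 i, add_smul, mul_smul]
        have h1 : (fun i => (F i).divX) = 0 := by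
          apply ihn
          · intro i
            rcases hF i with h2 | h2
            · by_cases h3 : (F i).natDegree = 0
              · right
                rw [Polynomial.divX_eq_zero_iff]
                exact Polynomial.eq_C_of_natDegree_eq_zero h3
              · left
                rw [Polynomial.natDegree_divX_eq_natDegree_tsub_one]
                omega
            · right; simp [h2]
          · apply h.1 _ trivial
            convert hV using 1
            rw [Finset.smul_sum]
            refine Finset.sum_congr rfl fun i _ => ?_
            rw [e1 i, congrFun h0 i, Pi.zero_apply, map_zero, zero_add, mul_smul]
        funext i
        rw [← Polynomial.divX_mul_X_add (F i), congrFun h0 i, congrFun h1 i]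
        simp
    classical
    have := key (1 + ∑ i, (MvPolynomial.finSuccEquiv k c (p i)).natDegree)
      (fun i => MvPolynomial.finSuccEquiv k c (p i)) (fun i => Or.inl (by
        have := Finset.single_le_sum (f := fun i => (MvPolynomial.finSuccEquiv k c (p i)).natDegree)
          (fun i _ => Nat.zero_le _) (Finset.mem_univ i)
        omega)) (by simpa using hp)
    funext i
    have h5 := congrFun this i
    simpa using h5

theorem WReg.good [IsNoetherianRing R] {C : Type} [AddCommGroup C] [Module R C]
    [Module k C] [IsScalarTower k R C] [Module.Finite R C]
    (hf : ∀ r : R, (∀ c : C, r • c = 0) → r = 0) {P : Res R C} :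
    ∀ (c : ℕ) (y : ℕ → R) (𝔞 : Ideal R) (M : Type) [AddCommGroup M] [Module R M]
    (π : C →ₗ[R] M), Good P 𝔞 π → WReg k c y ⊤ 𝔞 →
    WReg k c y (⊤ : Submodule R C) (𝔞 • ⊤) ∧
      ∃ (M' : Type) (_ : AddCommGroup M') (_ : Module R M') (π' : C →ₗ[R] M'),
        Good P (𝔞 ⊔ Ideal.span (y '' Set.Iio c)) π'
  | 0, y, 𝔞, M, _, _, π, h, hw => by
    classical
    constructor
    · obtain ⟨t, ht0, ht⟩ := hw
      obtain ⟨s, hs⟩ := (Module.Finite.fg_top : (⊤ : Submodule R C).FG)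
      refine ⟨Finset.image₂ (fun r c => r • c) t s, fun _ _ => trivial, fun u _ => ?_⟩
      have hu : u ∈ Submodule.span R (s : Set C) := by rw [hs]; trivial
      suffices H : ∀ a : R, ∃ w ∈ Submodule.span k
          ((Finset.image₂ (fun (r : R) (c : C) => r • c) t s : Finset C) : Set C),
          a • u - w ∈ 𝔞 • (⊤ : Submodule R C) by
        simpa using H 1
      induction hu using Submodule.span_induction with
      | zero => exact fun a => ⟨0, zero_mem _, by simp⟩
      | add x z _ _ hx hz =>
        intro r
        obtain ⟨a, ha, ha'⟩ := hx trivial r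
        obtain ⟨b, hb, hb'⟩ := hz trivial r
        exact ⟨a + b, add_mem ha hb, by rw [smul_add, add_sub_add_comm]; exact add_mem ha' hb'⟩
      | mem x hx =>
        intro a
        obtain ⟨w, hw, hw'⟩ := ht a trivial
        refine ⟨w • x, ?_, by rw [← sub_smul]; exact Submodule.smul_mem_smul hw' trivial⟩
        have h3 := Submodule.mem_map_of_mem
          (f := (LinearMap.toSpanSingleton R C x).restrictScalars k) hw
        rw [Submodule.map_span] at h3
        refine Submodule.span_mono ?_ h3
        rintro _ ⟨r, hr, rfl⟩
        rw [Finset.coe_image₂]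
        exact ⟨r, hr, x, hx, rfl⟩
      | smul a x _ hx =>
        intro r
        rw [← mul_smul]
        exact hx trivial _
    · simpa using ⟨M, _, _, π, h⟩
  | (c+1), y, 𝔞, M, _, _, π, h, hw => by
    have hreg : IsSMulRegular M (y 0) := h.regular hf (fun r hr => hw.1 r trivial hr)
    have e1 : 𝔞 ⊔ Submodule.map (LinearMap.lsmul R R (y 0)) ⊤ = 𝔞 ⊔ Ideal.span {y 0} := by
      congr 1
      ext r
      simp [Ideal.mem_span_singleton, dvd_def, eq_comm]
    have hw2 := hw.2
    rw [e1] at hw2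
    obtain ⟨h1, M', i1, i2, π', h2⟩ := WReg.good hf c _ _ _ _ (h.step hreg) hw2
    refine ⟨⟨?_, ?_⟩, M', i1, i2, π', ?_⟩
    · intro u _ hu
      rw [← h.ker, LinearMap.mem_ker] at hu ⊢
      rw [map_smul] at hu
      exact (isSMulRegular_iff_right_eq_zero_of_smul.1 hreg) _ hu
    · convert h1 using 2
      rw [Submodule.sup_smul]
      congr 1
      ext r
      rw [Submodule.ideal_span_singleton_smul]
      simp [Submodule.mem_smul_pointwise_iff_exists]
    · convert h2 using 1
      rw [sup_assoc]
      congr 1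
      rw [← Ideal.span_union]
      congr 1
      ext r
      simp only [Set.mem_image, Set.mem_Iio, Set.singleton_union, Set.mem_insert_iff]
      constructor
      · rintro ⟨i, hi, rfl⟩
        rcases i with _ | i
        · exact Or.inl rfl
        · exact Or.inr ⟨i, by omega, rfl⟩
      · rintro (rfl | ⟨i, hi, rfl⟩)
        · exact ⟨0, by omega, rfl⟩
        · exact ⟨i+1, by omega, rfl⟩

end

end

section
open scoped TensorProduct

theorem ker_killed {P : Type} [CommRing P] (𝔪 : Ideal P) [h𝔪 : 𝔪.IsMaximal] {W U : Type}
    [AddCommGroup W] [Module P W] [AddCommGroup U] [Module P U] [Module.Finite P W]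
    [Module.Projective P U] (μ : W →ₗ[P] U)
    (h : ∀ z, μ z ∈ 𝔪 • (⊤ : Submodule P U) → z ∈ 𝔪 • (⊤ : Submodule P W)) :
    ∃ g, g ∉ 𝔪 ∧ ∀ z, μ z = 0 → g • z = 0 := by
  letI : Field (P ⧸ 𝔪) := Ideal.Quotient.field 𝔪
  let μ' : (W ⧸ 𝔪 • (⊤ : Submodule P W)) →ₗ[P] (U ⧸ 𝔪 • (⊤ : Submodule P U)) :=
    Submodule.mapQ _ _ μ (by
      rw [← Submodule.map_le_iff_le_comap, Submodule.map_smul'']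
      exact Submodule.smul_mono le_rfl le_top)
  have hs : Function.Surjective (algebraMap P (P ⧸ 𝔪)) := Ideal.Quotient.mk_surjective
  let μ'' : (W ⧸ 𝔪 • (⊤ : Submodule P W)) →ₗ[P ⧸ 𝔪] (U ⧸ 𝔪 • (⊤ : Submodule P U)) :=
    LinearMap.extendScalarsOfSurjective hs μ'
  obtain ⟨ρ, hρ⟩ := LinearMap.exists_leftInverse_of_injective μ'' (by
    rw [LinearMap.ker_eq_bot, injective_iff_map_eq_zero]
    intro y hy
    obtain ⟨z, rfl⟩ := Submodule.Quotient.mk_surjective _ y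
    rw [Submodule.Quotient.mk_eq_zero]
    apply h
    exact (Submodule.Quotient.mk_eq_zero _).1 hy)
  obtain ⟨σ, hσ⟩ := Module.projective_lifting_property (Submodule.mkQ (𝔪 • (⊤ : Submodule P W)))
    ((ρ.restrictScalars P) ∘ₗ Submodule.mkQ (𝔪 • (⊤ : Submodule P U))) (Submodule.mkQ_surjective _)
  let φ : Module.End P W := LinearMap.id - σ ∘ₗ μ
  have hφ : LinearMap.range φ ≤ 𝔪 • ⊤ := by
    rintro _ ⟨z, rfl⟩
    rw [← Submodule.Quotient.mk_eq_zero]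
    have h1 := congrArg (fun f => f (μ z)) hσ
    have h2 := congrArg (fun f => f (Submodule.Quotient.mk z)) hρ
    simp only [LinearMap.comp_apply, LinearMap.restrictScalars_apply, Submodule.mkQ_apply] at h1
    simp only [φ, LinearMap.sub_apply, LinearMap.id_apply, LinearMap.comp_apply,
      Submodule.Quotient.mk_sub, h1]
    rw [sub_eq_zero]
    exact h2.symm
  obtain ⟨p, hp1, hp2, hp3, hp4⟩ :=
    LinearMap.exists_monic_and_natDegree_eq_and_coeff_mem_pow_and_aeval_eq_zero P φ 𝔪 hφ
  refine ⟨p.eval 1, ?_, ?_⟩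
  · intro hm
    rw [Polynomial.eval_eq_sum_range, Finset.sum_range_succ] at hm
    have h1 : ∑ x ∈ Finset.range p.natDegree, p.coeff x * 1 ^ x ∈ 𝔪 := by
      refine Ideal.sum_mem _ fun i hi => ?_
      have hi' := Finset.mem_range.1 hi
      refine Ideal.mul_mem_right _ _ ?_
      exact Ideal.pow_le_self (by omega) (hp3 i)
    rw [hp1.coeff_natDegree] at hm
    have h2 := (Ideal.add_mem_iff_right _ h1).1 hm
    exact h𝔪.ne_top ((Ideal.eq_top_iff_one _).2 (by simpa using h2))
  · intro z hz
    have h1 : φ z = z := by simp [φ, hz]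
    have h2 : ∀ q : Polynomial P, Polynomial.aeval φ q z = q.eval 1 • z := by
      intro q
      induction q using Polynomial.induction_on' with
      | add a b ha hb => simp [ha, hb, add_smul]
      | monomial n a =>
        have h3 : (φ ^ n) z = z := by
          induction n with
          | zero => simp
          | succ n ih => rw [pow_succ, Module.End.mul_apply, h1, ih]
        simp [Polynomial.aeval_monomial, h3]
    rw [← h2, hp4]; rfl

section
variable {P R : Type} [CommRing P] [CommRing R] [Algebra P R] (𝔪 : Ideal P) [h𝔪 : 𝔪.IsMaximal]

/-- detecting membership in `𝔪 W` by functionals -/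
theorem exists_functional {W : Type} [AddCommGroup W] [Module P W] {z : W}
    (hz : z ∉ 𝔪 • (⊤ : Submodule P W)) : ∃ ℓ : W →ₗ[P] P ⧸ 𝔪, ℓ z ≠ 0 := by
  letI : Field (P ⧸ 𝔪) := Ideal.Quotient.field 𝔪
  by_contra! hc
  apply hz
  rw [← Submodule.Quotient.mk_eq_zero, ← Module.forall_dual_apply_eq_zero_iff (P ⧸ 𝔪)]
  intro φ
  exact hc ((φ.restrictScalars P) ∘ₗ Submodule.mkQ (𝔪 • (⊤ : Submodule P W)))

variable {C N M A : Type} [AddCommGroup C] [Module R C] [Module P C] [IsScalarTower P R C]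
  [AddCommGroup N] [Module R N] [Module P N] [IsScalarTower P R N]
  [AddCommGroup M] [Module R M]
  [AddCommGroup A] [Module R A] [Module P A] [IsScalarTower P R A]

/-- perfect `R`-balanced pairing over `P` -/
structure Perfect (β : C →ₗ[P] N →ₗ[P] P) (R : Type) [CommRing R] [Module R C] [Module R N] :
    Prop where
  bal : ∀ (r : R) c n, β (r • c) n = β c (r • n)
  dual : ∃ (ι : Type) (_ : Fintype ι) (c : ι → C) (n : ι → N),
    (∀ x, x = ∑ i, β x (n i) • c i) ∧ (∀ x, x = ∑ i, β (c i) x • n i)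

variable {𝔪}

theorem Perfect.sep {β : C →ₗ[P] N →ₗ[P] P} (hβ : Perfect β R) {c : C} (h : ∀ n, β c n ∈ 𝔪) :
    c ∈ 𝔪 • (⊤ : Submodule P C) := by
  obtain ⟨ι, _, e, f, h1, h2⟩ := hβ.dual
  rw [h1 c]
  exact Submodule.sum_mem _ fun i _ => Submodule.smul_mem_smul (h _) trivial

theorem Perfect.represent {β : C →ₗ[P] N →ₗ[P] P} (hβ : Perfect β R)
    {π : C →ₗ[R] M} (hπ : ∀ c, π c = 0 ↔ c ∈ 𝔪 • (⊤ : Submodule P C))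
    (ℓ : A → N → P ⧸ 𝔪) (h1 : ∀ a a' n, ℓ (a + a') n = ℓ a n + ℓ a' n)
    (h2 : ∀ a n n', ℓ a (n + n') = ℓ a n + ℓ a n')
    (h3 : ∀ (r : R) a n, ℓ (r • a) n = ℓ a (r • n))
    (h4 : ∀ (p : P) a n, ℓ a (p • n) = p • ℓ a n) :
    ∃ θ : A →ₗ[R] M, ∀ a c, π c = θ a → ∀ n, Ideal.Quotient.mk 𝔪 (β c n) = ℓ a n := by
  have hsep : ∀ c, (∀ n, Ideal.Quotient.mk 𝔪 (β c n) = 0) → π c = 0 := fun c hc =>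
    (hπ c).2 (hβ.sep fun n => Ideal.Quotient.eq_zero_iff_mem.1 (hc n))
  have hsep' : ∀ c c', π c = π c' → ∀ n, Ideal.Quotient.mk 𝔪 (β c n) = Ideal.Quotient.mk 𝔪 (β c' n) := by
    intro c c' hc n
    have : c - c' ∈ 𝔪 • (⊤ : Submodule P C) := (hπ _).1 (by rw [map_sub, hc, sub_self])
    rw [Ideal.Quotient.mk_eq_mk_iff_sub_mem, ← LinearMap.sub_apply, ← map_sub]
    refine Submodule.smul_induction_on (p := fun x => β x n ∈ 𝔪) this ?_ ?_
    · intro r hr x _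
      rw [map_smul, LinearMap.smul_apply]
      exact Ideal.mul_mem_right _ _ hr
    · intro x y hx hy
      rw [map_add, LinearMap.add_apply]
      exact add_mem hx hy
  have hex : ∀ a, ∃ c, ∀ n, Ideal.Quotient.mk 𝔪 (β c n) = ℓ a n := by
    intro a
    obtain ⟨ι, _, e, f, h5, h6⟩ := hβ.dual
    choose p hp using fun i => Ideal.Quotient.mk_surjective (ℓ a (f i))
    refine ⟨∑ i, p i • e i, fun n => ?_⟩
    let L : N →+ P ⧸ 𝔪 := AddMonoidHom.mk' (ℓ a) (h2 a)
    have h7 : ℓ a n = L n := rfl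
    rw [h7]
    conv_rhs => rw [h6 n, map_sum]
    rw [map_sum, LinearMap.sum_apply, map_sum]
    refine Finset.sum_congr rfl fun i _ => ?_
    have h8 : L (β (e i) n • f i) = β (e i) n • ℓ a (f i) := h4 _ _ _
    rw [h8, ← hp, map_smul, LinearMap.smul_apply, smul_eq_mul, map_mul, Algebra.smul_def, mul_comm]
    rfl
  choose γ hγ using hex
  have e1 : ∀ c c', (∀ n, Ideal.Quotient.mk 𝔪 (β c n) = Ideal.Quotient.mk 𝔪 (β c' n)) →
      π c = π c' := by
    intro c c' h
    rw [← sub_eq_zero, ← map_sub]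
    apply hsep
    intro n
    rw [map_sub, LinearMap.sub_apply, map_sub, h, sub_self]
  refine ⟨⟨⟨fun a => π (γ a), fun a b => ?_⟩, fun r a => ?_⟩, fun a c hc n => ?_⟩
  · rw [← map_add]
    apply e1
    intro n
    rw [map_add, LinearMap.add_apply, map_add, hγ, hγ, hγ, h1]
  · simp only [RingHom.id_apply]
    rw [← map_smul]
    apply e1
    intro n
    rw [hβ.bal, hγ, hγ, h3]
  · rw [← hγ]
    exact hsep' _ _ hc n

theorem hom_mem_smul {W : Type} [AddCommGroup W] [Module P W] {L : W →+ P ⧸ 𝔪}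
    (hL : ∀ (p : P) w, L (p • w) = p • L w) {w : W} (hw : w ∈ 𝔪 • (⊤ : Submodule P W)) :
    L w = 0 := by
  refine Submodule.smul_induction_on (p := fun x => L x = 0) hw ?_ ?_
  · intro r hr x _
    rw [hL, Algebra.smul_def, Ideal.Quotient.algebraMap_eq, Ideal.Quotient.eq_zero_iff_mem.2 hr,
      zero_mul]
  · intro x y hx hy
    rw [map_add, hx, hy, add_zero]

theorem factor_one {β : C →ₗ[P] N →ₗ[P] P} (hβ : Perfect β R)
    {π : C →ₗ[R] M} (hπ : ∀ c, π c = 0 ↔ c ∈ 𝔪 • (⊤ : Submodule P C))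
    (hom : ∀ φ : C →ₗ[R] M, ∃ r : R, ∀ c, φ c = r • π c)
    {U : Type} [AddCommGroup U] [Module R U] [Module P U] [IsScalarTower P R U]
    [Module.Projective P U] [Module.Finite P (C ⊗[R] N)]
    (μ : C ⊗[R] N →ₗ[R] U) (t : U →ₗ[P] P) (hμ : ∀ c n, t (μ (c ⊗ₜ n)) = β c n) :
    ∃ g : P, g ∉ 𝔪 ∧ ∀ z, μ z = 0 → g • z = 0 := by
  refine ker_killed 𝔪 (μ.restrictScalars P) fun z hz => ?_
  by_contra hn
  obtain ⟨ℓ, hℓ⟩ := exists_functional 𝔪 hn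
  obtain ⟨θ, hθ⟩ := hβ.represent hπ (fun a n => ℓ (a ⊗ₜ[R] n))
    (fun a a' n => by rw [TensorProduct.add_tmul, map_add])
    (fun a n n' => by rw [TensorProduct.tmul_add, map_add])
    (fun r a n => by rw [TensorProduct.smul_tmul])
    (fun p a n => by
      rw [← map_smul, ← TensorProduct.tmul_smul])
  obtain ⟨r, hr⟩ := hom θ
  apply hℓ
  let L : U →+ P ⧸ 𝔪 := (Ideal.Quotient.mk 𝔪).toAddMonoidHom.comp
    (t.toAddMonoidHom.comp (LinearMap.lsmul R U r).toAddMonoidHom)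
  have hL : ∀ w, L (μ w) = ℓ w := by
    intro w
    induction w using TensorProduct.induction_on with
    | zero => simp
    | add x y hx hy => rw [map_add, map_add, hx, hy, map_add]
    | tmul c n =>
      rw [← hθ c (r • c) (by rw [hr, map_smul])]
      change Ideal.Quotient.mk 𝔪 (t (r • μ (c ⊗ₜ n))) = _
      rw [← map_smul, TensorProduct.smul_tmul', hμ]
  rw [← hL]
  refine hom_mem_smul (fun p w => ?_) hz
  change Ideal.Quotient.mk 𝔪 (t (r • (p • w))) = p • Ideal.Quotient.mk 𝔪 (t (r • w))
  rw [smul_comm, map_smul, smul_eq_mul, map_mul, Algebra.smul_def]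
  rfl

theorem factor_two {β : C →ₗ[P] N →ₗ[P] P} (hβ : Perfect β R)
    {π : C →ₗ[R] M} (hπs : Function.Surjective π)
    (hπ : ∀ c, π c = 0 ↔ c ∈ 𝔪 • (⊤ : Submodule P C))
    {F : Type} [AddCommGroup F] [Module R F] [Module P F] [IsScalarTower P R F]
    (K : Submodule R F) (hext : ∀ φ : K →ₗ[R] M, ∃ Φ : F →ₗ[R] M, ∀ x : K, Φ x = φ x)
    [Module.Projective P (F ⊗[R] N)] [Module.Finite P (K ⊗[R] N)] :
    ∃ g : P, g ∉ 𝔪 ∧ ∀ z : K ⊗[R] N, (K.subtype.rTensor N) z = 0 → g • z = 0 := by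
  refine ker_killed 𝔪 ((K.subtype.rTensor N).restrictScalars P) fun z hz => ?_
  by_contra hn
  obtain ⟨ℓ, hℓ⟩ := exists_functional 𝔪 hn
  obtain ⟨θ, hθ⟩ := hβ.represent hπ (fun (a : K) n => ℓ (a ⊗ₜ[R] n))
    (fun a a' n => by rw [TensorProduct.add_tmul, map_add])
    (fun a n n' => by rw [TensorProduct.tmul_add, map_add])
    (fun r a n => by rw [TensorProduct.smul_tmul])
    (fun p a n => by
      rw [← map_smul, ← TensorProduct.tmul_smul])
  obtain ⟨Θ, hΘ⟩ := hext θ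
  apply hℓ
  choose s hs using hπs
  have hsep' : ∀ c c', π c = π c' → ∀ n, Ideal.Quotient.mk 𝔪 (β c n) =
      Ideal.Quotient.mk 𝔪 (β c' n) := by
    intro c c' hc n
    have : c - c' ∈ 𝔪 • (⊤ : Submodule P C) := (hπ _).1 (by rw [map_sub, hc, sub_self])
    rw [Ideal.Quotient.mk_eq_mk_iff_sub_mem, ← LinearMap.sub_apply, ← map_sub]
    refine Submodule.smul_induction_on (p := fun x => β x n ∈ 𝔪) this ?_ ?_
    · intro r hr x _
      rw [map_smul, LinearMap.smul_apply]
      exact Ideal.mul_mem_right _ _ hr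
    · intro x y hx hy
      rw [map_add, LinearMap.add_apply]
      exact add_mem hx hy
  let L : F ⊗[R] N →+ P ⧸ 𝔪 := TensorProduct.liftAddHom
    (AddMonoidHom.mk' (fun f => AddMonoidHom.mk' (fun n => Ideal.Quotient.mk 𝔪 (β (s (Θ f)) n))
      (fun n n' => by rw [map_add, map_add]))
      (fun f f' => by
        ext n
        change Ideal.Quotient.mk 𝔪 (β (s (Θ (f + f'))) n) = Ideal.Quotient.mk 𝔪 (β (s (Θ f)) n)
          + Ideal.Quotient.mk 𝔪 (β (s (Θ f')) n)
        rw [← map_add, ← LinearMap.add_apply, ← map_add]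
        exact hsep' _ _ (by rw [hs, map_add, map_add, hs, hs]) n))
    (fun r f n => by
      change Ideal.Quotient.mk 𝔪 (β (s (Θ (r • f))) n) = Ideal.Quotient.mk 𝔪 (β (s (Θ f)) (r • n))
      rw [← hβ.bal]
      exact hsep' _ _ (by rw [hs, map_smul, map_smul, hs]) n)
  have hLt : ∀ f n, L (f ⊗ₜ n) = Ideal.Quotient.mk 𝔪 (β (s (Θ f)) n) := fun f n => rfl
  have hL : ∀ w, L ((K.subtype.rTensor N) w) = ℓ w := by
    intro w
    induction w using TensorProduct.induction_on with
    | zero => simp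
    | add x y hx hy => rw [map_add, map_add, hx, hy, map_add]
    | tmul a n =>
      rw [LinearMap.rTensor_tmul, hLt]
      exact hθ a _ (by rw [hs]; exact hΘ a) n
  rw [← hL]
  refine hom_mem_smul (fun p w => ?_) hz
  induction w using TensorProduct.induction_on with
  | zero => simp
  | add x y hx hy => rw [smul_add, map_add, hx, hy, map_add, smul_add]
  | tmul f n =>
    rw [← TensorProduct.tmul_smul, hLt, hLt, map_smul, smul_eq_mul, map_mul, Algebra.smul_def]
    rfl

/-- extension of maps from a syzygy, from `ExtVan`. -/
theorem ExtVan.extend {Q : Res R C} (h : ExtVan Q M) {F : Type} [AddCommGroup F] [Module R F]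
    [Module.Projective R F] (p : F →ₗ[R] C) (hp : Function.Surjective p)
    (φ : LinearMap.ker p →ₗ[R] M) : ∃ Φ : F →ₗ[R] M, ∀ x : LinearMap.ker p, Φ x = φ x := by
  obtain ⟨f, hf⟩ := Module.projective_lifting_property p Q.ε hp
  obtain ⟨g, hg⟩ := Module.projective_lifting_property Q.ε p Q.surj
  have hf' : ∀ x, p (f x) = Q.ε x := fun x => congrArg (fun f => f x) hf
  have hg' : ∀ x, Q.ε (g x) = p x := fun x => congrArg (fun f => f x) hg
  have hd : ∀ z, Q.ε (Q.d 0 z) = 0 := fun z => (Q.ex0 _).2 ⟨z, rfl⟩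
  let u : Q.X 1 →ₗ[R] LinearMap.ker p := (f ∘ₗ Q.d 0).codRestrict _ (fun z => by
    rw [LinearMap.mem_ker, LinearMap.comp_apply, hf', hd])
  obtain ⟨θ, hθ⟩ := h 0 (φ ∘ₗ u) (by
    ext z
    have : u (Q.d 1 z) = 0 := by
      apply Subtype.ext
      change f (Q.d 0 (Q.d 1 z)) = 0
      rw [Q.dd, map_zero]
    rw [LinearMap.comp_apply, LinearMap.comp_apply, this, map_zero]; rfl)
  let v : F →ₗ[R] LinearMap.ker p := (LinearMap.id - f ∘ₗ g).codRestrict _ (fun x => by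
    rw [LinearMap.mem_ker, LinearMap.sub_apply, map_sub, LinearMap.comp_apply, hf', hg']
    simp)
  refine ⟨θ ∘ₗ g + φ ∘ₗ v, fun x => ?_⟩
  obtain ⟨z, hz⟩ := (Q.ex0 (g x)).1 (by rw [hg']; exact x.2)
  have h1 : θ (g x) = φ (u z) := by
    rw [← hz]; exact (congrArg (fun f => f z) hθ).symm
  rw [LinearMap.add_apply, LinearMap.comp_apply, h1, LinearMap.comp_apply, ← map_add]
  congr 1
  apply Subtype.ext
  change f (Q.d 0 z) + (x - f (g x)) = x
  rw [hz]; abel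

end

end


section
variable {k G : Type} [Field k] [AddCommGroup G]

/-- elements supported in `A` -/
def mon (k : Type) [Field k] {G : Type} [AddCommGroup G] (A : Set G) :
    Submodule k (AddMonoidAlgebra k G) where
  carrier := {f | ∀ g, f.coeff g ≠ 0 → g ∈ A}
  zero_mem' := by
    intro g hg
    simp at hg
  add_mem' := by
    intro f h hf hh g hg
    rw [AddMonoidAlgebra.coeff_add, Finsupp.add_apply] at hg
    by_cases h1 : f.coeff g = 0
    · exact hh g (by simpa [h1] using hg)
    · exact hf g h1
  smul_mem' := by
    intro c f hf g hg
    rw [AddMonoidAlgebra.coeff_smul, Finsupp.smul_apply] at hg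
    exact hf g (fun h => hg (by rw [h, smul_zero]))

theorem mem_mon {A : Set G} {f : AddMonoidAlgebra k G} :
    f ∈ mon k A ↔ ∀ g, f.coeff g ≠ 0 → g ∈ A := Iff.rfl

theorem mon_mono {A A' : Set G} (h : A ⊆ A') : mon k A ≤ mon k A' := fun _ hf g hg => h (hf g hg)

/-- the monomial with exponent `g` -/
noncomputable def XX (k : Type) [Field k] {G : Type} [AddCommGroup G] (g : G) :
    AddMonoidAlgebra k G := AddMonoidAlgebra.single g 1

theorem coeff_XX_mul (g h : G) (f : AddMonoidAlgebra k G) :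
    (XX k g * f).coeff h = f.coeff (h - g) := by
  have := AddMonoidAlgebra.coeff_single_mul_apply (R := k) f (1 : k) g h
  rw [XX, this, one_mul]
  congr 1
  abel

theorem coeff_XX [DecidableEq G] (g h : G) : (XX k g).coeff h = if g = h then 1 else 0 := by
  rw [XX, AddMonoidAlgebra.coeff_single, Finsupp.single_apply]

theorem XX_mul (g h : G) : XX k g * XX k h = XX k (g + h) := by
  rw [XX, XX, AddMonoidAlgebra.single_mul_single, one_mul]; rfl

theorem XX_zero : XX k (0 : G) = 1 := rfl

theorem XX_pow (g : G) (n : ℕ) : XX k g ^ n = XX k (n • g) := by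
  rw [XX, AddMonoidAlgebra.single_pow, one_pow]; rfl

theorem XX_mem {A : Set G} {g : G} : XX k g ∈ mon k A ↔ g ∈ A := by
  classical
  rw [mem_mon]
  simp only [coeff_XX]
  constructor
  · intro h; exact h g (by simp)
  · intro h g' hg'
    have : g = g' := by by_contra hc; simp [hc] at hg'
    exact this ▸ h

theorem XX_ne_zero (g : G) : XX k g ≠ 0 := by
  classical
  intro h
  have := coeff_XX (k := k) g g
  rw [h] at this
  simp at this

theorem mon_mul {A A' A'' : Set G} {f h : AddMonoidAlgebra k G} (hf : f ∈ mon k A)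
    (hh : h ∈ mon k A') (hA : ∀ a ∈ A, ∀ a' ∈ A', a + a' ∈ A'') : f * h ∈ mon k A'' := by
  classical
  intro g hg
  have h1 := AddMonoidAlgebra.support_coeff_mul_subset f h (Finsupp.mem_support_iff.2 hg)
  obtain ⟨a, ha, b, hb, rfl⟩ := Finset.mem_add.1 h1
  exact hA a (hf a (Finsupp.mem_support_iff.1 ha)) b (hh b (Finsupp.mem_support_iff.1 hb))

theorem XX_mul_mem {A A' : Set G} {f : AddMonoidAlgebra k G} {g : G} (hf : f ∈ mon k A)
    (hA : ∀ a ∈ A, g + a ∈ A') : XX k g * f ∈ mon k A' := by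
  refine mon_mul (A := {g}) (XX_mem.2 rfl) hf ?_
  rintro _ rfl a ha
  exact hA a ha

theorem XX_cancel (g : G) (f : AddMonoidAlgebra k G) : XX k (-g) * (XX k g * f) = f := by
  rw [← mul_assoc, XX_mul, neg_add_cancel, XX_zero, one_mul]

theorem XX_cancel' (g : G) (f : AddMonoidAlgebra k G) : XX k g * (XX k (-g) * f) = f := by
  rw [← mul_assoc, XX_mul, add_neg_cancel, XX_zero, one_mul]

open Classical in
/-- restriction of the support -/
noncomputable def filt (p : G → Prop) : AddMonoidAlgebra k G →ₗ[k] AddMonoidAlgebra k G where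
  toFun f := AddMonoidAlgebra.ofCoeff (f.coeff.filter p)
  map_add' f g := by
    apply AddMonoidAlgebra.coeff_injective
    simp [Finsupp.filter_add]
  map_smul' c f := by
    apply AddMonoidAlgebra.coeff_injective
    simp [Finsupp.filter_smul]

open Classical in
theorem coeff_filt (p : G → Prop) (f : AddMonoidAlgebra k G) (g : G) :
    (filt p f).coeff g = if p g then f.coeff g else 0 := by
  change (f.coeff.filter p) g = _
  rw [Finsupp.filter_apply]

theorem filt_mem (p : G → Prop) {A : Set G} {f : AddMonoidAlgebra k G} (hf : f ∈ mon k A) :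
    filt p f ∈ mon k (A ∩ {g | p g}) := by
  classical
  intro g hg
  rw [coeff_filt] at hg
  by_cases hp : p g
  · rw [if_pos hp] at hg
    exact ⟨hf g hg, hp⟩
  · rw [if_neg hp] at hg
    exact absurd rfl hg

theorem filt_add_not (p : G → Prop) (f : AddMonoidAlgebra k G) :
    filt p f + filt (fun g => ¬ p g) f = f := by
  classical
  apply AddMonoidAlgebra.coeff_injective
  ext g
  rw [AddMonoidAlgebra.coeff_add, Finsupp.add_apply, coeff_filt, coeff_filt]
  by_cases hp : p g <;> simp [hp]

theorem filt_eq_self {p : G → Prop} {f : AddMonoidAlgebra k G} (hf : f ∈ mon k {g | p g}) :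
    filt p f = f := by
  classical
  apply AddMonoidAlgebra.coeff_injective
  ext g
  rw [coeff_filt]
  by_cases hp : p g
  · rw [if_pos hp]
  · rw [if_neg hp]
    by_contra hc
    exact hp (hf g (Ne.symm hc))

theorem filt_eq_zero {p : G → Prop} {f : AddMonoidAlgebra k G} (hf : f ∈ mon k {g | ¬ p g}) :
    filt p f = 0 := by
  classical
  apply AddMonoidAlgebra.coeff_injective
  ext g
  rw [coeff_filt]
  by_cases hp : p g
  · rw [if_pos hp]
    by_contra hc
    exact hf g hc hp
  · rw [if_neg hp]; rfl

theorem filt_XX_mul (p : G → Prop) (g : G) (f : AddMonoidAlgebra k G) :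
    filt p (XX k g * f) = XX k g * filt (fun h => p (g + h)) f := by
  classical
  apply AddMonoidAlgebra.coeff_injective
  ext h
  rw [coeff_filt, coeff_XX_mul, coeff_XX_mul, coeff_filt]
  simp

theorem mon_induction {A : Set G} {p : AddMonoidAlgebra k G → Prop} {f : AddMonoidAlgebra k G}
    (hf : f ∈ mon k A) (h0 : p 0) (hadd : ∀ f g, p f → p g → p (f + g))
    (hs : ∀ c : k, ∀ g ∈ A, p (c • XX k g)) : p f := by
  classical
  have h1 := AddMonoidAlgebra.mem_span_support_coeff f
  have h2 : Submodule.span k (AddMonoidAlgebra.of' k G '' f.coeff.support) ≤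
      Submodule.span k (XX k '' A) := Submodule.span_mono (by
    rintro _ ⟨g, hg, rfl⟩
    exact ⟨g, hf g (by simpa using hg), rfl⟩)
  have h3 := h2 h1
  refine Submodule.span_induction (p := fun f _ => ∀ c : k, p (c • f)) ?_ ?_ ?_ ?_ h3 1 |>
    fun h => by simpa using h
  · rintro _ ⟨g, hg, rfl⟩ c
    exact hs c g hg
  · intro c; simpa using h0
  · intro x y _ _ hx hy c
    rw [smul_add]; exact hadd _ _ (hx c) (hy c)
  · intro a x _ hx c
    rw [smul_smul]; exact hx _

/-- lowest parts multiply -/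
theorem exists_low_mul [IsDomain (AddMonoidAlgebra k G)] (κ : G →+ ℤ) {f h : AddMonoidAlgebra k G}
    {v w : ℤ} (hf : f ∈ mon k {g | v ≤ κ g}) (hh : h ∈ mon k {g | w ≤ κ g})
    (hf' : ∃ g, f.coeff g ≠ 0 ∧ κ g = v) (hh' : ∃ g, h.coeff g ≠ 0 ∧ κ g = w) :
    ∃ g, (f * h).coeff g ≠ 0 ∧ κ g = v + w := by
  classical
  set f0 := filt (fun g => κ g = v) f with hf0
  set f1 := filt (fun g => ¬ κ g = v) f with hf1
  set h0 := filt (fun g => κ g = w) h with hh0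
  set h1 := filt (fun g => ¬ κ g = w) h with hh1
  have ef : f0 + f1 = f := filt_add_not _ _
  have eh : h0 + h1 = h := filt_add_not _ _
  have hf0n : f0 ≠ 0 := by
    obtain ⟨g, hg, hg'⟩ := hf'
    intro hc
    apply hg
    have : f0.coeff g = f.coeff g := by rw [hf0, coeff_filt, if_pos hg']
    rw [← this, hc]; rfl
  have hh0n : h0 ≠ 0 := by
    obtain ⟨g, hg, hg'⟩ := hh'
    intro hc
    apply hg
    have : h0.coeff g = h.coeff g := by rw [hh0, coeff_filt, if_pos hg']
    rw [← this, hc]; rfl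
  have hn : f0 * h0 ≠ 0 := mul_ne_zero hf0n hh0n
  have : ∃ g, (f0 * h0).coeff g ≠ 0 := by
    by_contra! hc
    apply hn
    apply AddMonoidAlgebra.coeff_injective
    ext g
    rw [hc]; rfl
  obtain ⟨g, hg⟩ := this
  have m1 : f0 ∈ mon k {g | κ g = v} := mon_mono (fun x hx => hx.2) (filt_mem _ hf)
  have m2 : h0 ∈ mon k {g | κ g = w} := mon_mono (fun x hx => hx.2) (filt_mem _ hh)
  have m3 : f1 ∈ mon k {g | v < κ g} :=
    mon_mono (fun x hx => lt_of_le_of_ne hx.1 (Ne.symm hx.2)) (filt_mem _ hf)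
  have m4 : h1 ∈ mon k {g | w < κ g} :=
    mon_mono (fun x hx => lt_of_le_of_ne hx.1 (Ne.symm hx.2)) (filt_mem _ hh)
  have hgk : κ g = v + w := by
    have := mon_mul (A'' := {g | κ g = v + w}) m1 m2 (fun a ha b hb => by
      simp only [Set.mem_setOf_eq] at *
      rw [map_add]; omega)
    exact this g hg
  refine ⟨g, ?_, hgk⟩
  have e : f * h = f0 * h0 + (f0 * h1 + f1 * h) := by rw [← ef, ← eh]; ring
  have m5 : f0 * h1 + f1 * h ∈ mon k {g | v + w < κ g} := by
    refine add_mem (mon_mul m1 m4 ?_) (mon_mul m3 hh ?_) <;>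
    · intro a ha b hb
      simp only [Set.mem_setOf_eq] at *
      rw [map_add]; omega
  have z : (f0 * h1 + f1 * h).coeff g = 0 := by
    by_contra hc
    have := m5 g hc
    simp only [Set.mem_setOf_eq] at this
    omega
  rw [e, AddMonoidAlgebra.coeff_add, Finsupp.add_apply, z, add_zero]
  exact hg

/-- existence of a minimal value -/
theorem exists_low (κ : G →+ ℤ) {f : AddMonoidAlgebra k G} {v : ℤ} (hv : ∃ g, f.coeff g ≠ 0 ∧ κ g < v) :
    ∃ w, w < v ∧ f ∈ mon k {g | w ≤ κ g} ∧ ∃ g, f.coeff g ≠ 0 ∧ κ g = w := by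
  classical
  obtain ⟨g, hg, hg'⟩ := hv
  obtain ⟨g0, h0, h1⟩ := Finset.exists_min_image f.coeff.support κ ⟨g, by simpa using hg⟩
  refine ⟨κ g0, lt_of_le_of_lt (h1 g (by simpa using hg)) hg', ?_, g0, by simpa using h0, rfl⟩
  intro g1 hg1
  exact h1 g1 (by simpa using hg1)

end


section
/-- combinatorial data of the cone -/
structure CData (G Λ : Type) [AddCommGroup G] where
  T : AddSubmonoid G
  κ : Λ → G →+ ℤ
  x : G
  hx : x ∈ T
  hnx : -x ∈ T
  κx : ∀ l, κ l x = 1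
  τ : Λ → G
  hτ : ∀ l, τ l ∈ T
  κτ : ∀ l, κ l (τ l) = 0
  κτ' : ∀ l j, j ≠ l → 1 ≤ κ j (τ l)

variable {k G Λ : Type} [Field k] [AddCommGroup G]

/-- exponents of the divisorial module `I_d` -/
def CData.A (D : CData G Λ) (d : Λ → ℤ) : Set G := {g | g ∈ D.T ∧ ∀ l, d l ≤ D.κ l g}

/-- `R` is the monoid ring of `A 0` -/
structure RData (k : Type) [Field k] {G Λ : Type} [AddCommGroup G] (D : CData G Λ) (R : Type)
    [CommRing R] [Algebra R (AddMonoidAlgebra k G)] : Prop where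
  inj : Function.Injective (algebraMap R (AddMonoidAlgebra k G))
  mem : ∀ r : R, algebraMap R (AddMonoidAlgebra k G) r ∈ mon k (D.A 0)
  surj : ∀ f ∈ mon k (D.A 0), ∃ r : R, algebraMap R (AddMonoidAlgebra k G) r = f

/-- the localization at `x` is a unique factorization domain -/
def UData (k : Type) [Field k] {G Λ : Type} [AddCommGroup G] (D : CData G Λ) : Prop :=
  ∃ (Q : Type) (_ : CommRing Q) (_ : IsDomain Q) (_ : NormalizedGCDMonoid Q)
    (j : Q →+* AddMonoidAlgebra k G), Function.Injective j ∧ (∀ q, j q ∈ mon k (D.T : Set G)) ∧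
    ∀ f ∈ mon k (D.T : Set G), ∃ N : ℕ, ∀ M : ℕ, N ≤ M → ∃ q : Q, j q = XX k (M • D.x) * f

/-- consequence of Serre's condition -/
def S2 (R : Type) [CommRing R] (X : Type) [AddCommGroup X] [Module R X] : Prop :=
  ∀ (p : R) (c : X) (𝔭 : Ideal R), p ≠ 0 → 𝔭.IsPrime → (∀ s, s ∈ 𝔭 ↔ ∃ c' : X, s • c = p • c') →
    ∃ r : R, ∀ s, s ∈ 𝔭 ↔ ∃ r', s * r = p * r'

theorem S2.congr {R : Type} [CommRing R] {X X' : Type} [AddCommGroup X] [Module R X]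
    [AddCommGroup X'] [Module R X'] (h : S2 R X) (e : X ≃ₗ[R] X') : S2 R X' := by
  intro p c 𝔭 hp h𝔭 hs
  refine h p (e.symm c) 𝔭 hp h𝔭 fun s => ?_
  rw [hs]
  constructor
  · rintro ⟨c', hc'⟩
    exact ⟨e.symm c', by rw [← map_smul, hc', map_smul]⟩
  · rintro ⟨c', hc'⟩
    exact ⟨e c', by rw [← map_smul, ← hc', map_smul, e.apply_symm_apply]⟩

variable {D : CData G Λ} {R : Type} [CommRing R] [Algebra R (AddMonoidAlgebra k G)]

theorem CData.A_add {d : Λ → ℤ} {s a : G} (hs : s ∈ D.A 0) (ha : a ∈ D.A d) : s + a ∈ D.A d := by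
  refine ⟨D.T.add_mem hs.1 ha.1, fun l => ?_⟩
  have := hs.2 l
  have := ha.2 l
  rw [map_add]
  simp only [Pi.zero_apply] at *
  omega

/-- submodules given by monomial conditions -/
def monR (hR : RData k D R) (A : Set G) (hA : ∀ s ∈ D.A 0, ∀ a ∈ A, s + a ∈ A) :
    Submodule R (AddMonoidAlgebra k G) where
  carrier := mon k A
  zero_mem' := zero_mem _
  add_mem' := add_mem
  smul_mem' := by
    intro r f hf
    rw [Algebra.smul_def]
    exact mon_mul (hR.mem r) hf hA

/-- the divisorial module `I_d` -/
def Ib (hR : RData k D R) (d : Λ → ℤ) : Submodule R (AddMonoidAlgebra k G) :=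
  monR hR (D.A d) fun _ hs _ ha => CData.A_add hs ha

theorem mem_Ib {hR : RData k D R} {d : Λ → ℤ} {f : AddMonoidAlgebra k G} :
    f ∈ Ib hR d ↔ f ∈ mon k (D.A d) := Iff.rfl

theorem CData.zero_mem_A : (0 : G) ∈ D.A 0 := ⟨D.T.zero_mem, fun l => by simp⟩

theorem CData.nsmul_x_mem (N : ℕ) : N • D.x ∈ D.A 0 :=
  ⟨D.T.nsmul_mem D.hx N, fun l => by simp [D.κx]⟩

theorem CData.zsmul_x_mem_T (z : ℤ) : z • D.x ∈ D.T := by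
  rcases z.eq_nat_or_neg with ⟨n, rfl | rfl⟩
  · simpa using D.T.nsmul_mem D.hx n
  · simpa using D.T.nsmul_mem D.hnx n

/-- multiplying by a large power of `x` moves into `R` -/
theorem exists_x_mul [Finite Λ] {f : AddMonoidAlgebra k G} (hf : f ∈ mon k (D.T : Set G)) :
    ∃ N : ℕ, ∀ M : ℕ, N ≤ M → XX k (M • D.x) * f ∈ mon k (D.A 0) := by
  cases nonempty_fintype Λ
  refine mon_induction (p := fun f => ∃ N : ℕ, ∀ M : ℕ, N ≤ M →
    XX k (M • D.x) * f ∈ mon k (D.A 0)) hf ⟨0, fun M _ => by simp⟩ ?_ ?_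
  · rintro f g ⟨N, hN⟩ ⟨M, hM⟩
    refine ⟨N + M, fun K hK => ?_⟩
    rw [mul_add]
    exact add_mem (hN _ (by omega)) (hM _ (by omega))
  · intro c g hg
    refine ⟨∑ l, (D.κ l g).natAbs, fun M hM => ?_⟩
    rw [mul_smul_comm, XX_mul]
    refine Submodule.smul_mem _ _ (XX_mem.2 ⟨D.T.add_mem (D.nsmul_x_mem M).1 hg, fun l => ?_⟩)
    have : (D.κ l g).natAbs ≤ ∑ l, (D.κ l g).natAbs :=
      Finset.single_le_sum (f := fun l => (D.κ l g).natAbs) (fun _ _ => Nat.zero_le _)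
        (Finset.mem_univ l)
    rw [map_add, map_nsmul, D.κx]
    simp only [Pi.zero_apply, smul_eq_mul, nsmul_eq_mul, mul_one]
    omega

theorem mem_mon_x {N : ℕ} {f : AddMonoidAlgebra k G} :
    f ∈ mon k (D.A fun _ => (N : ℤ)) ↔ ∃ h ∈ mon k (D.A 0), f = XX k (N • D.x) * h := by
  constructor
  · intro hf
    refine ⟨XX k (-(N • D.x)) * f, XX_mul_mem hf fun a ha => ⟨?_, fun l => ?_⟩,
      (XX_cancel' _ _).symm⟩
    · refine D.T.add_mem ?_ ha.1
      simpa using D.T.nsmul_mem D.hnx N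
    · have : (N : ℤ) ≤ D.κ l a := ha.2 l
      rw [map_add, map_neg, map_nsmul, D.κx]
      simp only [Pi.zero_apply, smul_eq_mul, nsmul_eq_mul, mul_one]
      omega
  · rintro ⟨h, hh, rfl⟩
    refine XX_mul_mem hh fun a ha => ⟨D.T.add_mem (D.nsmul_x_mem N).1 ha.1, fun l => ?_⟩
    have := ha.2 l
    rw [map_add, map_nsmul, D.κx]
    simp only [Pi.zero_apply, smul_eq_mul, nsmul_eq_mul, mul_one] at *
    omega

/-- part two of the classification -/
theorem S2.eq_Ib [Finite Λ] [IsNoetherianRing R] [IsDomain (AddMonoidAlgebra k G)]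
    (hR : RData k D R) (I : Submodule R (AddMonoidAlgebra k G)) (hI : I ≤ Ib hR 0)
    {N0 : ℕ} (hN0 : XX k (N0 • D.x) ∈ I) (hS : S2 R I) : ∃ d, I = Ib hR d := by
  classical
  -- the minimal values
  have hd : ∀ l, ∃ d : ℤ, (∀ f ∈ I, ∀ g, f.coeff g ≠ 0 → d ≤ D.κ l g) ∧
      ∃ f ∈ I, ∃ g, f.coeff g ≠ 0 ∧ D.κ l g = d := by
    intro l
    obtain ⟨d, ⟨f, hf, g, hg, rfl⟩, h2⟩ := Int.exists_least_of_bdd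
      (P := fun z => ∃ f ∈ I, ∃ g, f.coeff g ≠ 0 ∧ D.κ l g = z)
      ⟨0, fun z ⟨f, hf, g, hg, hz⟩ => hz ▸ (hI hf g hg).2 l⟩
      ⟨D.κ l (N0 • D.x), _, hN0, N0 • D.x, by rw [coeff_XX]; simp, rfl⟩
    exact ⟨D.κ l g, fun f' hf' g' hg' => h2 _ ⟨f', hf', g', hg', rfl⟩, f, hf, g, hg, rfl⟩
  choose d hd1 hd2 using hd
  have hId : I ≤ Ib hR d := fun f hf g hg => ⟨(hI hf g hg).1, fun l => hd1 l f hf g hg⟩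
  refine ⟨d, le_antisymm hId fun f hf => ?_⟩
  by_contra hfI
  obtain ⟨b, 𝔭, h𝔭, hb, h1⟩ := exists_prime_ann (1 : R) (I.mkQ f) (fun j => by
    rw [one_pow, one_smul]
    simpa using hfI)
  have hb' : ∀ s, s ∈ 𝔭 ↔ s • b • f ∈ I := by
    intro s
    rw [hb, ← map_smul, ← map_smul, Submodule.mkQ_apply, Submodule.Quotient.mk_eq_zero]
  obtain ⟨M, hM⟩ := exists_x_mul (k := k) (D := D) (f := f) (mon_mono (fun g hg => hg.1) hf)
  obtain ⟨q, hq⟩ := hR.surj _ (hM M le_rfl)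
  set N := M + N0 with hN
  have hxf : XX k (N • D.x) * f ∈ I := by
    rw [hN, add_smul, add_comm, ← XX_mul, mul_assoc, ← hq, mul_comm, ← Algebra.smul_def]
    exact I.smul_mem _ hN0
  obtain ⟨p, hp⟩ := hR.surj _ (XX_mem (k := k).2 (D.nsmul_x_mem N))
  have hp0 : p ≠ 0 := by
    rintro rfl
    rw [map_zero] at hp
    exact XX_ne_zero _ hp.symm
  have hpf : p • b • f ∈ I := by
    rw [smul_comm, Algebra.smul_def p, hp]
    exact I.smul_mem _ hxf
  obtain ⟨r, hr⟩ := hS p ⟨_, hpf⟩ 𝔭 hp0 h𝔭 (fun s => by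
    rw [hb']
    constructor
    · intro h
      refine ⟨⟨_, h⟩, Subtype.ext ?_⟩
      change s • p • b • f = p • s • b • f
      rw [smul_comm]
    · rintro ⟨⟨c, hc⟩, hc'⟩
      have e : s • p • b • f = p • c := congrArg Subtype.val hc'
      rw [smul_comm, Algebra.smul_def p, Algebra.smul_def p, hp] at e
      rw [mul_left_cancel₀ (XX_ne_zero _) e]
      exact hc)
  have hxR : ∀ r : R, (∃ r', r = p * r') ↔ algebraMap R (AddMonoidAlgebra k G) r ∈
      mon k (D.A fun _ => (N : ℤ)) := by
    intro r
    rw [mem_mon_x]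
    constructor
    · rintro ⟨r', rfl⟩
      exact ⟨_, hR.mem r', by rw [map_mul, hp]⟩
    · rintro ⟨h, hh, e⟩
      obtain ⟨r', rfl⟩ := hR.surj h hh
      exact ⟨r', hR.inj (by rw [e, map_mul, hp])⟩
  have hrn : ¬ algebraMap R (AddMonoidAlgebra k G) r ∈ mon k (D.A fun _ => (N : ℤ)) := by
    rw [← hxR]
    intro h
    apply h1
    rw [hr]; simpa using h
  rw [mem_mon] at hrn
  push Not at hrn
  obtain ⟨g, hg, hgA⟩ := hrn
  have : ∃ l, D.κ l g < N := by
    by_contra! hc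
    exact hgA ⟨(hR.mem r g hg).1, hc⟩
  obtain ⟨l, hl⟩ := this
  obtain ⟨w, hw, hw1, hw2⟩ := exists_low (D.κ l) ⟨g, hg, hl⟩
  -- an element of `𝔭`
  obtain ⟨h, hhI, g', hg', hgd⟩ := hd2 l
  cases nonempty_fintype Λ
  let K : ℕ := ∑ j, (d l - d j).natAbs
  have hK : ∀ j, (d l - d j).natAbs ≤ K := fun j =>
    Finset.single_le_sum (f := fun j => (d l - d j).natAbs) (fun _ _ => Nat.zero_le _)
        (Finset.mem_univ j)
  let v : G := (-d l) • D.x + K • D.τ l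
  have hvT : v ∈ D.T := D.T.add_mem (D.zsmul_x_mem_T _) (D.T.nsmul_mem (D.hτ l) _)
  have hvl : D.κ l v = - d l := by
    simp only [v, map_add, map_zsmul, map_nsmul, D.κx, D.κτ]
    simp
  have hvj : ∀ j, - d j ≤ D.κ j v := by
    intro j
    by_cases hj : j = l
    · rw [hj, hvl]
    · simp only [v, map_add, map_zsmul, map_nsmul, D.κx]
      have h2 := D.κτ' l j hj
      have h3 := hK j
      simp only [smul_eq_mul, mul_one, nsmul_eq_mul]
      have : (K : ℤ) * 1 ≤ (K : ℤ) * D.κ j (D.τ l) := mul_le_mul_of_nonneg_left h2 (by positivity)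
      omega
  have hvA : ∀ f ∈ Ib hR d, XX k v * f ∈ mon k (D.A 0) := by
    intro f hf
    refine XX_mul_mem hf fun a ha => ⟨D.T.add_mem hvT ha.1, fun j => ?_⟩
    have := ha.2 j
    have := hvj j
    rw [map_add]
    simp only [Pi.zero_apply]
    omega
  obtain ⟨s, hs⟩ := hR.surj _ (hvA h (hId hhI))
  obtain ⟨q', hq'⟩ := hR.surj _ (hvA f hf)
  have hs𝔭 : s ∈ 𝔭 := by
    rw [hb', smul_comm]
    refine I.smul_mem _ ?_
    have : s • f = q' • h := by
      rw [Algebra.smul_def, Algebra.smul_def, hs, hq']; ring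
    rw [this]
    exact I.smul_mem _ hhI
  obtain ⟨r', hr'⟩ := (hr s).1 hs𝔭
  have h5 := (hxR _).1 ⟨r', hr'⟩
  have h6 : algebraMap R (AddMonoidAlgebra k G) s ∈ mon k {g | 0 ≤ D.κ l g} :=
    mon_mono (fun g hg => hg.2 l) (hR.mem s)
  obtain ⟨g2, hg2, hg3⟩ := exists_low_mul (D.κ l) h6 hw1 ⟨v + g', by
    rw [hs, coeff_XX_mul]; simpa using hg', by rw [map_add, hvl, hgd]; simp⟩ hw2
  rw [← map_mul] at hg2
  have h7 := (h5 g2 hg2).2 l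
  simp only [] at h7
  omega

/-- classification of rank one `S2` modules -/
theorem S2.exists_iso [Finite Λ] [IsNoetherianRing R] [IsDomain (AddMonoidAlgebra k G)]
    (hR : RData k D R) (hU : UData k D) {X : Type} [AddCommGroup X] [Module R X]
    [Module.Finite R X] [Nontrivial X] (θ : X →ₗ[R] R) (hθ : Function.Injective θ)
    (hS : S2 R X) : ∃ d, Nonempty (X ≃ₗ[R] Ib hR d) := by
  classical
  obtain ⟨Q, _, _, _, j, hj, hjT, hjs⟩ := hU
  obtain ⟨s, hs⟩ := (Module.Finite.fg_top : (⊤ : Submodule R X).FG)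
  let B := AddMonoidAlgebra k G
  let aθ : X → B := fun c => algebraMap R B (θ c)
  have haθT : ∀ r : R, algebraMap R B r ∈ mon k (D.T : Set G) := fun r =>
    mon_mono (fun g hg => hg.1) (hR.mem r)
  choose N hN using fun r : R => hjs _ (haθT r)
  let N1 := ∑ c ∈ s, N (θ c)
  have hN1 : ∀ c ∈ s, N (θ c) ≤ N1 := fun c hc =>
    Finset.single_le_sum (f := fun c => N (θ c)) (fun _ _ => Nat.zero_le _) hc
  have hq : ∀ c, ∃ q : Q, c ∈ s → j q = XX k (N1 • D.x) * aθ c := by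
    intro c
    by_cases hc : c ∈ s
    · obtain ⟨q, h⟩ := hN (θ c) N1 (hN1 c hc)
      exact ⟨q, fun _ => h⟩
    · exact ⟨0, fun h => absurd h hc⟩
  choose q hq using hq
  obtain ⟨c1, hc1, hc1n⟩ : ∃ c ∈ s, c ≠ 0 := by
    by_contra! hc
    have h1 : Submodule.span R (s : Set X) ≤ ⊥ := Submodule.span_le.2 fun c h => hc c h
    rw [hs] at h1
    obtain ⟨x, hx⟩ := exists_ne (0 : X)
    exact hx (h1 trivial)
  obtain ⟨g, hg, hg1⟩ := Finset.extract_gcd q ⟨c1, hc1⟩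
  have haθ : ∀ c, c ≠ 0 → aθ c ≠ 0 := by
    intro c hc h
    apply hc
    apply hθ
    apply hR.inj
    rw [map_zero, map_zero]; exact h
  have hqn : q c1 ≠ 0 := by
    intro h
    have := hq c1 hc1
    rw [h, map_zero] at this
    exact mul_ne_zero (XX_ne_zero _) (haθ c1 hc1n) this.symm
  set γ := s.gcd q with hγ
  have hγn : j γ ≠ 0 := by
    rw [Ne, map_eq_zero_iff j hj]
    intro h
    exact hqn (by rw [hg c1 hc1, h, zero_mul])
  choose N' hN' using fun c => exists_x_mul (k := k) (D := D) (hjT (g c))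
  let N2 := ∑ c ∈ s, N' c
  have hN2 : ∀ c ∈ s, N' c ≤ N2 := fun c hc =>
    Finset.single_le_sum (f := fun c => N' c) (fun _ _ => Nat.zero_le _) hc
  have hgen : ∀ c ∈ s, XX k ((N2 + N1) • D.x) * aθ c = j γ * (XX k (N2 • D.x) * j (g c)) := by
    intro c hc
    rw [add_smul, ← XX_mul, mul_assoc, ← hq c hc, hg c hc, map_mul]; ring
  have hex : ∀ c, ∃ f ∈ Ib hR 0, XX k ((N2 + N1) • D.x) * aθ c = j γ * f := by
    intro c
    have hc : c ∈ Submodule.span R (s : Set X) := by rw [hs]; trivial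
    induction hc using Submodule.span_induction with
    | zero => exact ⟨0, zero_mem _, by simp [aθ]⟩
    | mem c hc => exact ⟨_, hN' c N2 (hN2 c hc), hgen c hc⟩
    | add a b _ _ ha hb =>
      obtain ⟨f, hf, e⟩ := ha
      obtain ⟨f', hf', e'⟩ := hb
      refine ⟨f + f', add_mem hf hf', ?_⟩
      have : aθ (a + b) = aθ a + aθ b := by simp [aθ]
      rw [this, mul_add, mul_add, e, e']
    | smul r a _ ha =>
      obtain ⟨f, hf, e⟩ := ha
      refine ⟨r • f, Submodule.smul_mem _ _ hf, ?_⟩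
      have : aθ (r • a) = algebraMap R B r * aθ a := by simp [aθ]
      rw [this, Algebra.smul_def, mul_left_comm, e]; ring
  choose Θ hΘ0 hΘ using hex
  have hΘg : ∀ c ∈ s, Θ c = XX k (N2 • D.x) * j (g c) := fun c hc =>
    mul_left_cancel₀ hγn (by rw [← hΘ, hgen c hc])
  let Θ' : X →ₗ[R] B :=
    { toFun := Θ
      map_add' := fun a b => mul_left_cancel₀ hγn (by
        have : aθ (a + b) = aθ a + aθ b := by simp [aθ]
        rw [← hΘ, this, mul_add, mul_add, hΘ, hΘ])
      map_smul' := fun r a => mul_left_cancel₀ hγn (by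
        have : aθ (r • a) = algebraMap R B r * aθ a := by simp [aθ]
        rw [← hΘ, this, RingHom.id_apply, Algebra.smul_def, mul_left_comm, hΘ]; ring) }
  have hΘn : ∀ c, c ≠ 0 → Θ c ≠ 0 := by
    intro c hc h
    have := hΘ c
    rw [h, mul_zero] at this
    exact mul_ne_zero (XX_ne_zero _) (haθ c hc) this
  have hinj : Function.Injective Θ' := by
    rw [injective_iff_map_eq_zero]
    intro c hc
    by_contra h
    exact hΘn c h hc
  let I := LinearMap.range Θ'
  let e : X ≃ₗ[R] I := LinearEquiv.ofInjective Θ' hinj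
  have hI0 : I ≤ Ib hR 0 := by
    rintro _ ⟨c, rfl⟩
    exact hΘ0 c
  have hΘI : ∀ c, Θ c ∈ I := fun c => ⟨c, rfl⟩
  have hSI : S2 R I := hS.congr e
  suffices H : ∃ N : ℕ, XX k (N • D.x) ∈ I by
    obtain ⟨N, hN⟩ := H
    obtain ⟨d, hd⟩ := S2.eq_Ib hR I hI0 hN hSI
    exact ⟨d, ⟨e.trans (LinearEquiv.ofEq _ _ hd)⟩⟩
  by_contra! hno
  obtain ⟨xh, hxh⟩ := hR.surj (XX k D.x) (XX_mem.2 (by simpa using D.nsmul_x_mem 1))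
  have hxp : ∀ n : ℕ, algebraMap R B (xh ^ n) = XX k (n • D.x) := fun n => by
    rw [map_pow, hxh, XX_pow]
  obtain ⟨b, 𝔭, h𝔭, hb, hx𝔭⟩ := exists_prime_ann xh (I.mkQ 1) (fun n => by
    rw [← map_smul, Submodule.mkQ_apply, Ne, Submodule.Quotient.mk_eq_zero, Algebra.smul_def, hxp,
      mul_one]
    exact hno n)
  have hb' : ∀ s, s ∈ 𝔭 ↔ algebraMap R B (s * b) ∈ I := by
    intro s
    rw [hb, ← map_smul, ← map_smul, Submodule.mkQ_apply, Submodule.Quotient.mk_eq_zero,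
      ← mul_smul, Algebra.smul_def, mul_one]
  choose P hP using fun c => hR.surj _ (hΘ0 c)
  have hP0 : P c1 ≠ 0 := by
    intro h
    have := hP c1
    rw [h, map_zero] at this
    exact hΘn c1 hc1n this.symm
  have hPb : ∀ c, algebraMap R B (P c * b) ∈ I := by
    intro c
    rw [mul_comm, map_mul, hP, ← Algebra.smul_def]
    exact I.smul_mem _ (hΘI c)
  obtain ⟨r, hr⟩ := hSI (P c1) ⟨_, hPb c1⟩ 𝔭 hP0 h𝔭 (fun s => by
    rw [hb']
    constructor
    · intro h
      refine ⟨⟨_, h⟩, Subtype.ext ?_⟩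
      change s • algebraMap R B (P c1 * b) = P c1 • algebraMap R B (s * b)
      rw [Algebra.smul_def, Algebra.smul_def, ← map_mul, ← map_mul]
      congr 1; ring
    · rintro ⟨⟨c, hc⟩, hc'⟩
      have e : s • algebraMap R B (P c1 * b) = P c1 • c := congrArg Subtype.val hc'
      rw [Algebra.smul_def, Algebra.smul_def, map_mul, mul_left_comm, ← map_mul, hP] at e
      rw [mul_left_cancel₀ (hΘn c1 hc1n) e]
      exact hc)
  choose! r' hr' using fun c => (hr (P c)).1 ((hb' _).2 (hPb c))
  -- common exponent
  let M := N r + ∑ c ∈ s, N (r' c)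
  have hM : ∀ c ∈ s, N (r' c) ≤ M := fun c hc =>
    le_trans (Finset.single_le_sum (f := fun c => N (r' c)) (fun _ _ => Nat.zero_le _) hc)
      (Nat.le_add_left _ _)
  obtain ⟨ρ, hρ⟩ := hN r M (Nat.le_add_right _ _)
  have hdiv : ∀ c ∈ s, g c1 ∣ g c * ρ := by
    intro c hc
    obtain ⟨σ, hσ⟩ := hN (r' c) M (hM c hc)
    refine ⟨σ, hj ?_⟩
    rw [map_mul, map_mul, hρ, hσ]
    have e := congrArg (algebraMap R B) (hr' c)
    rw [map_mul, map_mul, hP, hP, hΘg c hc, hΘg c1 hc1] at e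
    apply mul_left_cancel₀ (XX_ne_zero (k := k) (N2 • D.x))
    linear_combination XX k (M • D.x) * e
  have hd2 : g c1 ∣ ρ := by
    have h1 := Finset.dvd_gcd (s := s) (f := fun c => g c * ρ) hdiv
    have h2 := h1.trans (Finset.gcd_mul_right' s g ρ).dvd
    rwa [hg1, one_mul] at h2
  obtain ⟨t, rfl⟩ := hd2
  obtain ⟨M', hM'⟩ := exists_x_mul (k := k) (D := D) (hjT t)
  obtain ⟨t', ht'⟩ := hR.surj _ (hM' M' le_rfl)
  have hfin : xh ^ (M + M' + N2) ∈ 𝔭 := by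
    rw [hr]
    refine ⟨t', hR.inj ?_⟩
    rw [map_mul, map_mul, hxp, hP, hΘg c1 hc1, ht', add_smul, add_smul, ← XX_mul, ← XX_mul]
    rw [map_mul] at hρ
    linear_combination (-XX k (N2 • D.x) * XX k (M' • D.x)) * hρ
  exact hx𝔭 (h𝔭.mem_of_pow_mem _ hfin)

end


section
variable {R : Type} [CommRing R] [IsDomain R] [IsNoetherianRing R]
  {C : Type} [AddCommGroup C] [Module R C]

theorem SD.torsionFree (h : SD R C) {r : R} (hr : r ≠ 0) {c : C} (hc : r • c = 0) : c = 0 := by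
  have := h.fin
  obtain ⟨P, hP⟩ := Good.of_sd h
  have h1 := Good.regular h.faithful hP (y := r) (fun s hs => by
    rw [Ideal.mem_bot] at *
    exact (mul_eq_zero.1 hs).resolve_left hr)
  exact (isSMulRegular_iff_right_eq_zero_of_smul.1 h1) c hc

theorem SD.embed (h : SD R C) : ∃ θ : C →ₗ[R] R, Function.Injective θ := by
  have := h.fin
  obtain ⟨θ, c0, h0⟩ := exists_hom_quot h.faithful (⊥ : Ideal R)
  let e : (R ⧸ (⊥ : Ideal R)) ≃ₗ[R] R := Submodule.quotEquivOfEqBot ⊥ rfl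
  let θ' : C →ₗ[R] R := e.toLinearMap ∘ₗ θ
  have h1 : θ' c0 ≠ 0 := by
    intro h1
    exact h0 (e.injective (by rw [map_zero]; exact h1))
  obtain ⟨r, hr⟩ := h.hom (LinearMap.toSpanSingleton R C c0 ∘ₗ θ')
  have hr' : ∀ c, θ' c • c0 = r • c := hr
  have hc0 : c0 ≠ 0 := by
    rintro rfl
    exact h1 (map_zero _)
  have hr0 : r ≠ 0 := by
    rintro rfl
    have := hr' c0
    rw [zero_smul] at this
    exact hc0 (h.torsionFree h1 this)
  refine ⟨θ', (injective_iff_map_eq_zero _).2 fun c hc => ?_⟩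
  have := hr' c
  rw [hc, zero_smul] at this
  exact h.torsionFree hr0 this.symm

theorem SD.nontrivial (h : SD R C) : Nontrivial C := by
  by_contra hc
  rw [not_nontrivial_iff_subsingleton] at hc
  exact one_ne_zero (h.faithful 1 fun c => Subsingleton.elim _ _)

theorem SD.s2 (h : SD R C) : S2 R C := by
  have := h.fin
  obtain ⟨P, hP⟩ := Good.of_sd h
  intro p c 𝔭 hp h𝔭 hs
  have h1 := Good.regular h.faithful hP (y := p) (fun s hs => by
    rw [Ideal.mem_bot] at *
    exact (mul_eq_zero.1 hs).resolve_left hp)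
  have h2 := hP.step h1
  obtain ⟨r, hr⟩ := Good.assoc h.faithful h2 𝔭 (Submodule.Quotient.mk c) (fun s => by
    rw [hs]
    constructor
    · rintro ⟨c', hc'⟩
      rw [← Submodule.Quotient.mk_smul, hc']
      exact quotSMulTop_smul c'
    · intro h3
      rw [← Submodule.Quotient.mk_smul] at h3
      exact mem_quotSMulTop h3)
  refine ⟨r, fun s => ?_⟩
  rw [hr, bot_sup_eq, Ideal.mem_span_singleton']
  constructor
  · rintro ⟨a, ha⟩
    exact ⟨a, by rw [← ha, mul_comm]⟩
  · rintro ⟨a, ha⟩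
    exact ⟨a, by rw [ha, mul_comm]⟩
end

section
variable (P : Type) [CommRing P] (R : Type) [CommRing R] [Algebra P R]
  (C : Type) [AddCommGroup C] [Module R C] [Module P C] [IsScalarTower P R C]

/-- `Hom_P(C, P)` as an `R`-module -/
def DualM (P : Type) [CommRing P] (R : Type) [CommRing R] (C : Type) [AddCommGroup C] [Module P C] : Type :=
  C →ₗ[P] P

instance : AddCommGroup (DualM P R C) := inferInstanceAs (AddCommGroup (C →ₗ[P] P))
instance : Module P (DualM P R C) := inferInstanceAs (Module P (C →ₗ[P] P))

/-- evaluation -/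
def DualM.ev : DualM P R C →ₗ[P] C →ₗ[P] P := LinearMap.id

variable {P R C}

theorem DualM.ext {φ ψ : DualM P R C} (h : ∀ c, DualM.ev P R C φ c = DualM.ev P R C ψ c) : φ = ψ :=
  LinearMap.ext h

instance : SMul R (DualM P R C) :=
  ⟨fun r φ => (DualM.ev P R C φ) ∘ₗ ((LinearMap.lsmul R C r).restrictScalars P)⟩

theorem DualM.ev_smul (r : R) (φ : DualM P R C) (c : C) :
    DualM.ev P R C (r • φ) c = DualM.ev P R C φ (r • c) := rfl

instance : Module R (DualM P R C) where
  one_smul φ := DualM.ext fun c => by rw [DualM.ev_smul, one_smul]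
  mul_smul r s φ := DualM.ext fun c => by
    rw [DualM.ev_smul, DualM.ev_smul, DualM.ev_smul, mul_smul, smul_comm]
  smul_zero r := DualM.ext fun c => by rw [DualM.ev_smul, map_zero]; rfl
  smul_add r φ ψ := DualM.ext fun c => by
    rw [DualM.ev_smul, map_add, map_add, LinearMap.add_apply, LinearMap.add_apply]; rfl
  add_smul r s φ := DualM.ext fun c => by
    rw [DualM.ev_smul, add_smul, map_add, map_add, LinearMap.add_apply]; rfl
  zero_smul φ := DualM.ext fun c => by rw [DualM.ev_smul, zero_smul, map_zero, map_zero]; rfl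

instance : IsScalarTower P R (DualM P R C) where
  smul_assoc p r φ := DualM.ext fun c => by
    rw [DualM.ev_smul, LinearMap.map_smul (DualM.ev P R C), LinearMap.smul_apply, DualM.ev_smul,
      smul_assoc, LinearMap.map_smul]

instance [Module.Finite P C] [Module.Free P C] : Module.Finite P (DualM P R C) :=
  inferInstanceAs (Module.Finite P (C →ₗ[P] P))
instance [Module.Finite P C] [Module.Free P C] : Module.Free P (DualM P R C) :=
  inferInstanceAs (Module.Free P (C →ₗ[P] P))

theorem DualM.finrank [StrongRankCondition P] [Module.Finite P C] [Module.Free P C] :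
    Module.finrank P (DualM P R C) = Module.finrank P C :=
  Module.finrank_linearMap_self P P C

/-- functoriality for isomorphisms -/
def DualM.congr {C' : Type} [AddCommGroup C'] [Module R C'] [Module P C'] [IsScalarTower P R C']
    (e : C ≃ₗ[R] C') : DualM P R C ≃ₗ[R] DualM P R C' where
  toFun φ := (DualM.ev P R C φ) ∘ₗ (e.symm.toLinearMap.restrictScalars P)
  invFun φ := (DualM.ev P R C' φ) ∘ₗ (e.toLinearMap.restrictScalars P)
  left_inv φ := DualM.ext fun c => by
    change DualM.ev P R C φ (e.symm (e c)) = _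
    rw [e.symm_apply_apply]
  right_inv φ := DualM.ext fun c => by
    change DualM.ev P R C' φ (e (e.symm c)) = _
    rw [e.apply_symm_apply]
  map_add' φ ψ := rfl
  map_smul' r φ := DualM.ext fun c => by
    change DualM.ev P R C φ (r • (e.symm c)) = DualM.ev P R C φ (e.symm (r • c))
    rw [map_smul e.symm]

/-- biduality -/
theorem DualM.bidual [Module.Finite P C] [Module.Free P C] :
    Nonempty (C ≃ₗ[R] DualM P R (DualM P R C)) := by
  let f : C →ₗ[R] DualM P R (DualM P R C) :=
    { toFun := fun c => (Module.Dual.eval P C c : Module.Dual P (Module.Dual P C))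
      map_add' := fun a b => by rw [map_add]; rfl
      map_smul' := fun r c => rfl }
  refine ⟨LinearEquiv.ofBijective f ?_⟩
  exact (Module.evalEquiv P C).bijective

theorem DualM.perfect [Module.Finite P C] [Module.Free P C] {N : Type} [AddCommGroup N] [Module R N]
    [Module P N] [IsScalarTower P R N] (e : N ≃ₗ[R] DualM P R C) :
    ∃ β : C →ₗ[P] N →ₗ[P] P, Perfect β R ∧ ∀ c n, β c n = DualM.ev P R C (e n) c := by
  let β : C →ₗ[P] N →ₗ[P] P :=
    LinearMap.flip ((DualM.ev P R C) ∘ₗ (e.toLinearMap.restrictScalars P))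
  have hβ : ∀ c n, β c n = DualM.ev P R C (e n) c := fun c n => rfl
  refine ⟨β, ⟨fun r c n => ?_, ?_⟩, hβ⟩
  · rw [hβ, hβ, map_smul e, DualM.ev_smul]
  · let b := Module.Free.chooseBasis P C
    let cd : Module.Free.ChooseBasisIndex P C → DualM P R C := fun i => b.coord i
    refine ⟨Module.Free.ChooseBasisIndex P C, inferInstance, b, fun i => e.symm (cd i), ?_, ?_⟩
    · intro x
      simp only [hβ, e.apply_symm_apply]
      exact (b.sum_repr x).symm
    · intro x
      apply e.injective
      have h1 : ∀ (p : P) n, e (p • n) = p • e n := fun p n => by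
        rw [← algebraMap_smul R p n, map_smul, algebraMap_smul]
      rw [map_sum]
      simp only [h1, hβ, e.apply_symm_apply]
      refine DualM.ext fun c => ?_
      rw [map_sum, LinearMap.sum_apply]
      conv_lhs => rw [← b.sum_repr c, map_sum]
      refine Finset.sum_congr rfl fun i _ => ?_
      rw [map_smul, smul_eq_mul, mul_comm]
      rfl

variable [IsDomain P] [IsDomain R] [Algebra.IsIntegral P R] [FaithfulSMul P R]

theorem exists_mul_P {r : R} (hr : r ≠ 0) : ∃ (r' : R) (h : P), h ≠ 0 ∧ r' * r = algebraMap P R h := by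
  have h1 : (Ideal.span {r}).comap (algebraMap P R) ≠ ⊥ :=
    Ideal.comap_ne_bot_of_integral_mem hr (Ideal.mem_span_singleton_self r)
      (Algebra.IsIntegral.isIntegral r)
  obtain ⟨h, h2, h3⟩ := Submodule.exists_mem_ne_zero_of_ne_bot h1
  obtain ⟨r', hr'⟩ := Ideal.mem_span_singleton'.1 h2
  exact ⟨r', h, h3, hr'⟩

theorem DualM.torsionFree {r : R} (hr : r ≠ 0) {φ : DualM P R C} (h : r • φ = 0) : φ = 0 := by
  obtain ⟨r', p, hp, e⟩ := exists_mul_P (P := P) hr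
  refine DualM.ext fun c => ?_
  have h1 := congrArg (fun f => DualM.ev P R C f (r' • c)) h
  simp only [DualM.ev_smul] at h1
  rw [smul_smul, mul_comm, e, algebraMap_smul, map_smul, map_zero] at h1
  rw [map_zero]
  exact (smul_eq_zero.1 h1).resolve_left hp

theorem exists_pow_dvd [UniqueFactorizationMonoid P] {h v : P} (h0 : h ≠ 0) (hv : ¬ h ∣ v) :
    ∃ (π : P) (e : ℕ), Prime π ∧ π ^ e ∣ h ∧ ¬ π ^ e ∣ v := by
  induction h using UniqueFactorizationMonoid.induction_on_prime with
  | h₁ => exact absurd rfl h0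
  | h₂ x hx => exact absurd (hx.dvd) hv
  | h₃ a π ha hπ ih =>
    by_cases h1 : a ∣ v
    · obtain ⟨w, rfl⟩ := h1
      obtain ⟨n, b, hb, rfl⟩ := WfDvdMonoid.max_power_factor ha hπ.irreducible
      refine ⟨π, n + 1, hπ, ⟨b, by ring⟩, fun h2 => ?_⟩
      rw [pow_succ, mul_assoc, mul_dvd_mul_iff_left (pow_ne_zero _ hπ.ne_zero)] at h2
      rcases hπ.dvd_or_dvd h2 with h3 | h3
      · exact hb h3
      · exact hv (by rw [mul_comm π]; exact mul_dvd_mul_left _ h3)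
    · obtain ⟨π', e, h2, h3, h4⟩ := ih ha h1
      exact ⟨π', e, h2, h3.mul_left _, h4⟩

theorem DualM.s2 [UniqueFactorizationMonoid P] [IsNoetherianRing R] : S2 R (DualM P R C) := by
  intro p φ0 𝔭 hp h𝔭 hs
  obtain ⟨p', h, hh, e⟩ := exists_mul_P (P := P) hp
  have hp' : p' ≠ 0 := by
    rintro rfl
    rw [zero_mul] at e
    exact hh ((map_eq_zero_iff _ (FaithfulSMul.algebraMap_injective P R)).1 e.symm)
  have hs' : ∀ s, s ∈ 𝔭 ↔ ∀ c, h ∣ DualM.ev P R C φ0 ((s * p') • c) := by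
    intro s
    rw [hs]
    constructor
    · rintro ⟨φ, hφ⟩ c
      have := congrArg (fun f => DualM.ev P R C f (p' • c)) hφ
      simp only [DualM.ev_smul, smul_smul] at this
      rw [this, mul_comm, e, algebraMap_smul, map_smul]
      exact ⟨_, rfl⟩
    · intro h1
      choose ψ hψ using h1
      let φ : DualM P R C := ({
        toFun := ψ
        map_add' := fun a b => by
          apply mul_left_cancel₀ hh
          rw [mul_add, ← hψ, ← hψ, ← hψ, smul_add, map_add]
        map_smul' := fun a b => by
          apply mul_left_cancel₀ hh
          rw [RingHom.id_apply, smul_eq_mul, mul_left_comm, ← hψ, ← hψ, smul_comm, map_smul,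
            smul_eq_mul] } : C →ₗ[P] P)
      refine ⟨φ, ?_⟩
      have h2 : p' • (s • φ0 - p • φ) = 0 := by
        refine DualM.ext fun c => ?_
        rw [smul_sub, smul_smul, smul_smul, e, algebraMap_smul, map_sub, LinearMap.sub_apply,
          DualM.ev_smul, mul_comm, hψ, map_smul, map_zero, LinearMap.smul_apply, smul_eq_mul]
        exact sub_self _
      exact sub_eq_zero.1 (DualM.torsionFree hp' h2)
  have h1 : ¬ ∀ c, h ∣ DualM.ev P R C φ0 (((1:R) * p') • c) := fun h1 =>
    h𝔭.ne_top ((Ideal.eq_top_iff_one _).2 ((hs' 1).2 h1))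
  push Not at h1
  obtain ⟨c0, hc0⟩ := h1
  obtain ⟨π, n, hπ, hπ1, hπ2⟩ := exists_pow_dvd hh hc0
  have hle : ∀ a : P, algebraMap P R a ∈ 𝔭 → π ∣ a := by
    intro a ha
    have h2 := (hs' _).1 ha c0
    rw [mul_smul, algebraMap_smul, map_smul, smul_eq_mul] at h2
    rw [one_mul] at hπ2
    have h3 := hπ1.trans h2
    by_contra h4
    exact hπ2 (hπ.pow_dvd_of_dvd_mul_left n h4 h3)
  have hp𝔭 : p ∈ 𝔭 := (hs p).2 ⟨φ0, rfl⟩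
  have hmin : 𝔭 ∈ (Ideal.span {p}).minimalPrimes := by
    refine ⟨⟨h𝔭, (Ideal.span_singleton_le_iff_mem _).2 hp𝔭⟩, ?_⟩
    rintro 𝔮 ⟨h𝔮, hp𝔮⟩ hle'
    have hp𝔮' := (Ideal.span_singleton_le_iff_mem _).1 hp𝔮
    have hh𝔮 : algebraMap P R h ∈ 𝔮 := by rw [← e]; exact Ideal.mul_mem_left _ _ hp𝔮'
    have h𝔮P : (𝔮.comap (algebraMap P R)) ≠ ⊥ := fun h0 => by
      have : h ∈ 𝔮.comap (algebraMap P R) := hh𝔮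
      rw [h0] at this
      exact hh this
    obtain ⟨π', hπ', hπ'p⟩ := Ideal.IsPrime.exists_mem_prime_of_ne_bot
      (h𝔮.comap (algebraMap P R)) h𝔮P
    have hass : π ∣ π' := hle _ (hle' hπ')
    have hass' : π' ∣ π := (hπ.dvd_prime_iff_associated hπ'p).1 hass |>.symm.dvd
    by_contra hnot
    obtain ⟨z, hz1, hz2⟩ := Set.not_subset.1 hnot
    have := Ideal.comap_lt_comap_of_integral_mem_sdiff hle' ⟨hz1, hz2⟩
      (Algebra.IsIntegral.isIntegral (R := P) z)
    refine not_le_of_gt this ?_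
    intro a ha
    have h5 : π' ∣ a := hass'.trans (hle a ha)
    exact Ideal.mem_of_dvd _ h5 hπ'
  have hmin' : 𝔭 ∈ ((Ideal.span {p}).colon {(1 : R)}).minimalPrimes := by
    convert hmin using 2
    ext s
    rw [Submodule.mem_colon_singleton, smul_eq_mul, mul_one]
  obtain ⟨r, hr⟩ := Submodule.exists_eq_colon_of_mem_minimalPrimes hmin'
  refine ⟨r, fun s => ?_⟩
  rw [hr, Submodule.mem_colon_singleton, smul_eq_mul, Ideal.mem_span_singleton]
  exact Iff.rfl

theorem DualM.embed [Module.Finite P C] [Module.Free P C] [Module.Finite P R] [Module.Free P R]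
    (θ : C →ₗ[R] R) (hθ : Function.Injective θ) [Nontrivial C] :
    Nontrivial (DualM P R C) ∧
    ∃ η : DualM P R C →ₗ[R] R, Function.Injective η := by
  classical
  have hr1 : Module.finrank P C ≤ Module.finrank P R :=
    LinearMap.finrank_le_finrank_of_injective (f := θ.restrictScalars P) hθ
  have hr2 : 0 < Module.finrank P R := Module.finrank_pos
  have hr3 : 0 < Module.finrank P C := Module.finrank_pos
  have hnt : Nontrivial (DualM P R C) := by
    apply Module.nontrivial_of_finrank_pos (R := P)
    rw [DualM.finrank]; exact hr3
  refine ⟨hnt, ?_⟩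
  obtain ⟨φ0, h0⟩ := exists_ne (0 : DualM P R C)
  have hdep : ∀ φ : DualM P R C, ∃ a s : R, a ≠ 0 ∧ a • φ = s • φ0 := by
    intro φ
    let f : (R × R) →ₗ[R] DualM P R C :=
      LinearMap.coprod (LinearMap.toSpanSingleton R _ φ) (LinearMap.toSpanSingleton R _ φ0)
    have hf : ¬ Function.Injective f := by
      intro hf
      have := LinearMap.finrank_le_finrank_of_injective (f := f.restrictScalars P) hf
      rw [DualM.finrank, Module.finrank_prod] at this
      omega
    rw [injective_iff_map_eq_zero] at hf
    push Not at hf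
    obtain ⟨⟨a, s⟩, h1, h2⟩ := hf
    have h1' : a • φ + s • φ0 = 0 := by simpa [f] using h1
    refine ⟨a, -s, ?_, ?_⟩
    · rintro rfl
      rw [zero_smul, zero_add] at h1'
      by_cases hs : s = 0
      · exact h2 (by rw [hs]; rfl)
      · exact h0 (DualM.torsionFree hs h1')
    · rw [neg_smul]; exact eq_neg_of_add_eq_zero_left h1'
  have : Module.Finite R (DualM P R C) := Module.Finite.of_restrictScalars_finite P R _
  obtain ⟨S, hS⟩ := Module.Finite.fg_top (R := R) (M := DualM P R C)
  choose a s ha hs using hdep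
  let A := ∏ φ ∈ S, a φ
  have hA : A ≠ 0 := Finset.prod_ne_zero_iff.2 fun φ _ => ha φ
  have hall : ∀ φ : DualM P R C, ∃ s : R, A • φ = s • φ0 := by
    intro φ
    have h1 : φ ∈ Submodule.span R (S : Set (DualM P R C)) := by rw [hS]; trivial
    induction h1 using Submodule.span_induction with
    | mem φ hφ =>
      refine ⟨(∏ ψ ∈ S.erase φ, a ψ) * s φ, ?_⟩
      rw [mul_smul, ← hs, smul_smul, Finset.prod_erase_mul _ _ hφ]
    | zero => exact ⟨0, by rw [smul_zero, zero_smul]⟩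
    | add x y _ _ hx hy =>
      obtain ⟨u, hu⟩ := hx
      obtain ⟨v, hv⟩ := hy
      exact ⟨u + v, by rw [smul_add, hu, hv, add_smul]⟩
    | smul r x _ hx =>
      obtain ⟨u, hu⟩ := hx
      exact ⟨r * u, by rw [smul_comm, hu, mul_smul]⟩
  choose η hη using hall
  have hinj : ∀ u v : R, u • φ0 = v • φ0 → u = v := by
    intro u v huv
    by_contra hne
    refine h0 (DualM.torsionFree (sub_ne_zero.2 hne) (φ := φ0) ?_)
    rw [sub_smul, huv, sub_self]
  refine ⟨{ toFun := η
            map_add' := fun x y => hinj _ _ (by rw [← hη, add_smul, ← hη, ← hη, smul_add])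
            map_smul' := fun r x => hinj _ _ (by
              rw [← hη, RingHom.id_apply, smul_eq_mul, mul_smul, ← hη, smul_comm]) }, ?_⟩
  rw [injective_iff_map_eq_zero]
  intro φ hφ
  have hφ' : η φ = 0 := hφ
  have := hη φ
  rw [hφ', zero_smul] at this
  exact DualM.torsionFree hA this

end


section
/-- combinatorial data of a one-sided ladder with rows `0..m` and columns `0..n` -/
structure LD (m n : ℕ) (G Λ : Type) [AddCommGroup G] [LinearOrder Λ] where
  s : ℕ → G →+ ℤ
  t : ℕ → G →+ ℤ
  E : ℕ → ℕ → G
  sE : ∀ p q i, p ≤ m → q ≤ n → s i (E p q) = if i = p then 1 else 0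
  tE : ∀ p q j, p ≤ m → q ≤ n → t j (E p q) = if j = q then 1 else 0
  sum : ∀ g, ∑ i ∈ Finset.range (m + 1), s i g = ∑ j ∈ Finset.range (n + 1), t j g
  ext : ∀ g, (∀ i ≤ m, s i g = 0) → (∀ j ≤ n, t j g = 0) → g = 0
  a : Λ → ℕ
  b : Λ → ℕ
  ha : StrictMono a
  hb : StrictAnti b
  am : ∀ l, a l ≤ m
  bn : ∀ l, b l ≤ n
  bot : Λ
  top : Λ
  abot : a bot = 0
  bbot : b bot = n
  atop : a top = m
  btop : b top = 0

variable {k : Type} [Field k] {m n : ℕ} {G Λ : Type} [AddCommGroup G] [LinearOrder Λ] (L : LD m n G Λ)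

namespace LD

/-- degree -/
def deg : G →+ ℤ := ∑ i ∈ Finset.range (m + 1), L.s i

/-- facet functionals attached to the corners -/
def κ (l : Λ) : G →+ ℤ :=
  ∑ i ∈ Finset.range (L.a l + 1), L.s i - ∑ j ∈ Finset.Ioc (L.b l) n, L.t j

theorem deg_apply (g : G) : L.deg g = ∑ i ∈ Finset.range (m + 1), L.s i g := by
  rw [deg, AddMonoidHom.finsetSum_apply]

theorem κ_apply (l : Λ) (g : G) : L.κ l g =
    ∑ i ∈ Finset.range (L.a l + 1), L.s i g - ∑ j ∈ Finset.Ioc (L.b l) n, L.t j g := by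
  rw [κ, AddMonoidHom.sub_apply, AddMonoidHom.finsetSum_apply, AddMonoidHom.finsetSum_apply]

theorem range_split {f : ℕ → ℤ} {a m : ℕ} (h : a ≤ m) :
    ∑ i ∈ Finset.range (m + 1), f i =
      ∑ i ∈ Finset.range (a + 1), f i + ∑ i ∈ Finset.Ioc a m, f i := by
  rw [Finset.range_eq_Ico, ← Finset.sum_Ico_consecutive _ (Nat.zero_le (a + 1)) (by omega : a + 1 ≤ m + 1),
    Finset.range_eq_Ico]
  congr 1
  refine Finset.sum_congr ?_ fun _ _ => rfl
  ext i
  simp only [Finset.mem_Ico, Finset.mem_Ioc]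
  omega

theorem κ_apply' (l : Λ) (g : G) : L.κ l g =
    ∑ j ∈ Finset.range (L.b l + 1), L.t j g - ∑ i ∈ Finset.Ioc (L.a l) m, L.s i g := by
  have h1 := range_split (f := fun i => L.s i g) (L.am l)
  have h2 := range_split (f := fun i => L.t i g) (L.bn l)
  have h3 := L.sum g
  rw [κ_apply]
  linarith

theorem κ_deg (l : Λ) (g : G) : L.κ l g = L.deg g - ∑ i ∈ Finset.Ioc (L.a l) m, L.s i g
    - ∑ j ∈ Finset.Ioc (L.b l) n, L.t j g := by
  have h1 := range_split (f := fun i => L.s i g) (L.am l)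
  rw [κ_apply, deg_apply, h1]
  ring

theorem κ_bot (g : G) : L.κ L.bot g = L.s 0 g := by
  rw [κ_apply, L.abot, L.bbot]; simp

theorem κ_top (g : G) : L.κ L.top g = L.t 0 g := by
  rw [κ_apply', L.atop, L.btop]; simp

theorem κE (l : Λ) {p q : ℕ} (hp : p ≤ m) (hq : q ≤ n) : L.κ l (L.E p q) =
    (if p ≤ L.a l then 1 else 0) - (if L.b l < q then 1 else 0) := by
  rw [κ_apply]
  congr 1
  · rw [Finset.sum_congr rfl fun i _ => L.sE p q i hp hq, Finset.sum_ite_eq']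
    simp [Nat.lt_succ_iff]
  · rw [Finset.sum_congr rfl fun i _ => L.tE p q i hp hq, Finset.sum_ite_eq']
    simp [hq]

theorem degE {p q : ℕ} (hp : p ≤ m) (hq : q ≤ n) : L.deg (L.E p q) = 1 := by
  rw [deg_apply, Finset.sum_congr rfl fun i _ => L.sE p q i hp hq, Finset.sum_ite_eq']
  simp; omega

theorem bot_le (l : Λ) : L.bot ≤ l := L.ha.le_iff_le.1 (by rw [L.abot]; exact Nat.zero_le _)
theorem le_top (l : Λ) : l ≤ L.top := L.ha.le_iff_le.1 (by rw [L.atop]; exact L.am l)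

/-- the semigroup of the localization -/
def T : AddSubmonoid G where
  carrier := {g | (∀ i, 1 ≤ i → i ≤ m → 0 ≤ L.s i g) ∧ ∀ j, 1 ≤ j → j ≤ n → 0 ≤ L.t j g}
  zero_mem' := by simp
  add_mem' := by
    rintro g h ⟨h1, h2⟩ ⟨h3, h4⟩
    refine ⟨fun i hi hi' => ?_, fun j hj hj' => ?_⟩
    · rw [map_add]; exact add_nonneg (h1 i hi hi') (h3 i hi hi')
    · rw [map_add]; exact add_nonneg (h2 j hj hj') (h4 j hj hj')

theorem mem_T {g : G} : g ∈ L.T ↔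
    (∀ i, 1 ≤ i → i ≤ m → 0 ≤ L.s i g) ∧ ∀ j, 1 ≤ j → j ≤ n → 0 ≤ L.t j g := Iff.rfl

theorem E_mem_T {p q : ℕ} (hp : p ≤ m) (hq : q ≤ n) : L.E p q ∈ L.T := by
  refine ⟨fun i _ _ => ?_, fun j _ _ => ?_⟩
  · rw [L.sE p q i hp hq]; split_ifs <;> simp
  · rw [L.tE p q j hp hq]; split_ifs <;> simp

/-- the element `u` of the corner `l` -/
def u (l : Λ) : G := if L.b l < n then L.E 0 (L.b l + 1) else 0
/-- the element `v` of the corner `l` -/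
def v (l : Λ) : G := if L.a l < m then L.E (L.a l + 1) 0 else 0

theorem κu (l j : Λ) : L.κ j (L.u l) = if j < l then 1 else 0 := by
  rw [u]
  split_ifs with h1 h2 h2
  · rw [κE _ _ (Nat.zero_le _) h1]
    have := L.hb h2
    simp; omega
  · rw [κE _ _ (Nat.zero_le _) h1]
    have := L.hb.antitone (not_lt.1 h2)
    simp; omega
  · have := L.hb h2
    have := L.bn j
    omega
  · simp

theorem κv (l j : Λ) : L.κ j (L.v l) = if l < j then 1 else 0 := by
  rw [v]
  split_ifs with h1 h2 h2
  · rw [κE _ _ h1 (Nat.zero_le _)]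
    have := L.ha h2
    simp; omega
  · rw [κE _ _ h1 (Nat.zero_le _)]
    have := L.ha.monotone (not_lt.1 h2)
    simp; omega
  · have := L.ha h2
    have := L.am j
    omega
  · simp

theorem u_mem_T (l : Λ) : L.u l ∈ L.T := by
  rw [u]; split_ifs with h
  · exact L.E_mem_T (Nat.zero_le _) h
  · exact zero_mem _

theorem v_mem_T (l : Λ) : L.v l ∈ L.T := by
  rw [v]; split_ifs with h
  · exact L.E_mem_T h (Nat.zero_le _)
  · exact zero_mem _

/-- the associated cone data -/
def cd : CData G Λ where
  T := L.T
  κ := L.κ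
  x := L.E 0 0
  hx := L.E_mem_T (Nat.zero_le _) (Nat.zero_le _)
  hnx := by
    refine ⟨fun i h _ => ?_, fun j h _ => ?_⟩
    · rw [map_neg, L.sE _ _ _ (Nat.zero_le _) (Nat.zero_le _), if_neg (by omega)]; simp
    · rw [map_neg, L.tE _ _ _ (Nat.zero_le _) (Nat.zero_le _), if_neg (by omega)]; simp
  κx := fun l => by rw [κE _ _ (Nat.zero_le _) (Nat.zero_le _)]; simp
  τ := fun l => L.u l + L.v l
  hτ := fun l => add_mem (L.u_mem_T l) (L.v_mem_T l)
  κτ := fun l => by rw [map_add, κu, κv]; simp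
  κτ' := fun l j h => by
    rw [map_add, κu, κv]
    rcases lt_or_gt_of_ne h with h | h
    · simp [h, h.not_gt]
    · simp [h, h.not_gt]

/-- the semigroup of the ladder -/
abbrev S : Set G := L.cd.A 0

theorem mem_S {g : G} : g ∈ L.S ↔ (∀ i ≤ m, 0 ≤ L.s i g) ∧ (∀ j ≤ n, 0 ≤ L.t j g) ∧
    ∀ l, 0 ≤ L.κ l g := by
  constructor
  · rintro ⟨⟨h1, h2⟩, h3⟩
    refine ⟨fun i hi => ?_, fun j hj => ?_, h3⟩
    · rcases Nat.eq_zero_or_pos i with rfl | h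
      · rw [← L.κ_bot]; exact h3 _
      · exact h1 i h hi
    · rcases Nat.eq_zero_or_pos j with rfl | h
      · rw [← L.κ_top]; exact h3 _
      · exact h2 j h hj
  · rintro ⟨h1, h2, h3⟩
    exact ⟨⟨fun i _ h => h1 i h, fun j _ h => h2 j h⟩, h3⟩

/-- the ladder -/
def Y (p q : ℕ) : Prop := p ≤ m ∧ q ≤ n ∧ ∀ l, p ≤ L.a l ∨ q ≤ L.b l

theorem E_mem_S {p q : ℕ} (h : L.Y p q) : L.E p q ∈ L.S := by
  obtain ⟨hp, hq, h⟩ := h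
  refine ⟨L.E_mem_T hp hq, fun l => ?_⟩
  change 0 ≤ L.κ l _
  rw [κE _ _ hp hq]
  have := h l
  split_ifs <;> omega

theorem sub_E_mem {g : G} (hg : g ∈ L.S) {p q : ℕ} (hY : L.Y p q) (hs : 0 < L.s p g)
    (ht : 0 < L.t q g) (hs' : ∀ i ≤ m, p < i → L.s i g = 0) (ht' : ∀ j < q, L.t j g = 0) :
    g - L.E p q ∈ L.S := by
  obtain ⟨hp, hq, hY⟩ := hY
  rw [mem_S] at hg ⊢
  obtain ⟨h1, h2, h3⟩ := hg
  refine ⟨fun i hi => ?_, fun j hj => ?_, fun l => ?_⟩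
  · rw [map_sub, L.sE _ _ _ hp hq]
    split_ifs with h
    · subst h; omega
    · simpa using h1 i hi
  · rw [map_sub, L.tE _ _ _ hp hq]
    split_ifs with h
    · subst h; omega
    · simpa using h2 j hj
  · rw [map_sub, κE _ _ hp hq]
    have h4 := h3 l
    by_cases h5 : p ≤ L.a l
    · by_cases h6 : q ≤ L.b l
      · have : 0 < L.κ l g := by
          rw [κ_apply', Finset.sum_eq_zero (s := Finset.Ioc (L.a l) m), sub_zero]
          · exact lt_of_lt_of_le ht (Finset.single_le_sum (f := fun j => L.t j g)
              (fun j hj => h2 j (by have := L.bn l; rw [Finset.mem_range] at hj; omega))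
              (Finset.mem_range.2 (by omega)))
          · intro i hi
            rw [Finset.mem_Ioc] at hi
            exact hs' i hi.2 (by omega)
        rw [if_pos h5, if_neg (by omega)]; omega
      · rw [if_pos h5, if_pos (by omega)]; simpa using h4
    · have := hY l
      rw [if_neg h5, if_neg (by omega)]; simpa using h4

theorem Y_of_extreme {g : G} (hg : g ∈ L.S) {p q : ℕ} (hp : p ≤ m) (hq : q ≤ n) (hs : 0 < L.s p g)
    (ht : ∀ j < q, L.t j g = 0) : L.Y p q := by
  refine ⟨hp, hq, fun l => ?_⟩
  rw [mem_S] at hg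
  obtain ⟨h1, h2, h3⟩ := hg
  by_contra! hc
  have h4 := h3 l
  rw [κ_apply', Finset.sum_eq_zero (s := Finset.range _)] at h4
  · have := Finset.single_le_sum (f := fun i => L.s i g) (s := Finset.Ioc (L.a l) m)
      (fun i hi => h1 i (Finset.mem_Ioc.1 hi).2) (Finset.mem_Ioc.2 ⟨hc.1, hp⟩)
    omega
  · intro j hj
    rw [Finset.mem_range] at hj
    exact ht j (by omega)

theorem exists_extreme {g : G} (hg : g ∈ L.S) (h0 : g ≠ 0) : ∃ p q, L.Y p q ∧ 0 < L.s p g ∧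
    0 < L.t q g ∧ (∀ i ≤ m, p < i → L.s i g = 0) ∧ (∀ j < q, L.t j g = 0) := by
  classical
  have hg' := L.mem_S.1 hg
  obtain ⟨h1, h2, h3⟩ := hg'
  have hd : (∃ i ≤ m, L.s i g ≠ 0) ∧ (∃ j ≤ n, L.t j g ≠ 0) := by
    by_contra hc
    have key : (∀ i ≤ m, L.s i g = 0) ∧ (∀ j ≤ n, L.t j g = 0) := by
      have hsum := L.sum g
      rw [not_and_or] at hc
      rcases hc with hc | hc
      · push Not at hc
        refine ⟨hc, ?_⟩
        rw [Finset.sum_eq_zero (fun i hi => hc i (by rw [Finset.mem_range] at hi; omega))] at hsum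
        have := (Finset.sum_eq_zero_iff_of_nonneg (fun j hj => h2 j (by
          rw [Finset.mem_range] at hj; omega))).1 hsum.symm
        exact fun j hj => this j (Finset.mem_range.2 (by omega))
      · push Not at hc
        refine ⟨?_, hc⟩
        rw [Finset.sum_eq_zero (s := Finset.range (n+1)) (fun i hi => hc i (by rw [Finset.mem_range] at hi; omega))] at hsum
        have := (Finset.sum_eq_zero_iff_of_nonneg (fun j hj => h1 j (by
          rw [Finset.mem_range] at hj; omega))).1 hsum
        exact fun j hj => this j (Finset.mem_range.2 (by omega))
    exact h0 (L.ext g key.1 key.2)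
  obtain ⟨⟨i0, hi0, hi0'⟩, hj⟩ := hd
  let p := Nat.findGreatest (fun i => L.s i g ≠ 0) m
  have hp : L.s p g ≠ 0 := Nat.findGreatest_spec (P := fun i => L.s i g ≠ 0) hi0 hi0'
  have hpm : p ≤ m := Nat.findGreatest_le _
  let q := Nat.find hj
  obtain ⟨hq, hq'⟩ := Nat.find_spec hj
  have hqmin : ∀ j < q, L.t j g = 0 := by
    intro j hjq
    have := Nat.find_min hj hjq
    push Not at this
    exact this (by change q ≤ n at hq; omega)
  have hp' : 0 < L.s p g := lt_of_le_of_ne (h1 p hpm) (Ne.symm hp)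
  refine ⟨p, q, L.Y_of_extreme hg hpm hq hp' hqmin, hp', lt_of_le_of_ne (h2 q hq) (Ne.symm hq'), ?_, hqmin⟩
  intro i hi hpi
  have := Nat.findGreatest_is_greatest (P := fun i => L.s i g ≠ 0) hpi hi
  push Not at this
  exact this

theorem deg_nonneg {g : G} (hg : g ∈ L.S) : 0 ≤ L.deg g := by
  rw [deg_apply]
  exact Finset.sum_nonneg fun i hi => (L.mem_S.1 hg).1 i (by rw [Finset.mem_range] at hi; omega)

end LD

theorem UData.of {D : CData G Λ} {σ : Type} (φ : (σ →₀ ℕ) →+ G) (hφ : Function.Injective φ)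
    (hT : ∀ e, φ e ∈ D.T) (hs : ∀ g ∈ D.T, ∃ N : ℕ, ∀ M : ℕ, N ≤ M → ∃ e, φ e = M • D.x + g) :
    UData k D := by
  classical
  let Q := MvPolynomial σ k
  let _ : StrongNormalizationMonoid Q := UniqueFactorizationMonoid.strongNormalizationMonoid
  refine ⟨Q, inferInstance, inferInstance, UniqueFactorizationMonoid.toNormalizedGCDMonoid Q,
    AddMonoidAlgebra.mapDomainRingHom k φ, ?_, ?_, ?_⟩
  · exact AddMonoidAlgebra.mapDomain_injective hφ
  · intro q g hg
    rw [AddMonoidAlgebra.mapDomainRingHom_apply, AddMonoidAlgebra.coeff_mapDomain] at hg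
    have := Finsupp.mapDomain_support (Finsupp.mem_support_iff.2 hg)
    obtain ⟨e, _, rfl⟩ := Finset.mem_image.1 this
    exact hT e
  · intro f hf
    refine mon_induction (p := fun f => ∃ N : ℕ, ∀ M : ℕ, N ≤ M → ∃ q : Q,
      AddMonoidAlgebra.mapDomainRingHom k φ q = XX k (M • D.x) * f) hf ?_ ?_ ?_
    · exact ⟨0, fun M _ => ⟨0, by rw [map_zero, mul_zero]⟩⟩
    · rintro f g ⟨N, hN⟩ ⟨N', hN'⟩
      refine ⟨N + N', fun M hM => ?_⟩
      obtain ⟨q, hq⟩ := hN M (by omega)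
      obtain ⟨q', hq'⟩ := hN' M (by omega)
      exact ⟨q + q', by rw [map_add, hq, hq', mul_add]⟩
    · intro c g hg
      obtain ⟨N, hN⟩ := hs g hg
      refine ⟨N, fun M hM => ?_⟩
      obtain ⟨e, he⟩ := hN M hM
      refine ⟨AddMonoidAlgebra.single e c, ?_⟩
      rw [AddMonoidAlgebra.mapDomainRingHom_apply, AddMonoidAlgebra.mapDomain_single, he,
        mul_smul_comm, XX_mul, XX, AddMonoidAlgebra.smul_single, smul_eq_mul, mul_one]

theorem LD.udata : UData k L.cd := by
  classical
  let w : Option (Fin m ⊕ Fin n) → G := fun o => match o with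
    | none => L.E 0 0
    | some (Sum.inl p) => L.E (p + 1) 0
    | some (Sum.inr q) => L.E 0 (q + 1)
  let φ : (Option (Fin m ⊕ Fin n) →₀ ℕ) →+ G := Finsupp.liftAddHom fun o =>
    (multiplesHom G (w o))
  have hφ : ∀ e, φ e = e none • L.E 0 0 + (∑ p : Fin m, e (some (Sum.inl p)) • L.E (p + 1) 0 +
      ∑ q : Fin n, e (some (Sum.inr q)) • L.E 0 (q + 1)) := by
    intro e
    rw [Finsupp.liftAddHom_apply, Finsupp.sum_fintype _ _ (fun i => by simp),
      Fintype.sum_option, Fintype.sum_sum_type]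
    rfl
  have hs : ∀ e (i : Fin m), L.s (i + 1) (φ e) = e (some (Sum.inl i)) := by
    intro e i
    rw [hφ, map_add, map_add, map_sum, map_sum, map_nsmul, L.sE _ _ _ (by omega) (by omega)]
    rw [Finset.sum_congr rfl (fun p _ => by rw [map_nsmul, L.sE _ _ _ (by omega) (by omega)]),
      Finset.sum_congr rfl (fun (p : Fin n) _ => by
        rw [map_nsmul, L.sE _ _ _ (by omega) (by omega)])]
    simp [Fin.val_inj]
  have ht : ∀ e (i : Fin n), L.t (i + 1) (φ e) = e (some (Sum.inr i)) := by
    intro e i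
    rw [hφ, map_add, map_add, map_sum, map_sum, map_nsmul, L.tE _ _ _ (by omega) (by omega)]
    rw [Finset.sum_congr rfl (fun p _ => by rw [map_nsmul, L.tE _ _ _ (by omega) (by omega)]),
      Finset.sum_congr rfl (fun (p : Fin n) _ => by
        rw [map_nsmul, L.tE _ _ _ (by omega) (by omega)])]
    simp [Fin.val_inj]
  have hs0 : ∀ e, L.s 0 (φ e) = e none + ∑ q : Fin n, (e (some (Sum.inr q)) : ℤ) := by
    intro e
    rw [hφ, map_add, map_add, map_sum, map_sum, map_nsmul, L.sE _ _ _ (by omega) (by omega)]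
    rw [Finset.sum_congr rfl (fun p _ => by rw [map_nsmul, L.sE _ _ _ (by omega) (by omega)]),
      Finset.sum_congr rfl (fun (p : Fin n) _ => by
        rw [map_nsmul, L.sE _ _ _ (by omega) (by omega)])]
    simp
  refine UData.of φ ?_ ?_ ?_
  · intro e e' h
    have h2 : ∀ i, e (some (Sum.inr i)) = e' (some (Sum.inr i)) := fun i => by
      have := ht e i
      rw [h, ht] at this
      exact_mod_cast this.symm
    ext o
    rcases o with _ | (i | i)
    · have := hs0 e
      rw [h, hs0] at this
      simp only [h2] at this
      have := add_right_cancel this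
      exact_mod_cast this.symm
    · have := hs e i
      rw [h, hs] at this
      exact_mod_cast this.symm
    · exact h2 i
  · intro e
    rw [hφ]
    refine add_mem (nsmul_mem (L.E_mem_T (by omega) (by omega)) _) (add_mem ?_ ?_)
    · exact sum_mem fun p _ => nsmul_mem (L.E_mem_T (by omega) (by omega)) _
    · exact sum_mem fun p _ => nsmul_mem (L.E_mem_T (by omega) (by omega)) _
  · intro g hg
    obtain ⟨h1, h2⟩ := L.mem_T.1 hg
    let d : ℤ := L.s 0 g - ∑ q : Fin n, L.t (q + 1) g
    refine ⟨(-d).toNat, fun M hM => ?_⟩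
    have hM' : 0 ≤ M + d := by omega
    let e : Option (Fin m ⊕ Fin n) →₀ ℕ := Finsupp.equivFunOnFinite.symm fun o => match o with
      | none => (M + d).toNat
      | some (Sum.inl p) => (L.s (p + 1) g).toNat
      | some (Sum.inr q) => (L.t (q + 1) g).toNat
    have e0 : (e none : ℤ) = M + d := Int.toNat_of_nonneg hM'
    have e1 : ∀ p : Fin m, (e (some (Sum.inl p)) : ℤ) = L.s (p + 1) g := fun p =>
      Int.toNat_of_nonneg (h1 _ (by omega) (by omega))
    have e2 : ∀ p : Fin n, (e (some (Sum.inr p)) : ℤ) = L.t (p + 1) g := fun p =>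
      Int.toNat_of_nonneg (h2 _ (by omega) (by omega))
    have xs : ∀ i, L.s i (L.E 0 0) = if i = 0 then 1 else 0 := fun i =>
      L.sE 0 0 i (by omega) (by omega)
    have xt : ∀ i, L.t i (L.E 0 0) = if i = 0 then 1 else 0 := fun i =>
      L.tE 0 0 i (by omega) (by omega)
    have hS : ∀ i ≤ m, L.s i (φ e - (M • L.E 0 0 + g)) = 0 := by
      intro i hi
      rw [map_sub, map_add, map_nsmul, xs]
      rcases Nat.eq_zero_or_pos i with rfl | h
      · rw [hs0, e0]
        simp only [e2, if_true, d]
        simp only [nsmul_eq_mul, mul_one]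
        ring
      · obtain ⟨i, rfl⟩ : ∃ i', i = i' + 1 := ⟨i - 1, by omega⟩
        have := hs e ⟨i, by omega⟩
        simp only at this
        rw [this, e1]
        simp
    have hT' : ∀ j, 1 ≤ j → j ≤ n → L.t j (φ e - (M • L.E 0 0 + g)) = 0 := by
      intro i h hi
      rw [map_sub, map_add, map_nsmul, xt]
      obtain ⟨i, rfl⟩ : ∃ i', i = i' + 1 := ⟨i - 1, by omega⟩
      have := ht e ⟨i, by omega⟩
      simp only at this
      rw [this, e2]
      simp
    refine ⟨e, sub_eq_zero.1 (L.ext _ hS fun j hj => ?_)⟩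
    rcases Nat.eq_zero_or_pos j with rfl | h
    · have := L.sum (φ e - (M • L.E 0 0 + g))
      rw [Finset.sum_eq_zero (fun i hi => hS i (by rw [Finset.mem_range] at hi; omega)),
        Finset.sum_range_succ', Finset.sum_eq_zero (fun i hi => hT' (i + 1) (by omega) (by
          rw [Finset.mem_range] at hi; omega)), zero_add] at this
      exact this.symm
    · exact hT' j h hj

end


section
variable {k : Type} [Field k] {m n : ℕ} {G Λ : Type} [AddCommGroup G] [LinearOrder Λ] {L : LD m n G Λ}
  {R : Type} [CommRing R] [Algebra k R] [Algebra R (AddMonoidAlgebra k G)]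
  [IsScalarTower k R (AddMonoidAlgebra k G)]

/-- a subset stable under `S` -/
def Stab (L : LD m n G Λ) (A : Set G) : Prop := ∀ s ∈ L.cd.A 0, ∀ a ∈ A, s + a ∈ A

theorem mem_monR (hR : RData k L.cd R) {A : Set G} {hA : Stab L A} {f : AddMonoidAlgebra k G} :
    f ∈ monR hR A hA ↔ f ∈ mon k A := Iff.rfl

/-- regularity for pairs of sets -/
def SReg (hR : RData k L.cd R) (c : ℕ) (y : ℕ → R) (U V : Set G) : Prop :=
  ∃ (hU : Stab L U) (hV : Stab L V), WReg k c y (monR hR U hU) (monR hR V hV)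

theorem mon_split {V W : Set G} {f : AddMonoidAlgebra k G} (hf : f ∈ mon k (V ∪ W)) :
    ∃ f1 ∈ mon k V, ∃ f2 ∈ mon k W, f = f1 + f2 := by
  refine ⟨_, mon_mono ?_ (filt_mem (fun g => g ∈ V) hf), _,
    mon_mono ?_ (filt_mem (fun g => ¬ g ∈ V) hf), (filt_add_not _ _).symm⟩
  · rintro g ⟨_, h⟩; exact h
  · rintro g ⟨h1 | h1, h⟩
    · exact absurd h1 h
    · exact h1

/-- restriction of the comparison to differences -/
theorem SReg.congr (hR : RData k L.cd R) {c : ℕ} {y : ℕ → R} {U V U' V' : Set G} (hU : Stab L U) (hV : Stab L V)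
    (h1 : U ⊆ U') (h2 : V ⊆ V') (h3 : U' ⊆ U ∪ V') (h4 : U ∩ V' ⊆ V)
    (h : SReg hR c y U' V') : SReg hR c y U V := by
  obtain ⟨hU', hV', h⟩ := h
  refine ⟨hU, hV, WReg.transfer_rev LinearMap.id c y (fun u hu => mon_mono h1 hu)
    (fun u hu => mon_mono h2 hu) (fun u hu => ?_) (fun u hu hu' => ?_) h⟩
  · obtain ⟨f1, hf1, f2, hf2, rfl⟩ := mon_split (mon_mono h3 hu)
    exact ⟨f1, hf1, by rw [LinearMap.id_apply, add_sub_cancel_left]; exact hf2⟩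
  · intro g hg
    exact h4 ⟨hu g hg, hu' g hg⟩

theorem SReg.ext (hR : RData k L.cd R) {c : ℕ} {y : ℕ → R} {U V W : Set G} (h1 : V ⊆ W) (h2 : W ⊆ U)
    (h : SReg hR c y W V) (h' : SReg hR c y U W) : SReg hR c y U V := by
  obtain ⟨hW, hV, h⟩ := h
  obtain ⟨hU, _, h'⟩ := h'
  exact ⟨hU, hV, WReg.ext c y (fun _ h => mon_mono h1 h) (fun _ h => mon_mono h2 h) h h'⟩

theorem XX_mul_mem_iff {A : Set G} {e : G} {f : AddMonoidAlgebra k G} :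
    XX k e * f ∈ mon k A ↔ f ∈ mon k {g | e + g ∈ A} := by
  rw [mem_mon, mem_mon]
  constructor
  · intro h g hg
    apply h
    rw [coeff_XX_mul]
    simpa using hg
  · intro h g hg
    rw [coeff_XX_mul] at hg
    have := h _ hg
    simpa using this

theorem SReg.mul (hR : RData k L.cd R) {c : ℕ} {y : ℕ → R} {U V U' V' : Set G} {e : G} (he : e ∈ L.S) (hU' : Stab L U')
    (hV' : Stab L V') (h1 : ∀ g ∈ U, e + g ∈ U') (h2 : ∀ g ∈ V, e + g ∈ V')
    (h3 : ∀ g ∈ U', g ∈ V' ∨ g - e ∈ U) (h4 : ∀ g ∈ U, e + g ∈ V' → g ∈ V)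
    (h : SReg hR c y U V) : SReg hR c y U' V' := by
  obtain ⟨hU, hV, h⟩ := h
  obtain ⟨r, hr⟩ := hR.surj _ (XX_mem.2 he)
  have hf : ∀ u, LinearMap.lsmul R (AddMonoidAlgebra k G) r u = XX k e * u := fun u => by
    rw [LinearMap.lsmul_apply, Algebra.smul_def, hr]
  refine ⟨hU', hV', WReg.transfer (LinearMap.lsmul R _ r) c y (fun u hu => ?_)
    (fun u hu => ?_) (fun u hu => ?_) (fun u hu hu' => ?_) h⟩
  · rw [hf]; exact XX_mul_mem hu h1
  · rw [hf]; exact XX_mul_mem hu h2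
  · obtain ⟨f1, hf1, f2, hf2, rfl⟩ := mon_split (W := {g | g - e ∈ U}) (V := V')
      (mon_mono (fun g hg => h3 g hg) hu)
    refine ⟨XX k (-e) * f2, ?_, ?_⟩
    · refine XX_mul_mem hf2 fun g hg => ?_
      rw [neg_add_eq_sub]; exact hg
    · rw [hf, XX_cancel', add_sub_cancel_right]; exact hf1
  · rw [hf] at hu'
    intro g hg
    exact h4 g (hu g hg) (XX_mul_mem_iff.1 hu' g hg)

/-- an antidiagonal of the ladder -/
noncomputable def LD.diag (L : LD m n G Λ) (c : ℕ) : Finset (ℕ × ℕ) :=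
  haveI := Classical.decPred fun x : ℕ × ℕ => L.Y x.1 x.2 ∧ (m - x.1) + x.2 = c
  (Finset.range (m + 1) ×ˢ Finset.range (n + 1)).filter
    fun x => L.Y x.1 x.2 ∧ (m - x.1) + x.2 = c

theorem LD.mem_diag {c p q : ℕ} : (p, q) ∈ L.diag c ↔ L.Y p q ∧ (m - p) + q = c := by
  letI := Classical.decPred fun x : ℕ × ℕ => L.Y x.1 x.2 ∧ (m - x.1) + x.2 = c
  rw [LD.diag, Finset.mem_filter, Finset.mem_product, Finset.mem_range, Finset.mem_range]
  constructor
  · exact fun h => h.2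
  · intro h
    have := h.1.1
    have := h.1.2.1
    simp only
    exact ⟨⟨by omega, by omega⟩, h⟩

theorem LD.exists_y (hR : RData k L.cd R) : ∃ y : ℕ → R, ∀ c, algebraMap R (AddMonoidAlgebra k G) (y c) =
    ∑ x ∈ L.diag c, XX k (L.E x.1 x.2) := by
  have : ∀ c, ∃ r : R, algebraMap R (AddMonoidAlgebra k G) r = ∑ x ∈ L.diag c, XX k (L.E x.1 x.2) :=
    fun c => hR.surj _ (sum_mem fun x hx => XX_mem.2 (L.E_mem_S (LD.mem_diag.1 hx).1))
  choose y hy using this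
  exact ⟨y, hy⟩

/-- the defining property of the parameters -/
def IsY (k : Type) [Field k] {m n : ℕ} {G Λ : Type} [AddCommGroup G] [LinearOrder Λ] (L : LD m n G Λ)
    {R : Type} [CommRing R] [Algebra R (AddMonoidAlgebra k G)] (y : ℕ → R) : Prop :=
  ∀ c, algebraMap R (AddMonoidAlgebra k G) (y c) = ∑ x ∈ L.diag c, XX k (L.E x.1 x.2)

variable {y : ℕ → R}

theorem SReg.succ (hR : RData k L.cd R) (hy : IsY k L y) {N c : ℕ} {U V V' : Set G} {p q : ℕ} (hY : L.Y p q) (hc : (m - p) + q = c)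
    (hU : Stab L U) (hV : Stab L V)
    (h1 : ∀ p' q', L.Y p' q' → (m - p') + q' = c → (p' ≠ p ∨ q' ≠ q) → ∀ u ∈ U, L.E p' q' + u ∈ V)
    (h2 : ∀ u ∈ U, L.E p q + u ∈ V → u ∈ V)
    (h3 : ∀ g, g ∈ V' ↔ g ∈ V ∨ g - L.E p q ∈ U)
    (h : SReg hR N (fun i => y (c + 1 + i)) U V') : SReg hR (N + 1) (fun i => y (c + i)) U V := by
  obtain ⟨_, hV', h⟩ := h
  obtain ⟨x, hx⟩ := hR.surj _ (XX_mem.2 (L.E_mem_S hY))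
  have hf : ∀ u : AddMonoidAlgebra k G, x • u = XX k (L.E p q) * u := fun u => by
    rw [Algebra.smul_def, hx]
  refine ⟨hU, hV, WReg.succ N _ x ?_ ?_ ?_ (V' := monR hR V' hV') ?_⟩
  · intro u hu
    rw [hf, Algebra.smul_def, add_zero, hy, ← Finset.add_sum_erase _ _ (LD.mem_diag.2 ⟨hY, hc⟩),
      add_mul, add_sub_cancel_left, Finset.sum_mul]
    refine Submodule.sum_mem (monR hR V hV) fun ⟨p', q'⟩ hx' => ?_
    rw [Finset.mem_erase, LD.mem_diag] at hx'
    refine XX_mul_mem hu (h1 p' q' hx'.2.1 hx'.2.2 ?_)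
    by_contra! hcon
    exact hx'.1 (Prod.ext hcon.1 hcon.2)
  · intro u hu hu'
    rw [hf] at hu'
    intro g hg
    exact h2 g (hu g hg) (XX_mul_mem_iff.1 hu' g hg)
  · intro u
    constructor
    · intro hu
      obtain ⟨f1, hf1, f2, hf2, rfl⟩ := mon_split (W := {g | g - L.E p q ∈ U}) (V := V)
        (mon_mono (fun g hg => (h3 g).1 hg) hu)
      refine ⟨XX k (-L.E p q) * f2, ?_, ?_⟩
      · refine XX_mul_mem hf2 fun g hg => ?_
        rw [neg_add_eq_sub]; exact hg
      · rw [hf, XX_cancel', add_sub_cancel_right]; exact hf1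
    · rintro ⟨w, hw, hu⟩
      have e1 : u - x • w ∈ monR hR V' hV' :=
        mon_mono (k := k) (fun g hg => (h3 g).2 (Or.inl hg)) hu
      have e2 : XX k (L.E p q) * w ∈ monR hR V' hV' :=
        XX_mul_mem (k := k) hw (fun a ha => (h3 (L.E p q + a)).2 (Or.inr (by simpa using ha)))
      have := Submodule.add_mem _ e1 e2
      rwa [hf, sub_add_cancel] at this
  · convert h using 3
    ring


/-- complement of a face -/
def LD.co (L : LD m n G Λ) (P q : ℕ) : Set G :=
  {g | g ∈ L.S ∧ ((∃ i, P ≤ i ∧ i ≤ m ∧ 0 < L.s i g) ∨ ∃ j, j < q ∧ j ≤ n ∧ 0 < L.t j g)}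

theorem LD.stab_S : Stab L L.S := fun _ hs _ ha => CData.A_add hs ha

theorem LD.S_add {g h : G} (hg : g ∈ L.S) (hh : h ∈ L.S) : g + h ∈ L.S := CData.A_add hg hh

theorem LD.stab_co (P q : ℕ) : Stab L (L.co P q) := by
  rintro g hg h ⟨h1, h2⟩
  have h3 := L.mem_S.1 hg
  refine ⟨LD.S_add hg h1, ?_⟩
  rcases h2 with ⟨i, h4, h5, h6⟩ | ⟨i, h4, h5, h6⟩
  · exact Or.inl ⟨i, h4, h5, by rw [map_add]; have := h3.1 i h5; omega⟩
  · exact Or.inr ⟨i, h4, h5, by rw [map_add]; have := h3.2.1 i h5; omega⟩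

theorem LD.co_eq_zero {g : G} (hg : g ∈ L.S) (h : g ∉ L.co 0 0 ∨ g ∉ L.co (m+1) (n+1)) : g = 0 := by
  by_contra h0
  obtain ⟨p, q, hY, hs, ht, -⟩ := L.exists_extreme hg h0
  rcases h with h | h
  · exact h ⟨hg, Or.inl ⟨p, by omega, hY.1, hs⟩⟩
  · exact h ⟨hg, Or.inr ⟨q, by have := hY.2.1; omega, hY.2.1, ht⟩⟩

theorem LD.co_mono {P q P' q' : ℕ} (h : P' ≤ P) (h' : q ≤ q') : L.co P q ⊆ L.co P' q' := by
  rintro g ⟨hg, ⟨i, h1, h2⟩ | ⟨i, h1, h2⟩⟩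
  · exact ⟨hg, Or.inl ⟨i, by omega, h2⟩⟩
  · exact ⟨hg, Or.inr ⟨i, by omega, h2⟩⟩

theorem LD.Y_mono {p q p' q' : ℕ} (h : L.Y p q) (hp : p' ≤ p) (hq : q' ≤ q) : L.Y p' q' := by
  obtain ⟨h1, h2, h3⟩ := h
  refine ⟨by omega, by omega, fun l => ?_⟩
  have := h3 l
  omega

theorem LD.E_add_co {p q p' q' : ℕ} (hY : L.Y p' q') (h : p < p' ∨ q' < q) {u : G} (hu : u ∈ L.S) :
    L.E p' q' + u ∈ L.co (p + 1) q := by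
  have h1 := L.mem_S.1 hu
  refine ⟨LD.S_add (L.E_mem_S hY) hu, ?_⟩
  rcases h with h | h
  · refine Or.inl ⟨p', h, hY.1, ?_⟩
    rw [map_add, L.sE _ _ _ hY.1 hY.2.1, if_pos rfl]
    have := h1.1 p' hY.1
    omega
  · refine Or.inr ⟨q', h, hY.2.1, ?_⟩
    rw [map_add, L.tE _ _ _ hY.1 hY.2.1, if_pos rfl]
    have := h1.2.1 q' hY.2.1
    omega

theorem LD.E_co_cancel {p q : ℕ} (hY : L.Y p q) {u : G} (hu : u ∈ L.S)
    (h : L.E p q + u ∈ L.co (p + 1) q) : u ∈ L.co (p + 1) q := by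
  refine ⟨hu, ?_⟩
  rcases h.2 with ⟨i, h1, h2, h3⟩ | ⟨i, h1, h2, h3⟩
  · rw [map_add, L.sE _ _ _ hY.1 hY.2.1, if_neg (by omega), zero_add] at h3
    exact Or.inl ⟨i, h1, h2, h3⟩
  · rw [map_add, L.tE _ _ _ hY.1 hY.2.1, if_neg (by omega), zero_add] at h3
    exact Or.inr ⟨i, h1, h2, h3⟩

theorem LD.co_split {p q : ℕ} (hY : L.Y p q) (g : G) :
    g ∈ L.co p q ∩ L.co (p + 1) (q + 1) ↔ g ∈ L.co (p + 1) q ∨ g - L.E p q ∈ L.S := by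
  constructor
  · rintro ⟨⟨hg, h1⟩, -, h2⟩
    by_cases hn : g ∈ L.co (p + 1) q
    · exact Or.inl hn
    · right
      have h3 := L.mem_S.1 hg
      have hs : ∀ i, p + 1 ≤ i → i ≤ m → L.s i g = 0 := fun i hi hi' => by
        by_contra hc
        exact hn ⟨hg, Or.inl ⟨i, hi, hi', lt_of_le_of_ne (h3.1 i hi') (Ne.symm hc)⟩⟩
      have ht : ∀ j, j < q → L.t j g = 0 := fun j hj => by
        by_contra hc
        have hj' : j ≤ n := by have := hY.2.1; omega
        exact hn ⟨hg, Or.inr ⟨j, hj, hj', lt_of_le_of_ne (h3.2.1 j hj') (Ne.symm hc)⟩⟩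
      refine L.sub_E_mem hg hY ?_ ?_ (fun i hi hi' => hs i hi' hi) ht
      · rcases h1 with ⟨i, h4, h5, h6⟩ | ⟨i, h4, h5, h6⟩
        · rcases Nat.lt_or_ge p i with h | h
          · rw [hs i h h5] at h6; exact absurd h6 (lt_irrefl _)
          · rwa [show p = i by omega]
        · rw [ht i h4] at h6; exact absurd h6 (lt_irrefl _)
      · rcases h2 with ⟨i, h4, h5, h6⟩ | ⟨i, h4, h5, h6⟩
        · rw [hs i h4 h5] at h6; exact absurd h6 (lt_irrefl _)
        · rcases Nat.lt_or_ge i q with h | h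
          · rw [ht i h] at h6; exact absurd h6 (lt_irrefl _)
          · rwa [show q = i by omega]
  · rintro (h | h)
    · exact ⟨LD.co_mono (by omega) le_rfl h, LD.co_mono le_rfl (by omega) h⟩
    · have hg : g ∈ L.S := by
        have := LD.S_add (L.E_mem_S hY) h
        simpa using this
      have h3 := L.mem_S.1 h
      refine ⟨⟨hg, Or.inl ⟨p, le_rfl, hY.1, ?_⟩⟩, ⟨hg, Or.inr ⟨q, by omega, hY.2.1, ?_⟩⟩⟩
      · have := h3.1 p hY.1
        rw [map_sub, L.sE _ _ _ hY.1 hY.2.1, if_pos rfl] at this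
        omega
      · have := h3.2.1 q hY.2.1
        rw [map_sub, L.tE _ _ _ hY.1 hY.2.1, if_pos rfl] at this
        omega


theorem stab_inter {A B : Set G} (hA : Stab L A) (hB : Stab L B) : Stab L (A ∩ B) :=
  fun s hs a ha => ⟨hA s hs a ha.1, hB s hs a ha.2⟩

theorem LD.sreg (hR : RData k L.cd R) (hy : IsY k L y) : ∀ (N p q : ℕ), p + (n - q) = N → L.Y p q →
    SReg hR (N + 1) (fun i => y ((m - p) + q + i)) L.S (L.co (p + 1) q) ∧
    (L.Y p (q + 1) → SReg hR (N + 1) (fun i => y ((m - p) + q + i))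
      (L.co (p + 1) (q + 1)) (L.co (p + 1) q)) := by
  intro N
  induction N with
  | zero =>
    intro p q hN hY
    have hq := hY.2.1
    obtain rfl : p = 0 := by omega
    obtain rfl : q = n := by omega
    refine ⟨?_, fun h => absurd h.2.1 (by omega)⟩
    refine SReg.succ hR hy (V' := L.co 0 q ∩ L.co 1 (q + 1)) hY rfl LD.stab_S (LD.stab_co _ _) ?_ ?_
      (LD.co_split hY) ?_
    · intro p' q' hY' hc hne u hu
      refine LD.E_add_co hY' ?_ hu
      have := hY'.1
      have := hY.1
      omega
    · intro u hu h
      exact LD.E_co_cancel hY hu h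
    · refine ⟨LD.stab_S, stab_inter (LD.stab_co _ _) (LD.stab_co _ _), ?_⟩
      refine ⟨{XX k 0}, ?_, ?_⟩
      · intro f hf
        obtain rfl := Finset.mem_singleton.1 hf
        exact XX_mem.2 CData.zero_mem_A
      · intro u hu
        obtain ⟨f1, hf1, f2, hf2, rfl⟩ := mon_split (V := L.co 0 q ∩ L.co 1 (q + 1)) (W := {0})
          (mon_mono (A := L.S) (fun g hg => by
            by_cases h0 : g = 0
            · exact Or.inr h0
            · left
              constructor
              · by_contra hc
                exact h0 (LD.co_eq_zero hg (Or.inl fun h => hc (LD.co_mono le_rfl (by omega) h)))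
              · by_contra hc
                exact h0 (LD.co_eq_zero hg (Or.inr fun h => hc (LD.co_mono (by omega) (by omega) h)))) hu)
        refine ⟨f2, ?_, by rw [add_sub_cancel_right]; exact hf1⟩
        rw [Finset.coe_singleton, Submodule.mem_span_singleton]
        refine ⟨f2.coeff 0, ?_⟩
        classical
        apply AddMonoidAlgebra.coeff_injective
        ext g
        rw [AddMonoidAlgebra.coeff_smul, Finsupp.smul_apply, coeff_XX]
        by_cases h0 : g = 0
        · subst h0; simp
        · rw [if_neg (fun h => h0 (by first | exact h | exact h.symm)), smul_zero]
          by_contra hc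
          exact h0 (hf2 g (Ne.symm hc))
  | succ N ih =>
    intro p q hN hY
    have hpm := hY.1
    have hqn := hY.2.1
    have key1 : ∀ p' q', L.Y p' q' → (m - p') + q' = (m - p) + q → (p' ≠ p ∨ q' ≠ q) →
        p < p' ∨ q' < q := by
      intro p' q' hY' hc hne
      have := hY'.1
      omega
    -- the quotient U / W for `p ≥ 1`
    have keyB : ∀ p0, p = p0 + 1 → L.Y p (q + 1) →
        SReg hR (N + 1) (fun i => y ((m - p) + q + 1 + i)) (L.co (p + 1) (q + 1))
          (L.co p q ∩ L.co (p + 1) (q + 1)) := by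
      rintro p0 rfl hY1
      have h1 := (ih p0 q (by omega) (LD.Y_mono hY (by omega) le_rfl)).2
        (LD.Y_mono hY1 (by omega) le_rfl)
      have e : (m - p0) + q = (m - (p0 + 1)) + q + 1 := by omega
      rw [e] at h1
      refine SReg.congr hR (LD.stab_co _ _) (stab_inter (LD.stab_co _ _) (LD.stab_co _ _))
        (LD.co_mono (by omega) le_rfl) (fun g hg => hg.1) ?_ (fun g hg => ⟨hg.2, hg.1⟩) h1
      rintro g ⟨hg, ⟨i, h2, h3⟩ | ⟨i, h2, h3⟩⟩
      · exact Or.inr ⟨hg, Or.inl ⟨i, h2, h3⟩⟩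
      · exact Or.inl ⟨hg, Or.inr ⟨i, h2, h3⟩⟩
    have keyW : p = 0 → L.co p q ∩ L.co (p + 1) (q + 1) = L.co (p + 1) (q + 1) := by
      rintro rfl
      refine Set.inter_eq_right.2 fun g hg => ?_
      by_contra hc
      have := LD.co_eq_zero hg.1 (Or.inl fun h => hc (LD.co_mono le_rfl (by omega) h))
      subst this
      rcases hg.2 with ⟨i, _, _, h⟩ | ⟨i, _, _, h⟩ <;> simp at h
    have keyA : L.Y p (q + 1) →
        SReg hR (N + 1) (fun i => y ((m - p) + q + 1 + i)) L.S (L.co (p + 1) (q + 1)) := by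
      intro hY1
      have := hY1.2.1
      have h1 := (ih p (q + 1) (by omega) hY1).1
      rwa [← add_assoc] at h1
    constructor
    · refine SReg.succ hR hy (V' := L.co p q ∩ L.co (p + 1) (q + 1)) hY rfl LD.stab_S
        (LD.stab_co _ _) ?_ ?_ (LD.co_split hY) ?_
      · intro p' q' hY' hc hne u hu
        exact LD.E_add_co hY' (key1 p' q' hY' hc hne) hu
      · intro u hu h
        exact LD.E_co_cancel hY hu h
      · by_cases hY1 : L.Y p (q + 1)
        · rcases Nat.eq_zero_or_pos p with h0 | h0
          · rw [keyW h0]; exact keyA hY1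
          · exact SReg.ext hR Set.inter_subset_right (fun g hg => hg.1)
              (keyB (p - 1) (by omega) hY1) (keyA hY1)
        · have h0 : p ≠ 0 := by
            rintro rfl
            exact hY1 ⟨by omega, by omega, fun l => Or.inl (Nat.zero_le _)⟩
          obtain ⟨p0, rfl⟩ : ∃ p0, p = p0 + 1 := ⟨p - 1, by omega⟩
          have h1 := (ih p0 q (by omega) (LD.Y_mono hY (by omega) le_rfl)).1
          have e : (m - p0) + q = (m - (p0 + 1)) + q + 1 := by omega
          rw [e] at h1
          have e2 : L.co (p0 + 1) q ∩ L.co (p0 + 1 + 1) (q + 1) = L.co (p0 + 1) q := by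
            refine Set.inter_eq_left.2 fun g hg => ?_
            by_contra hc
            have h3 := L.mem_S.1 hg.1
            have hs : ∀ i, p0 + 1 + 1 ≤ i → i ≤ m → L.s i g = 0 := fun i hi hi' => by
              by_contra hc'
              exact hc ⟨hg.1, Or.inl ⟨i, hi, hi', lt_of_le_of_ne (h3.1 i hi') (Ne.symm hc')⟩⟩
            have ht : ∀ j, j < q + 1 → j ≤ n → L.t j g = 0 := fun j hj hj' => by
              by_contra hc'
              exact hc ⟨hg.1, Or.inr ⟨j, hj, hj', lt_of_le_of_ne (h3.2.1 j hj') (Ne.symm hc')⟩⟩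
            have hs' : 0 < L.s (p0 + 1) g := by
              rcases hg.2 with ⟨i, h4, h5, h6⟩ | ⟨i, h4, h5, h6⟩
              · rcases Nat.lt_or_ge (p0 + 1) i with h | h
                · rw [hs i h h5] at h6; exact absurd h6 (lt_irrefl _)
                · rwa [show p0 + 1 = i by omega]
              · rw [ht i (by omega) h5] at h6; exact absurd h6 (lt_irrefl _)
            rcases Nat.lt_or_ge q n with h | h
            · exact hY1 (L.Y_of_extreme hg.1 hpm h hs' fun j hj => ht j hj (by omega))
            · have : g = 0 := LD.co_eq_zero hg.1 (Or.inr fun hcc => by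
                rcases hcc.2 with ⟨i, h4, h5, h6⟩ | ⟨i, h4, h5, h6⟩
                · omega
                · rw [ht i (by omega) h5] at h6; exact absurd h6 (lt_irrefl _))
              rw [this, map_zero] at hs'
              exact absurd hs' (lt_irrefl _)
          rw [e2]
          exact h1
    · intro hY1
      have hstab : Stab L (L.co (p + 1) q ∪ {g | g - L.E p q ∈ L.co (p + 1) (q + 1)}) := by
        rintro s hs g (hg | hg)
        · exact Or.inl (LD.stab_co _ _ s hs g hg)
        · right
          rw [Set.mem_setOf_eq, add_sub_assoc]
          exact LD.stab_co _ _ s hs _ hg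
      refine SReg.succ hR hy (V' := L.co (p + 1) q ∪ {g | g - L.E p q ∈ L.co (p + 1) (q + 1)}) hY
        rfl (LD.stab_co _ _) (LD.stab_co _ _) ?_ ?_ (fun g => Iff.rfl) ?_
      · intro p' q' hY' hc hne u hu
        exact LD.E_add_co hY' (key1 p' q' hY' hc hne) hu.1
      · intro u hu h
        exact LD.E_co_cancel hY hu.1 h
      · have h1 : SReg hR (N + 1) (fun i => y ((m - p) + q + 1 + i))
            (L.co p q ∩ L.co (p + 1) (q + 1))
            (L.co (p + 1) q ∪ {g | g - L.E p q ∈ L.co (p + 1) (q + 1)}) := by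
          refine SReg.mul hR (L.E_mem_S hY) (stab_inter (LD.stab_co _ _) (LD.stab_co _ _)) hstab
            ?_ ?_ ?_ ?_ (keyA hY1)
          · intro g hg
            exact (LD.co_split hY _).2 (Or.inr (by simpa using hg))
          · intro g hg
            exact Or.inr (by simpa using hg)
          · intro g hg
            rcases (LD.co_split hY _).1 hg with h | h
            · exact Or.inl (Or.inl h)
            · exact Or.inr h
          · rintro g hg (h | h)
            · exact LD.co_mono le_rfl (by omega) (LD.E_co_cancel hY hg h)
            · simpa using h
        rcases Nat.eq_zero_or_pos p with h0 | h0
        · rwa [keyW h0] at h1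
        · refine SReg.ext hR ?_ Set.inter_subset_right h1 (keyB (p - 1) (by omega) hY1)
          rintro g (h | h)
          · exact (LD.co_split hY _).2 (Or.inl h)
          · exact (LD.co_split hY _).2 (Or.inr h.1)

theorem LD.wreg (hR : RData k L.cd R) (hy : IsY k L y) : WReg k (m + n + 1) y (⊤ : Submodule R R) ⊥ := by
  obtain ⟨hU, hV, h⟩ := (LD.sreg hR hy (m + n) m 0 (by omega)
    ⟨le_rfl, Nat.zero_le _, fun l => Or.inr (Nat.zero_le _)⟩).1
  have e : (fun i => y ((m - m) + 0 + i)) = y := by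
    funext i; congr 1; omega
  rw [e] at h
  refine WReg.transfer_rev (Algebra.linearMap R (AddMonoidAlgebra k G)) _ y ?_ ?_ ?_ ?_ h
  · intro u _
    exact hR.mem u
  · intro v hv
    rw [(Submodule.mem_bot R).1 hv, map_zero]; exact zero_mem _
  · intro u hu
    obtain ⟨r, hr⟩ := hR.surj u hu
    exact ⟨r, trivial, by rw [Algebra.linearMap_apply, hr, sub_self]; exact zero_mem _⟩
  · intro u _ hu
    rw [Submodule.mem_bot]
    apply hR.inj
    rw [map_zero]
    apply AddMonoidAlgebra.coeff_injective
    ext g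
    by_contra hc
    have := hu g hc
    rcases this.2 with ⟨i, h1, h2, _⟩ | ⟨i, h1, _⟩ <;> omega

end


section
variable {R M : Type} [CommRing R] [AddCommGroup M] [Module R M]

theorem mem_span_smul_top {c : ℕ} {y : ℕ → R} {x : M}
    (hx : x ∈ Ideal.span (y '' Set.Iio c) • (⊤ : Submodule R M)) :
    ∃ f : Fin c → M, x = ∑ j : Fin c, y j • f j := by
  refine Submodule.smul_induction_on hx ?_ ?_
  · intro r hr n _
    have h1 : Ideal.span (y '' Set.Iio c) = Ideal.span (Set.range fun j : Fin c => y j) := by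
      congr 1
      ext z
      constructor
      · rintro ⟨i, hi, rfl⟩; exact ⟨⟨i, hi⟩, rfl⟩
      · rintro ⟨i, rfl⟩; exact ⟨i, i.2, rfl⟩
    rw [h1, Ideal.mem_span_range_iff_exists_fun] at hr
    obtain ⟨a, rfl⟩ := hr
    refine ⟨fun j => a j • n, ?_⟩
    rw [Finset.sum_smul]
    refine Finset.sum_congr rfl fun j _ => ?_
    rw [smul_smul, mul_comm]
  · rintro x z ⟨f, rfl⟩ ⟨g, rfl⟩
    exact ⟨f + g, by rw [← Finset.sum_add_distrib]; simp⟩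

end

section
variable {k : Type} [Field k] {m n : ℕ} {G Λ : Type} [AddCommGroup G] [LinearOrder Λ] {L : LD m n G Λ}
  {R : Type} [CommRing R] [Algebra k R] [Algebra R (AddMonoidAlgebra k G)]
  [IsScalarTower k R (AddMonoidAlgebra k G)]

theorem LD.deg_ge {d : Λ → ℤ} {g : G} (hg : g ∈ L.cd.A d) : d L.bot ≤ L.deg g := by
  have h1 := hg.2 L.bot
  change d L.bot ≤ L.κ L.bot g at h1
  rw [L.κ_deg, L.abot, L.bbot, Finset.Ioc_self, Finset.sum_empty, sub_zero] at h1
  have : 0 ≤ ∑ i ∈ Finset.Ioc 0 m, L.s i g := Finset.sum_nonneg fun i hi => by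
    rw [Finset.mem_Ioc] at hi
    exact (L.mem_T.1 hg.1).1 i hi.1 hi.2
  omega

variable {c : ℕ} {y : ℕ → R}
  [Algebra (MvPolynomial (Fin c) k) R] [Algebra (MvPolynomial (Fin c) k) (AddMonoidAlgebra k G)]
  [IsScalarTower (MvPolynomial (Fin c) k) R (AddMonoidAlgebra k G)]

theorem filt_y (hy : IsY k L y) (D : ℤ) (j : ℕ) (f : AddMonoidAlgebra k G) :
    filt (fun g => L.deg g = D) (y j • f) = y j • filt (fun g => L.deg g = D - 1) f := by
  rw [Algebra.smul_def, hy, Finset.sum_mul, map_sum, Algebra.smul_def, hy, Finset.sum_mul]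
  refine Finset.sum_congr rfl fun x hx => ?_
  have hY := (LD.mem_diag.1 hx).1
  rw [filt_XX_mul]
  congr 2
  congr 1
  funext g
  rw [map_add, L.degE hY.1 hY.2.1]
  exact propext ⟨fun h => by omega, fun h => by omega⟩

theorem filt_XX_homog (D : ℤ) (g : G) (a : k) : filt (fun g => L.deg g = D) (a • XX k g) =
    (if L.deg g = D then a else 0) • XX k g := by
  rw [map_smul]
  split_ifs with h
  · rw [filt_eq_self]
    exact XX_mem.2 h
  · rw [filt_eq_zero, smul_zero, zero_smul]
    exact XX_mem.2 h

/-- monomial elements -/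
noncomputable def moI (hR : RData k L.cd R) (d : Λ → ℤ) (g : L.cd.A d) : Ib hR d :=
  ⟨XX k (g : G), XX_mem.2 g.2⟩

theorem span_mo (hR : RData k L.cd R) (d : Λ → ℤ) :
    Submodule.span k (Set.range (moI hR d)) = ⊤ := by
  rw [eq_top_iff]
  intro f _
  have h1 : (f : AddMonoidAlgebra k G) ∈ (Submodule.span k (Set.range (moI hR d))).map
      ((Ib hR d).subtype.restrictScalars k) := by
    refine mon_induction (p := fun f => f ∈ (Submodule.span k (Set.range (moI hR d))).map
      ((Ib hR d).subtype.restrictScalars k)) (mem_Ib.1 f.2) (zero_mem _) (fun _ _ => add_mem) ?_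
    intro a g hg
    refine Submodule.smul_mem _ a ⟨moI hR d ⟨g, hg⟩, Submodule.subset_span ⟨_, rfl⟩, rfl⟩
  obtain ⟨f', h2, h3⟩ := h1
  have : f' = f := Subtype.ext h3
  rwa [← this]

theorem Ib_free (hR : RData k L.cd R) (hy : IsY k L y)
    (hP : ∀ p : MvPolynomial (Fin c) k, algebraMap _ R p = MvPolynomial.aeval (fun j : Fin c => y j) p)
    (d : Λ → ℤ) (hW : WReg k c y (⊤ : Submodule R (Ib hR d)) ⊥) :
    Module.Free (MvPolynomial (Fin c) k) (Ib hR d) ∧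
      Module.Finite (MvPolynomial (Fin c) k) (Ib hR d) := by
  classical
  set W : Submodule R (Ib hR d) := Ideal.span (y '' Set.Iio c) • (⊤ : Submodule R (Ib hR d)) with hWdef
  set Q := Ib hR d ⧸ W.restrictScalars k
  set mo : L.cd.A d → Ib hR d := moI hR d with hmodef
  have hmo : Submodule.span k (Set.range mo) = ⊤ := span_mo hR d
  have hQfin : Module.Finite k Q := by
    obtain ⟨t, -, ht⟩ := WReg.finite c y hW
    refine ⟨⟨t.image (Submodule.Quotient.mk : Ib hR d → Q), ?_⟩⟩
    rw [eq_top_iff]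
    rintro x -
    obtain ⟨u, rfl⟩ := Submodule.Quotient.mk_surjective _ x
    obtain ⟨w, hw, hu⟩ := ht u trivial
    rw [bot_sup_eq] at hu
    have : (Submodule.Quotient.mk u : Q) = Submodule.mkQ (W.restrictScalars k) w := by
      exact (Submodule.Quotient.eq _).2 hu
    rw [this, Finset.coe_image]
    have h5 := Submodule.mem_map_of_mem (f := Submodule.mkQ (W.restrictScalars k)) hw
    rw [Submodule.map_span] at h5
    exact h5
  obtain ⟨ι, a, ha, hspan, hli⟩ := exists_linearIndependent' k
    (fun g => (Submodule.mkQ (W.restrictScalars k)) (mo g))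
  have hι : Fintype ι := @Fintype.ofFinite ι hli.finite_of_isNoetherian
  have hspan' : ∀ u : Ib hR d, ∃ b : ι → k, u - ∑ i, b i • mo (a i) ∈ W := by
    intro u
    have h1 : Submodule.mkQ (W.restrictScalars k) u ∈ Submodule.span k
        (Set.range ((fun g => (Submodule.mkQ (W.restrictScalars k)) (mo g)) ∘ a)) := by
      rw [hspan]
      have h5 := Submodule.mem_map_of_mem (f := Submodule.mkQ (W.restrictScalars k))
        (show u ∈ Submodule.span k (Set.range mo) by rw [hmo]; trivial)
      rw [Submodule.map_span, ← Set.range_comp] at h5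
      exact h5
    rw [Submodule.mem_span_range_iff_exists_fun] at h1
    obtain ⟨b, hb⟩ := h1
    refine ⟨b, ?_⟩
    have : (Submodule.mkQ (W.restrictScalars k)) (∑ i, b i • mo (a i)) =
      Submodule.mkQ (W.restrictScalars k) u := by
      rw [← hb, map_sum]; rfl
    exact (Submodule.Quotient.eq _).1 this.symm
  have hind : LinearIndependent (MvPolynomial (Fin c) k) fun i => mo (a i) := by
    rw [Fintype.linearIndependent_iff]
    intro p hp i
    have h1 := WReg.independent (fun i => mo (a i)) c y ⊥ hW (fun b hb => by
      rw [bot_sup_eq] at hb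
      rw [Fintype.linearIndependent_iff] at hli
      funext i
      refine hli b ?_ i
      have h2 : (Submodule.mkQ (W.restrictScalars k)) (∑ i, b i • mo (a i)) = 0 :=
        (Submodule.Quotient.mk_eq_zero _).2 hb
      rw [map_sum] at h2
      exact h2) p (by
      rw [Submodule.mem_bot, ← hp]
      refine Finset.sum_congr rfl fun i _ => ?_
      rw [← hP, algebraMap_smul])
    exact congrFun h1 i
  set N := Submodule.span (MvPolynomial (Fin c) k) (Set.range fun i => mo (a i)) with hN
  set N' : Submodule (MvPolynomial (Fin c) k) (AddMonoidAlgebra k G) :=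
    Submodule.span (MvPolynomial (Fin c) k) (Set.range fun i => XX k (a i : G)) with hN'
  have hk : ∀ (b : k) (f : AddMonoidAlgebra k G), b • f = (MvPolynomial.C b : MvPolynomial (Fin c) k) • f := by
    intro b f
    rw [← algebraMap_smul R (MvPolynomial.C b : MvPolynomial (Fin c) k) f, hP]
    simp [algebraMap_smul]
  have hyN : ∀ (j : Fin c) (f : AddMonoidAlgebra k G), y j • f = (MvPolynomial.X j : MvPolynomial (Fin c) k) • f := by
    intro j f
    rw [← algebraMap_smul R (MvPolynomial.X j : MvPolynomial (Fin c) k) f, hP]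
    simp
  have hdeg : ∀ (e : ℕ) (f : AddMonoidAlgebra k G),
      f ∈ mon k (L.cd.A d ∩ {g | L.deg g = d L.bot + e}) → f ∈ N' := by
    intro e
    induction e using Nat.strong_induction_on with
    | _ e ih =>
      intro f hf
      obtain ⟨b, hb⟩ := hspan' ⟨f, mon_mono Set.inter_subset_left hf⟩
      obtain ⟨F, hF⟩ := mem_span_smul_top hb
      have h1 := congrArg (fun z : Ib hR d => (z : AddMonoidAlgebra k G)) hF
      simp only [Submodule.coe_sub, Submodule.coe_sum, Submodule.coe_smul] at h1
      have h1' := congrArg (filt fun g => L.deg g = d L.bot + e) h1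
      rw [map_sub, map_sum, map_sum, filt_eq_self (mon_mono Set.inter_subset_right hf),
        sub_eq_iff_eq_add] at h1'
      rw [h1']
      refine add_mem (sum_mem fun j _ => ?_) (sum_mem fun i _ => ?_)
      · rw [filt_y hy, hyN]
        refine N'.smul_mem _ ?_
        rcases Nat.eq_zero_or_pos e with h0 | h0
        · rw [filt_eq_zero]
          · exact zero_mem _
          · intro g hg hg'
            have := LD.deg_ge ((F j).2 g hg)
            omega
        · refine ih (e - 1) (by omega) _ (mon_mono ?_ (filt_mem _ (F j).2))
          rintro g ⟨hg1, hg2⟩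
          refine ⟨hg1, ?_⟩
          change L.deg g = _ at hg2
          change L.deg g = _
          omega
      · have h9 := filt_XX_homog (L := L) (d L.bot + e) (a i : G) (b i)
        have h10 : ((b i • mo (a i) : Ib hR d) : AddMonoidAlgebra k G) = b i • XX k (a i : G) := rfl
        rw [h10, h9, hk]
        exact N'.smul_mem _ (Submodule.subset_span ⟨i, rfl⟩)
  have hall : ∀ f ∈ mon k (L.cd.A d), f ∈ N' := by
    intro f hf
    refine mon_induction hf (zero_mem _) (fun _ _ => add_mem) fun b g hg => ?_
    rw [hk]
    refine N'.smul_mem _ (hdeg (L.deg g - d L.bot).toNat _ (XX_mem.2 ⟨hg, ?_⟩))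
    have := LD.deg_ge hg
    change L.deg g = _
    omega
  have htop : ⊤ ≤ N := by
    intro f _
    have h1 : N.map ((Ib hR d).subtype.restrictScalars (MvPolynomial (Fin c) k)) = N' := by
      rw [hN, Submodule.map_span, ← Set.range_comp]
      rfl
    have h2 := hall f.1 f.2
    rw [← h1] at h2
    obtain ⟨f', h3, h4⟩ := h2
    have : f' = f := Subtype.ext h4
    rwa [← this]
  let bas := Module.Basis.mk hind htop
  exact ⟨Module.Free.of_basis bas, Module.Finite.of_basis bas⟩

end

section
open scoped TensorProduct

section
variable {k : Type} [Field k] {G H : Type} [AddCommGroup G] [AddCommGroup H] (unk : G →+ H)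

/-- component of weight `θ` -/
noncomputable def wt (θ : H) : AddMonoidAlgebra k G →ₗ[k] AddMonoidAlgebra k G :=
  filt fun g => unk g = θ

theorem wt_XX (g : G) : wt unk (unk g) (XX k g) = XX k g := filt_eq_self (XX_mem.2 rfl)

theorem wt_XX' {g : G} {θ : H} (h : unk g ≠ θ) : wt unk θ (XX k g) = 0 := filt_eq_zero (XX_mem.2 h)

theorem wt_mul {A B : Set G} {θ σ : H} (h : ∀ s ∈ A, ∀ a ∈ B, unk (s + a) = θ → unk s = σ)
    {f g : AddMonoidAlgebra k G} (hf : f ∈ mon k A) (hg : g ∈ mon k B) :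
    wt unk θ (f * g) = wt unk σ f * wt unk (θ - σ) g := by
  refine mon_induction (p := fun f => wt unk θ (f * g) = wt unk σ f * wt unk (θ - σ) g) hf ?_ ?_ ?_
  · simp
  · intro f f' h1 h2
    rw [add_mul, map_add, h1, h2, map_add, add_mul]
  · intro c s hs
    rw [smul_mul_assoc, map_smul, map_smul, smul_mul_assoc]
    congr 1
    rw [wt, filt_XX_mul]
    by_cases h1 : unk s = σ
    · subst h1
      rw [wt_XX, wt]
      congr 2
      congr 1
      funext a
      rw [map_add, eq_sub_iff_add_eq, add_comm]
    · rw [wt_XX' unk h1, zero_mul, filt_eq_zero, mul_zero]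
      intro a ha h2
      exact h1 (h s hs a (hg a ha) h2)

theorem wt_mul_irr {A : Set G} {θ : H} (h0 : θ ≠ 0)
    (h : ∀ s ∈ A, ∀ a ∈ A, unk (s + a) = θ → unk s = 0 ∨ unk a = 0)
    {f g : AddMonoidAlgebra k G} (hf : f ∈ mon k A) (hg : g ∈ mon k A) :
    wt unk θ (f * g) = wt unk 0 f * wt unk θ g + wt unk θ f * wt unk 0 g := by
  refine mon_induction (p := fun f => wt unk θ (f * g) = wt unk 0 f * wt unk θ g +
    wt unk θ f * wt unk 0 g) hf ?_ ?_ ?_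
  · simp
  · intro f f' h1 h2
    rw [add_mul, map_add, h1, h2, map_add, map_add]
    ring
  · intro c s hs
    rw [smul_mul_assoc, map_smul, map_smul, map_smul, smul_mul_assoc, smul_mul_assoc, ← smul_add]
    congr 1
    have e : wt unk θ (XX k s * g) = XX k s * filt (fun a => unk (s + a) = θ) g := filt_XX_mul _ _ _
    rw [e]
    by_cases h1 : unk s = 0
    · have e1 : wt unk 0 (XX k s) = XX k s := by rw [← h1]; exact wt_XX unk s
      rw [e1, wt_XX' unk (θ := θ) (by rw [h1]; exact h0.symm), zero_mul, add_zero, wt]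
      congr 2
      congr 1
      funext a
      rw [map_add, h1, zero_add]
    · rw [wt_XX' unk h1, zero_mul, zero_add]
      by_cases h2 : unk s = θ
      · subst h2
        rw [wt_XX, wt]
        congr 2
        congr 1
        funext a
        rw [map_add, add_eq_left]
      · rw [wt_XX' unk h2, zero_mul, filt_eq_zero, mul_zero]
        intro a ha h3
        rcases h s hs a (hg a ha) h3 with h4 | h4
        · exact h1 h4
        · rw [map_add, h4, add_zero] at h3
          exact h2 h3

theorem wt_zero_ne {f : AddMonoidAlgebra k G} (h : f.coeff 0 ≠ 0) : wt unk 0 f ≠ 0 := by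
  classical
  intro h1
  have h2 := coeff_filt (fun g => unk g = 0) f 0
  rw [if_pos (map_zero unk)] at h2
  apply h
  rw [← h2]
  change (wt unk 0 f).coeff 0 = 0
  rw [h1]; rfl

end

section
variable {k : Type} [Field k] {G Λ H : Type} [AddCommGroup G] [AddCommGroup H] {D : CData G Λ}
  {R : Type} [CommRing R] [Algebra R (AddMonoidAlgebra k G)]

/-- minimality of a weight -/
def MinW (D : CData G Λ) (unk : G →+ H) (d : Λ → ℤ) (θ : H) : Prop :=
  ∀ s ∈ D.A 0, ∀ a ∈ D.A d, unk (s + a) = θ → unk s = 0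

theorem wt_smul {hR : RData k D R} {unk : G →+ H} {d : Λ → ℤ} {θ : H} (hm : MinW D unk d θ) (r : R)
    (f : AddMonoidAlgebra k G) (hf : f ∈ Ib hR d) :
    wt unk θ (r • f) = wt unk 0 (algebraMap R (AddMonoidAlgebra k G) r) * wt unk θ f := by
  rw [Algebra.smul_def, wt_mul unk hm (hR.mem r) hf, sub_zero]

/-- test map on tensor products -/
theorem exists_test {hR : RData k D R} {unk : G →+ H} {d' : Λ → ℤ} {θ' : H}
    (hm' : MinW D unk d' θ') {X : Type} [AddCommGroup X] [Module R X]
    (Ψ : X →+ AddMonoidAlgebra k G) (hΨ : ∀ (r : R) x, Ψ (r • x) =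
      wt unk 0 (algebraMap R (AddMonoidAlgebra k G) r) * Ψ x) :
    ∃ T : X ⊗[R] Ib hR d' →+ AddMonoidAlgebra k G, (∀ x f, T (x ⊗ₜ f) = Ψ x * wt unk θ' f) ∧
      ∀ (r : R) z, T (r • z) = wt unk 0 (algebraMap R (AddMonoidAlgebra k G) r) * T z := by
  let Φ : Ib hR d' →+ AddMonoidAlgebra k G :=
    (wt (k := k) unk θ').toAddMonoidHom.comp (Ib hR d').subtype.toAddMonoidHom
  have hΦ : ∀ (r : R) f, Φ (r • f) = wt unk 0 (algebraMap R (AddMonoidAlgebra k G) r) * Φ f :=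
    fun r f => wt_smul hm' r f.1 f.2
  let b : X →+ Ib hR d' →+ AddMonoidAlgebra k G :=
    { toFun := fun x => (AddMonoidHom.mulLeft (Ψ x)).comp Φ
      map_zero' := by ext f; simp
      map_add' := fun x x' => by ext f; simp [add_mul] }
  have hb : ∀ x f, b x f = Ψ x * Φ f := fun _ _ => rfl
  have hT : ∀ x f, TensorProduct.liftAddHom (R := R) b (fun r x f => by rw [hb, hb, hΨ, hΦ]; ring)
    (x ⊗ₜ f) = Ψ x * Φ f := fun x f => rfl
  refine ⟨TensorProduct.liftAddHom (R := R) b (fun r x f => by rw [hb, hb, hΨ, hΦ]; ring),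
    fun x f => rfl, fun r z => ?_⟩
  induction z with
  | zero => rw [smul_zero, map_zero, mul_zero]
  | tmul x f =>
    rw [TensorProduct.smul_tmul', hT, hT, hΨ, mul_assoc]
  | add z z' h h' => rw [smul_add, map_add, h, h', map_add, mul_add]

/-- torsion of the tensor product is killed -/
def M1 (hR : RData k D R) (d d' : Λ → ℤ) : Prop :=
  ∃ r0 : R, (algebraMap R (AddMonoidAlgebra k G) r0).coeff 0 ≠ 0 ∧
    ∀ z : Ib hR d ⊗[R] Ib hR d', (∃ r : R, r ≠ 0 ∧ r • z = 0) → r0 • z = 0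

/-- the Tor of the pair is killed -/
def M2 (hR : RData k D R) (d d' : Λ → ℤ) : Prop :=
  ∀ (J : Finset (D.A d)) (p : (J → R) →ₗ[R] Ib hR d), (∀ f, (p f : AddMonoidAlgebra k G) =
    ∑ j, f j • XX k ((j : D.A d) : G)) → Function.Surjective p →
  ∃ r0 : R, (algebraMap R (AddMonoidAlgebra k G) r0).coeff 0 ≠ 0 ∧
    ∀ z : LinearMap.ker p ⊗[R] Ib hR d', ((LinearMap.ker p).subtype.rTensor _) z = 0 → r0 • z = 0

theorem exists_nsmul_mem [Finite Λ] (a : G) (ha : a ∈ D.T) : ∃ N : ℕ, ∀ M : ℕ, N ≤ M → M • D.x + a ∈ D.A 0 := by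
  obtain ⟨N, hN⟩ : ∃ N : ℕ, ∀ l, - D.κ l a ≤ N := by
    obtain ⟨N, hN⟩ := (Set.finite_range fun l => - D.κ l a).bddAbove
    exact ⟨N.toNat, fun l => le_trans (hN ⟨l, rfl⟩) (Int.self_le_toNat N)⟩
  refine ⟨N, fun M hM => ⟨D.T.add_mem (D.T.nsmul_mem D.hx _) ha, fun l => ?_⟩⟩
  have := hN l
  rw [map_add, map_nsmul, D.κx]
  simp
  omega

theorem F1 [Finite Λ] [IsDomain (AddMonoidAlgebra k G)] {hR : RData k D R} {d d' : Λ → ℤ}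
    (h1 : M1 hR d d') (unk : G →+ H)
    {a0 a1 b0 b1 : G} (ha0 : a0 ∈ D.A d) (ha1 : a1 ∈ D.A d) (hb0 : b0 ∈ D.A d') (hb1 : b1 ∈ D.A d')
    (hab : a0 + b1 = a1 + b0) (hne : unk a1 ≠ unk a0) (hm : MinW D unk d (unk a0))
    (hm' : MinW D unk d' (unk b1)) : False := by
  obtain ⟨r0, hr0, hz⟩ := h1
  obtain ⟨N0, hN0⟩ := exists_nsmul_mem a0 ha0.1
  obtain ⟨N1, hN1⟩ := exists_nsmul_mem a1 ha1.1
  obtain ⟨x0, hx0⟩ := hR.surj _ (XX_mem.2 (hN0 (max N0 N1) (le_max_left _ _)))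
  obtain ⟨x1, hx1⟩ := hR.surj _ (XX_mem.2 (hN1 (max N0 N1) (le_max_right _ _)))
  let A0 : Ib hR d := ⟨XX k a0, XX_mem.2 ha0⟩
  let A1 : Ib hR d := ⟨XX k a1, XX_mem.2 ha1⟩
  let B0 : Ib hR d' := ⟨XX k b0, XX_mem.2 hb0⟩
  let B1 : Ib hR d' := ⟨XX k b1, XX_mem.2 hb1⟩
  have e1 : x1 • A0 = x0 • A1 := by
    apply Subtype.ext
    change x1 • XX k a0 = x0 • XX k a1
    rw [Algebra.smul_def, Algebra.smul_def, hx0, hx1, XX_mul, XX_mul]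
    congr 1; abel
  have e2 : x0 • B1 = x1 • B0 := by
    apply Subtype.ext
    change x0 • XX k b1 = x1 • XX k b0
    rw [Algebra.smul_def, Algebra.smul_def, hx0, hx1, XX_mul, XX_mul]
    congr 1
    rw [add_assoc, add_assoc, hab]
  have h2 := hz (A0 ⊗ₜ B1 - A1 ⊗ₜ B0) ⟨x1, by
    rintro rfl
    rw [map_zero] at hx1
    exact XX_ne_zero _ hx1.symm, by
    rw [smul_sub, TensorProduct.smul_tmul', e1, TensorProduct.smul_tmul, e2,
      TensorProduct.tmul_smul, sub_self]⟩
  obtain ⟨T, hT, hT'⟩ := exists_test (hR := hR) hm'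
    (((wt (k := k) unk (unk a0)).toAddMonoidHom.comp (Ib hR d).subtype.toAddMonoidHom))
    (fun r f => wt_smul hm r f.1 f.2)
  have h3 := congrArg T h2
  rw [hT', map_sub, hT, hT, map_zero] at h3
  change _ * (wt unk (unk a0) (XX k a0) * wt unk (unk b1) (XX k b1) -
    wt unk (unk a0) (XX k a1) * wt unk (unk b1) (XX k b0)) = 0 at h3
  rw [wt_XX, wt_XX, wt_XX' unk hne, zero_mul, sub_zero, XX_mul] at h3
  rcases mul_eq_zero.1 h3 with h | h
  · exact wt_zero_ne unk hr0 h
  · exact XX_ne_zero _ h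

end

end

section
open scoped TensorProduct

section
variable {k : Type} [Field k] {G Λ H : Type} [AddCommGroup G] [AddCommGroup H] {D : CData G Λ}
  {R : Type} [CommRing R] [Algebra R (AddMonoidAlgebra k G)]

/-- monomial elements -/
noncomputable def moD (hR : RData k D R) (d : Λ → ℤ) (g : D.A d) : Ib hR d :=
  ⟨XX k (g : G), XX_mem.2 g.2⟩

theorem span_moD (hR : RData k D R) (d : Λ → ℤ) :
    Submodule.span R (Set.range (moD hR d)) = ⊤ := by
  rw [eq_top_iff]
  intro f _
  have h1 : (f : AddMonoidAlgebra k G) ∈ (Submodule.span R (Set.range (moD hR d))).map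
      ((Ib hR d).subtype) := by
    refine mon_induction (p := fun f => f ∈ (Submodule.span R (Set.range (moD hR d))).map
      ((Ib hR d).subtype)) (mem_Ib.1 f.2) (zero_mem _) (fun _ _ => add_mem) ?_
    intro a g hg
    obtain ⟨r, hr⟩ := hR.surj (a • XX k 0) (Submodule.smul_mem _ _ (XX_mem.2 CData.zero_mem_A))
    have : a • XX k g = r • XX k g := by
      rw [Algebra.smul_def r (XX k g), hr, smul_mul_assoc, XX_mul, zero_add]
    rw [this]
    exact Submodule.smul_mem _ r ⟨moD hR d ⟨g, hg⟩, Submodule.subset_span ⟨_, rfl⟩, rfl⟩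
  obtain ⟨f', h2, h3⟩ := h1
  have : f' = f := Subtype.ext h3
  rwa [← this]

theorem exists_gens (hR : RData k D R) (d : Λ → ℤ) [Module.Finite R (Ib hR d)] (a0 a1 : D.A d) :
    ∃ (J : Finset (D.A d)) (p : (J → R) →ₗ[R] Ib hR d), a0 ∈ J ∧ a1 ∈ J ∧
      (∀ f, (p f : AddMonoidAlgebra k G) = ∑ j : J, f j • XX k ((j : D.A d) : G)) ∧
      Function.Surjective p := by
  classical
  have h1 : (Submodule.span R (Set.range (moD hR d))).FG := by
    rw [span_moD]; exact Module.Finite.fg_top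
  rw [Submodule.fg_span_iff_fg_span_finset_subset] at h1
  obtain ⟨s', hs, hs'⟩ := h1
  rw [span_moD] at hs'
  choose c hc using fun x : s' => hs x.2
  let J : Finset (D.A d) := insert a0 (insert a1 (s'.attach.image c))
  refine ⟨J, Fintype.linearCombination R fun j : J => moD hR d j, by simp [J], by simp [J], ?_, ?_⟩
  · intro f
    rw [Fintype.linearCombination_apply, Submodule.coe_sum]
    rfl
  · rw [← LinearMap.range_eq_top, Fintype.range_linearCombination, eq_top_iff, hs', Submodule.span_le]
    intro x hx
    apply Submodule.subset_span
    exact ⟨⟨c ⟨x, hx⟩, by simp [J]⟩, hc ⟨x, hx⟩⟩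

theorem F2 [IsDomain (AddMonoidAlgebra k G)] {hR : RData k D R} {d d' : Λ → ℤ}
    [Module.Finite R (Ib hR d)]
    (h2 : M2 hR d d') (unk : G →+ H)
    {a0 a1 b0 b1 p0 p1 q0 q1 : G} (ha0 : a0 ∈ D.A d) (ha1 : a1 ∈ D.A d) (hb0 : b0 ∈ D.A d')
    (hb1 : b1 ∈ D.A d') (hp0 : p0 ∈ D.A 0) (hp1 : p1 ∈ D.A 0) (hq0 : q0 ∈ D.A 0) (hq1 : q1 ∈ D.A 0)
    (e1 : p1 + a0 = p0 + a1) (e2 : q1 + a0 = q0 + a1) (e3 : p1 + b1 = q1 + b0)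
    (e4 : p0 + b1 = q0 + b0)
    (hne : unk a1 ≠ unk a0) (hne' : unk b0 ≠ unk b1) (hm : MinW D unk d (unk a0))
    (hm' : MinW D unk d' (unk b1)) (h0 : unk p1 ≠ 0)
    (hirr : ∀ s ∈ D.A 0, ∀ a ∈ D.A 0, unk (s + a) = unk p1 → unk s = 0 ∨ unk a = 0) : False := by
  classical
  obtain ⟨J, p, hJ0, hJ1, hp, hps⟩ := exists_gens hR d ⟨a0, ha0⟩ ⟨a1, ha1⟩
  obtain ⟨r0, hr0, hz⟩ := h2 J p hp hps
  obtain ⟨P0, hP0⟩ := hR.surj _ (XX_mem.2 hp0)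
  obtain ⟨P1, hP1⟩ := hR.surj _ (XX_mem.2 hp1)
  obtain ⟨Q0, hQ0⟩ := hR.surj _ (XX_mem.2 hq0)
  obtain ⟨Q1, hQ1⟩ := hR.surj _ (XX_mem.2 hq1)
  let j0 : J := ⟨⟨a0, ha0⟩, hJ0⟩
  let j1 : J := ⟨⟨a1, ha1⟩, hJ1⟩
  have hj : j0 ≠ j1 := by
    intro h
    apply hne
    have := congrArg (fun j : J => unk ((j : D.A d) : G)) h
    exact this.symm
  let F0 : J → R := Pi.single j0 1
  let F1 : J → R := Pi.single j1 1
  let B0 : Ib hR d' := ⟨XX k b0, XX_mem.2 hb0⟩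
  let B1 : Ib hR d' := ⟨XX k b1, XX_mem.2 hb1⟩
  have hF : ∀ (r r' : R), (p (r • F0 - r' • F1) : AddMonoidAlgebra k G) =
      algebraMap R _ r * XX k a0 - algebraMap R _ r' * XX k a1 := by
    intro r r'
    rw [map_sub, map_smul, map_smul, Submodule.coe_sub, Submodule.coe_smul, Submodule.coe_smul, hp, hp]
    rw [Finset.sum_eq_single j0 (fun j _ hj' => by simp [F0, Pi.single_apply, hj']) (by simp),
      Finset.sum_eq_single j1 (fun j _ hj' => by simp [F1, Pi.single_apply, hj']) (by simp)]
    simp only [F0, F1, Pi.single_eq_same, Algebra.smul_def, map_one, one_mul, j0, j1]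
  have hK0 : P1 • F0 - P0 • F1 ∈ LinearMap.ker p := by
    rw [LinearMap.mem_ker]
    apply Subtype.ext
    rw [hF, hP1, hP0, XX_mul, XX_mul, e1, sub_self]; rfl
  have hK1 : Q1 • F0 - Q0 • F1 ∈ LinearMap.ker p := by
    rw [LinearMap.mem_ker]
    apply Subtype.ext
    rw [hF, hQ1, hQ0, XX_mul, XX_mul, e2, sub_self]; rfl
  have f3 : P1 • B1 = Q1 • B0 := by
    apply Subtype.ext
    change P1 • XX k b1 = Q1 • XX k b0
    rw [Algebra.smul_def, Algebra.smul_def, hP1, hQ1, XX_mul, XX_mul, e3]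
  have f4 : P0 • B1 = Q0 • B0 := by
    apply Subtype.ext
    change P0 • XX k b1 = Q0 • XX k b0
    rw [Algebra.smul_def, Algebra.smul_def, hP0, hQ0, XX_mul, XX_mul, e4]
  let K0 : LinearMap.ker p := ⟨_, hK0⟩
  let K1 : LinearMap.ker p := ⟨_, hK1⟩
  have h3 := hz (K0 ⊗ₜ B1 - K1 ⊗ₜ B0) (by
    rw [map_sub, LinearMap.rTensor_tmul, LinearMap.rTensor_tmul]
    change (P1 • F0 - P0 • F1) ⊗ₜ[R] B1 - (Q1 • F0 - Q0 • F1) ⊗ₜ[R] B0 = 0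
    rw [TensorProduct.sub_tmul, TensorProduct.sub_tmul, TensorProduct.smul_tmul,
      TensorProduct.smul_tmul, TensorProduct.smul_tmul, TensorProduct.smul_tmul, f3, f4, sub_self])
  let Ψ : LinearMap.ker p →+ AddMonoidAlgebra k G :=
    { toFun := fun x => ∑ j : J, wt unk (unk a0) (XX k ((j : D.A d) : G)) *
        wt unk (unk p1) (algebraMap R (AddMonoidAlgebra k G) ((x : J → R) j))
      map_zero' := by simp
      map_add' := fun x x' => by simp [mul_add, Finset.sum_add_distrib] }
  have hΨ : ∀ x, Ψ x = ∑ j : J, wt unk (unk a0) (XX k ((j : D.A d) : G)) *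
        wt unk (unk p1) (algebraMap R (AddMonoidAlgebra k G) ((x : J → R) j)) := fun _ => rfl
  have hΨl : ∀ (r : R) x, Ψ (r • x) = wt unk 0 (algebraMap R (AddMonoidAlgebra k G) r) * Ψ x := by
    intro r x
    have hx : ∑ j : J, wt unk (unk a0) (XX k ((j : D.A d) : G)) *
        wt unk 0 (algebraMap R (AddMonoidAlgebra k G) ((x : J → R) j)) = 0 := by
      have h5 : (p x : AddMonoidAlgebra k G) = 0 := by
        rw [LinearMap.mem_ker.1 x.2]; rfl
      rw [hp] at h5
      have h6 := congrArg (wt unk (unk a0)) h5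
      rw [map_sum, map_zero] at h6
      rw [← h6]
      refine Finset.sum_congr rfl fun j _ => ?_
      rw [wt_smul (hR := hR) hm _ _ (XX_mem.2 j.1.2), mul_comm]
    rw [hΨ, hΨ]
    have : ∀ j, algebraMap R (AddMonoidAlgebra k G) (((r • x : LinearMap.ker p) : J → R) j) =
        algebraMap R _ r * algebraMap R _ ((x : J → R) j) := fun j => by
      rw [Submodule.coe_smul, Pi.smul_apply, smul_eq_mul, map_mul]
    simp only [this]
    simp only [wt_mul_irr unk h0 hirr (hR.mem _) (hR.mem _), mul_add, Finset.sum_add_distrib]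
    have e5 : ∑ j : J, wt unk (unk a0) (XX k ((j : D.A d) : G)) *
      (wt unk (unk p1) (algebraMap R (AddMonoidAlgebra k G) r) *
        wt unk 0 (algebraMap R (AddMonoidAlgebra k G) ((x : J → R) j))) = 0 := by
      rw [← mul_zero (wt unk (unk p1) (algebraMap R (AddMonoidAlgebra k G) r)), ← hx, Finset.mul_sum]
      exact Finset.sum_congr rfl fun j _ => by ring
    rw [e5, add_zero, Finset.mul_sum]
    exact Finset.sum_congr rfl fun j _ => by ring
  obtain ⟨T, hT, hT'⟩ := exists_test (hR := hR) hm' Ψ hΨl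
  have h4 := congrArg T h3
  have hΨ0 : Ψ K0 = XX k (a0 + p1) := by
    rw [hΨ, Finset.sum_eq_single j0]
    · change wt unk (unk a0) (XX k a0) * wt unk (unk p1) (algebraMap R _ (P1 * F0 j0 - P0 * F1 j0)) = _
      simp only [F0, F1, Pi.single_eq_same, Pi.single_apply, if_neg hj, mul_zero, sub_zero, mul_one]
      rw [hP1, wt_XX, wt_XX, XX_mul]
    · intro j _ hj0
      by_cases hj1 : j = j1
      · subst hj1
        change wt unk (unk a0) (XX k a1) * _ = 0
        rw [wt_XX' unk hne, zero_mul]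
      · have : (K0 : J → R) j = 0 := by
          change P1 * F0 j - P0 * F1 j = 0
          simp [F0, F1, Pi.single_apply, hj0, hj1]
        rw [this, map_zero, map_zero, mul_zero]
    · simp
  rw [hT', map_sub, hT, hT, map_zero, hΨ0] at h4
  change _ * (_ * wt unk (unk b1) (XX k b1) - _ * wt unk (unk b1) (XX k b0)) = 0 at h4
  rw [wt_XX, wt_XX' unk hne', mul_zero, sub_zero, XX_mul] at h4
  rcases mul_eq_zero.1 h4 with h | h
  · exact wt_zero_ne unk hr0 h
  · exact XX_ne_zero _ h

end

end

section
open scoped TensorProduct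

section
variable {m n : ℕ} {G Λ : Type} [AddCommGroup G] [LinearOrder Λ] (L : LD m n G Λ)

namespace LD
/-- the weight used to separate two corners -/
noncomputable def unk (i j : Λ) : G →+ (ℕ → ℤ) × (ℕ → ℤ) × ℤ :=
  AddMonoidHom.mk' (fun g => (fun p => if 1 ≤ p ∧ p ≤ m ∧ p ≠ L.a j + 1 then L.s p g else 0,
    fun q => if 1 ≤ q ∧ q ≤ n ∧ q ≠ L.b i + 1 then L.t q g else 0, L.κ i g + L.s (L.a i + 1) g)) (by
    intro g h
    refine Prod.ext (funext fun p => ?_) (Prod.ext (funext fun q => ?_) ?_)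
    · simp only [map_add, Prod.mk_add_mk, Pi.add_apply]; split_ifs <;> simp
    · simp only [map_add, Prod.mk_add_mk, Pi.add_apply]; split_ifs <;> simp
    · simp only [map_add, Prod.mk_add_mk]; ring)

/-- vanishing of the other coordinates -/
def Oth (i j : Λ) (g : G) : Prop :=
  (∀ p, 1 ≤ p → p ≤ m → p ≠ L.a j + 1 → p ≠ L.a i + 1 → L.s p g = 0) ∧
  ∀ q, 1 ≤ q → q ≤ n → q ≠ L.b i + 1 → q ≠ L.b j + 1 → L.t q g = 0

variable {L} {i j : Λ}

theorem unk_fst {p : ℕ} (g : G) (h1 : 1 ≤ p) (h2 : p ≤ m) (h3 : p ≠ L.a j + 1) :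
    (L.unk i j g).1 p = L.s p g := if_pos ⟨h1, h2, h3⟩
theorem unk_snd {p : ℕ} (g : G) (h1 : 1 ≤ p) (h2 : p ≤ n) (h3 : p ≠ L.b i + 1) :
    (L.unk i j g).2.1 p = L.t p g := if_pos ⟨h1, h2, h3⟩
theorem unk_thd (g : G) : (L.unk i j g).2.2 = L.κ i g + L.s (L.a i + 1) g := rfl

theorem Oth.sum_s (hij : i < j) {g : G} (h : L.Oth i j g) {l : Λ} (h1 : i ≤ l) (h2 : l ≤ j) :
    ∑ p ∈ Finset.Ioc (L.a l) m, L.s p g = (if L.a j < m then L.s (L.a j + 1) g else 0) +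
      if l = i then L.s (L.a i + 1) g else 0 := by
  classical
  have hj := L.am j
  have hi := L.ha hij
  have hlj := L.ha.monotone h2
  have : ∀ p ∈ Finset.Ioc (L.a l) m, L.s p g = (if p = L.a j + 1 then L.s p g else 0) +
      if p = L.a i + 1 then L.s p g else 0 := by
    intro p hp
    rw [Finset.mem_Ioc] at hp
    split_ifs with h3 h4 h4
    · omega
    · simp
    · simp
    · simpa using h.1 p (by omega) hp.2 h3 h4
  rw [Finset.sum_congr rfl this, Finset.sum_add_distrib, Finset.sum_ite_eq', Finset.sum_ite_eq']
  congr 1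
  · simp only [Finset.mem_Ioc]
    congr 1
    apply propext; omega
  · congr 1
    simp only [Finset.mem_Ioc]
    apply propext
    constructor
    · intro h3
      exact le_antisymm (L.ha.le_iff_le.1 (by omega)) h1
    · rintro rfl; omega

theorem Oth.sum_t (hij : i < j) {g : G} (h : L.Oth i j g) {l : Λ} (h1 : i ≤ l) (h2 : l ≤ j) :
    ∑ p ∈ Finset.Ioc (L.b l) n, L.t p g = (if L.b i < n then L.t (L.b i + 1) g else 0) +
      if l = j then L.t (L.b j + 1) g else 0 := by
  classical
  have hj := L.bn i
  have hi := L.hb hij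
  have hlj := L.hb.antitone h1
  have : ∀ p ∈ Finset.Ioc (L.b l) n, L.t p g = (if p = L.b i + 1 then L.t p g else 0) +
      if p = L.b j + 1 then L.t p g else 0 := by
    intro p hp
    rw [Finset.mem_Ioc] at hp
    split_ifs with h3 h4 h4
    · omega
    · simp
    · simp
    · simpa using h.2 p (by omega) hp.2 h3 h4
  rw [Finset.sum_congr rfl this, Finset.sum_add_distrib, Finset.sum_ite_eq', Finset.sum_ite_eq']
  congr 1
  · simp only [Finset.mem_Ioc]
    congr 1
    apply propext; omega
  · congr 1
    simp only [Finset.mem_Ioc]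
    apply propext
    constructor
    · intro h3
      exact le_antisymm h2 (L.hb.le_iff_ge.1 (by omega))
    · rintro rfl; omega

theorem Oth.κ (hij : i < j) {g : G} (h : L.Oth i j g) {l : Λ} (h1 : i ≤ l) (h2 : l ≤ j) :
    (L.unk i j g).2.2 = L.κ l g + (if l = i then L.s (L.a i + 1) g else 0) +
      (if l = j then L.t (L.b j + 1) g else 0) := by
  rw [unk_thd, κ_deg, κ_deg, h.sum_s hij h1 h2, h.sum_t hij h1 h2, h.sum_s hij le_rfl hij.le,
    h.sum_t hij le_rfl hij.le, if_pos rfl, if_neg hij.ne]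
  ring

theorem Oth.of_unk {g h : G} (hij : i < j) (hg : g ∈ L.T) (hh : h ∈ L.T) {θ : G} (hθ : L.Oth i j θ)
    (e : L.unk i j (g + h) = L.unk i j θ) : L.Oth i j g ∧ L.Oth i j h := by
  have h1 : ∀ p, 1 ≤ p → p ≤ m → p ≠ L.a j + 1 → p ≠ L.a i + 1 → L.s p g = 0 ∧ L.s p h = 0 := by
    intro p hp hp' h3 h4
    have h5 : (L.unk i j (g + h)).1 p = (L.unk i j θ).1 p := by rw [e]
    rw [unk_fst _ hp hp' h3, unk_fst _ hp hp' h3, map_add, hθ.1 p hp hp' h3 h4] at h5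
    have := hg.1 p hp hp'
    have := hh.1 p hp hp'
    omega
  have h2 : ∀ p, 1 ≤ p → p ≤ n → p ≠ L.b i + 1 → p ≠ L.b j + 1 → L.t p g = 0 ∧ L.t p h = 0 := by
    intro p hp hp' h3 h4
    have h5 : (L.unk i j (g + h)).2.1 p = (L.unk i j θ).2.1 p := by rw [e]
    rw [unk_snd _ hp hp' h3, unk_snd _ hp hp' h3, map_add, hθ.2 p hp hp' h3 h4] at h5
    have := hg.2 p hp hp'
    have := hh.2 p hp hp'
    omega
  exact ⟨⟨fun p a b c d => (h1 p a b c d).1, fun p a b c d => (h2 p a b c d).1⟩,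
    ⟨fun p a b c d => (h1 p a b c d).2, fun p a b c d => (h2 p a b c d).2⟩⟩

theorem Oth.zero (hij : i < j) {g : G} (hg : g ∈ L.S) (h : L.Oth i j g)
    (he : (L.unk i j g).2.2 ≤ 0) : L.unk i j g = 0 := by
  have hj := L.am j
  have hi := L.bn i
  have hai := L.ha hij
  have hbi := L.hb hij
  have h1 := h.κ hij le_rfl hij.le
  have h2 := h.κ hij hij.le le_rfl
  rw [if_pos rfl, if_neg hij.ne] at h1
  rw [if_pos rfl, if_neg hij.ne'] at h2
  have h3 : 0 ≤ L.κ i g := hg.2 i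
  have h4 : 0 ≤ L.κ j g := hg.2 j
  have h5 := hg.1.1 (L.a i + 1) (by omega) (by omega)
  have h6 := hg.1.2 (L.b j + 1) (by omega) (by omega)
  refine Prod.ext (funext fun p => ?_) (Prod.ext (funext fun q => ?_) ?_)
  · change ite _ _ _ = (0 : ℤ)
    split_ifs with hp
    · by_cases hp' : p = L.a i + 1
      · subst hp'; omega
      · exact h.1 p hp.1 hp.2.1 hp.2.2 hp'
    · rfl
  · change ite _ _ _ = (0 : ℤ)
    split_ifs with hp
    · by_cases hp' : q = L.b j + 1
      · subst hp'; omega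
      · exact h.2 q hp.1 hp.2.1 hp.2.2 hp'
    · rfl
  · change (L.unk i j g).2.2 = 0
    omega

theorem Oth.minW (hij : i < j) {θ : G} (hθ : L.Oth i j θ) {d : Λ → ℤ} {l : Λ} (h1 : i ≤ l)
    (h2 : l ≤ j) (hd : d l = (L.unk i j θ).2.2) : MinW L.cd (L.unk i j) d (L.unk i j θ) := by
  intro s hs a ha e
  obtain ⟨h3, h4⟩ := Oth.of_unk hij hs.1 ha.1 hθ e
  refine h3.zero hij hs ?_
  have hj := L.am j
  have hi := L.bn i
  have hai := L.ha hij
  have hbi := L.hb hij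
  have h5 := h4.κ hij h1 h2
  have h6 : d l ≤ L.κ l a := ha.2 l
  have h7 := ha.1.1 (L.a i + 1) (by omega) (by omega)
  have h8 := ha.1.2 (L.b j + 1) (by omega) (by omega)
  have h9 := congrArg (fun z => z.2.2) e
  simp only [map_add, Prod.snd_add] at h9
  split_ifs at h5 <;> omega

theorem Oth.irr (hij : i < j) {θ : G} (hθ : L.Oth i j θ) (hd : (L.unk i j θ).2.2 = 1) :
    ∀ s ∈ L.cd.A 0, ∀ a ∈ L.cd.A 0, L.unk i j (s + a) = L.unk i j θ →
      L.unk i j s = 0 ∨ L.unk i j a = 0 := by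
  intro s hs a ha e
  obtain ⟨h3, h4⟩ := Oth.of_unk hij hs.1 ha.1 hθ e
  have h9 := congrArg (fun z => z.2.2) e
  simp only [map_add, Prod.snd_add] at h9
  by_cases h : (L.unk i j s).2.2 ≤ 0
  · exact Or.inl (h3.zero hij hs h)
  · exact Or.inr (h4.zero hij ha (by omega))

variable (L) in
/-- the test monomials -/
def W (i j : Λ) (N c α β : ℤ) : G := N • (L.u i + L.v j) + c • L.E 0 0 +
  α • (L.E (L.a i + 1) 0 - L.E 0 0) + β • (L.E 0 (L.b j + 1) - L.E 0 0)

theorem W_add (N c α β N' c' α' β' : ℤ) : L.W i j N c α β + L.W i j N' c' α' β' =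
    L.W i j (N + N') (c + c') (α + α') (β + β') := by
  simp only [W, add_smul]; abel

theorem s_W (hij : i < j) (N c α β : ℤ) {p : ℕ} (hp : 1 ≤ p) (hp' : p ≤ m) :
    L.s p (L.W i j N c α β) = N * (if p = L.a j + 1 then 1 else 0) +
      α * (if p = L.a i + 1 then 1 else 0) := by
  have hj := L.am j
  have hi := L.bn i
  have hai := L.ha hij
  have hbi := L.hb hij
  have h1 : L.s p (L.u i) = 0 := by
    rw [u]; split_ifs with h
    · rw [L.sE _ _ _ (Nat.zero_le _) h, if_neg (by omega)]
    · simp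
  have h2 : L.s p (L.v j) = if p = L.a j + 1 then 1 else 0 := by
    rw [v]; split_ifs with h h' h'
    · rw [L.sE _ _ _ h (Nat.zero_le _), if_pos h']
    · rw [L.sE _ _ _ h (Nat.zero_le _), if_neg h']
    · omega
    · simp
  rw [W]
  simp only [map_add, map_zsmul, map_sub, h1, h2, smul_eq_mul]
  rw [L.sE _ _ _ (Nat.zero_le _) (Nat.zero_le _), L.sE _ _ _ (by omega) (Nat.zero_le _),
    L.sE _ _ _ (Nat.zero_le _) (by omega), if_neg (by omega : ¬ p = 0)]
  ring

theorem t_W (hij : i < j) (N c α β : ℤ) {p : ℕ} (hp : 1 ≤ p) (hp' : p ≤ n) :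
    L.t p (L.W i j N c α β) = N * (if p = L.b i + 1 then 1 else 0) +
      β * (if p = L.b j + 1 then 1 else 0) := by
  have hj := L.am j
  have hi := L.bn i
  have hai := L.ha hij
  have hbi := L.hb hij
  have h1 : L.t p (L.v j) = 0 := by
    rw [v]; split_ifs with h
    · rw [L.tE _ _ _ h (Nat.zero_le _), if_neg (by omega)]
    · simp
  have h2 : L.t p (L.u i) = if p = L.b i + 1 then 1 else 0 := by
    rw [u]; split_ifs with h h' h'
    · rw [L.tE _ _ _ (Nat.zero_le _) h, if_pos h']
    · rw [L.tE _ _ _ (Nat.zero_le _) h, if_neg h']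
    · omega
    · simp
  rw [W]
  simp only [map_add, map_zsmul, map_sub, h1, h2, smul_eq_mul]
  rw [L.tE _ _ _ (Nat.zero_le _) (Nat.zero_le _), L.tE _ _ _ (by omega) (Nat.zero_le _),
    L.tE _ _ _ (Nat.zero_le _) (by omega), if_neg (by omega : ¬ p = 0)]
  ring

theorem κ_W (hij : i < j) (N c α β : ℤ) (l : Λ) :
    L.κ l (L.W i j N c α β) = N * ((if l < i then 1 else 0) + (if j < l then 1 else 0)) + c -
      α * (if l ≤ i then 1 else 0) - β * (if j ≤ l then 1 else 0) := by
  have hj := L.am j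
  have hi := L.bn i
  have hai := L.ha hij
  have hbi := L.hb hij
  rw [W]
  simp only [map_add, map_zsmul, map_sub, κu, κv, smul_eq_mul]
  rw [κE _ _ (Nat.zero_le _) (Nat.zero_le _), κE _ _ (by omega) (Nat.zero_le _),
    κE _ _ (Nat.zero_le _) (by omega)]
  have h1 : (L.a i + 1 ≤ L.a l) = (¬ l ≤ i) := by
    rw [← L.ha.le_iff_le]; apply propext; omega
  have h2 : (L.b l < L.b j + 1) = (j ≤ l) := by
    rw [← L.hb.le_iff_ge (a := l)]; apply propext; omega
  simp only [h1, h2, ite_not]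
  simp only [zero_le, if_true, not_lt_zero, if_false]
  split_ifs <;> ring

theorem W_oth (hij : i < j) (N c α β : ℤ) : L.Oth i j (L.W i j N c α β) := by
  refine ⟨fun p h1 h2 h3 h4 => ?_, fun p h1 h2 h3 h4 => ?_⟩
  · rw [s_W hij _ _ _ _ h1 h2, if_neg h3, if_neg h4]; simp
  · rw [t_W hij _ _ _ _ h1 h2, if_neg h3, if_neg h4]; simp

theorem W_thd (hij : i < j) (N c α β : ℤ) : (L.unk i j (L.W i j N c α β)).2.2 = c := by
  have hj := L.am j
  have hai := L.ha hij
  rw [unk_thd, κ_W hij, s_W hij _ _ _ _ (by omega) (by omega), if_neg (lt_irrefl _),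
    if_neg hij.not_gt, if_pos le_rfl, if_neg hij.not_ge, if_neg (by omega), if_pos rfl]
  ring

theorem W_fst (hij : i < j) (N c α β : ℤ) :
    (L.unk i j (L.W i j N c α β)).1 (L.a i + 1) = α := by
  have hj := L.am j
  have hai := L.ha hij
  rw [unk_fst _ (by omega) (by omega) (by omega), s_W hij _ _ _ _ (by omega) (by omega),
    if_neg (by omega), if_pos rfl]
  ring

theorem W_snd (hij : i < j) (N c α β : ℤ) :
    (L.unk i j (L.W i j N c α β)).2.1 (L.b j + 1) = β := by
  have hj := L.bn i
  have hai := L.hb hij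
  rw [unk_snd _ (by omega) (by omega) (by omega), t_W hij _ _ _ _ (by omega) (by omega),
    if_neg (by omega), if_pos rfl]
  ring

theorem W_mem [Finite Λ] (hij : i < j) (d : Λ → ℤ) (c : ℤ) (hd : ∀ l, i ≤ l → l ≤ j → d l ≤ c) :
    ∃ N : ℤ, ∀ α β : ℤ, 0 ≤ α → α ≤ 1 → 0 ≤ β → β ≤ 1 → d i ≤ c - α → d j ≤ c - β →
      L.W i j N c α β ∈ L.cd.A d := by
  obtain ⟨N, hN⟩ := (Set.finite_range fun l => d l - c + 2).bddAbove
  refine ⟨max N 0, fun α β h1 h2 h3 h4 h5 h6 => ⟨⟨fun p hp hp' => ?_, fun p hp hp' => ?_⟩, fun l => ?_⟩⟩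
  · rw [s_W hij _ _ _ _ hp hp']
    have := le_max_right N 0
    positivity
  · rw [t_W hij _ _ _ _ hp hp']
    have := le_max_right N 0
    positivity
  · change d l ≤ L.κ l _
    have h0 := le_max_right N 0
    have h7 : d l - c + 2 ≤ max N 0 := le_trans (hN ⟨l, rfl⟩) (le_max_left _ _)
    generalize max N 0 = N at *
    rw [κ_W hij]
    rcases lt_trichotomy l i with h | h | h
    · rw [if_pos h, if_neg (by order), if_pos h.le, if_neg (by order)]; linarith
    · subst h
      rw [if_neg (lt_irrefl _), if_neg (by order), if_pos le_rfl, if_neg (by order)]; linarith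
    · rcases lt_trichotomy l j with h' | h' | h'
      · rw [if_neg (by order), if_neg (by order), if_neg (by order), if_neg (by order)]
        have := hd l h.le h'.le
        linarith
      · subst h'
        rw [if_neg (by order), if_neg (by order), if_neg (by order), if_pos le_rfl]; linarith
      · rw [if_neg (by order), if_pos h', if_neg (by order), if_pos h'.le]; linarith

variable {k : Type} [Field k] {R : Type} [CommRing R] [Algebra R (AddMonoidAlgebra k G)]

theorem pair [Finite Λ] [IsDomain (AddMonoidAlgebra k G)] {hR : RData k L.cd R} {d d' : Λ → ℤ}
    [Module.Finite R (Ib hR d)] (h1 : M1 hR d d') (h2 : M2 hR d d') {i j : Λ} (hij : i < j) :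
    d i = d j ∨ d' i = d' j := by
  by_contra! hc
  obtain ⟨hc1, hc2⟩ := hc
  have key : ∀ d : Λ → ℤ, d i ≠ d j → ∃ c l, i ≤ l ∧ l ≤ j ∧ d l = c ∧
      (∀ l, i ≤ l → l ≤ j → d l ≤ c) ∧ (d i ≤ c - 1 ∨ d j ≤ c - 1) := by
    intro d hd
    obtain ⟨l, hl, hl'⟩ := (Set.toFinite (Set.Icc i j)).exists_maximalFor d _ ⟨i, le_rfl, hij.le⟩
    have h3 : ∀ l', i ≤ l' → l' ≤ j → d l' ≤ d l := fun l' h h' => by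
      by_contra! hc
      exact absurd (hl' ⟨h, h'⟩ hc.le) (not_le.2 hc)
    refine ⟨d l, l, hl.1, hl.2, rfl, h3, ?_⟩
    have := h3 i le_rfl hij.le
    have := h3 j hij.le le_rfl
    omega
  obtain ⟨c, l, hl1, hl2, hl3, hc, hA⟩ := key d hc1
  obtain ⟨c', l', hl1', hl2', hl3', hc', hA'⟩ := key d' hc2
  obtain ⟨N, hN⟩ := W_mem (L := L) hij d c hc
  obtain ⟨N', hN'⟩ := W_mem (L := L) hij d' c' hc'
  obtain ⟨N0, hN0⟩ := W_mem (L := L) hij 0 1 (fun _ _ _ => by simp)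
  have ci := hc i le_rfl hij.le
  have cj := hc j hij.le le_rfl
  have ci' := hc' i le_rfl hij.le
  have cj' := hc' j hij.le le_rfl
  have hmin : ∀ α β, MinW L.cd (L.unk i j) d (L.unk i j (L.W i j N c α β)) := fun α β =>
    (W_oth hij _ _ _ _).minW hij hl1 hl2 (by rw [W_thd hij, hl3])
  have hmin' : ∀ α β, MinW L.cd (L.unk i j) d' (L.unk i j (L.W i j N' c' α β)) := fun α β =>
    (W_oth hij _ _ _ _).minW hij hl1' hl2' (by rw [W_thd hij, hl3'])
  have ne1 : ∀ N c N' c', L.unk i j (L.W i j N c 1 0) ≠ L.unk i j (L.W i j N' c' 0 0) := by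
    intro N c N' c' h
    have := congrArg (fun z => z.1 (L.a i + 1)) h
    simp only [W_fst hij] at this
    omega
  have ne2 : ∀ N c N' c', L.unk i j (L.W i j N c 0 1) ≠ L.unk i j (L.W i j N' c' 0 0) := by
    intro N c N' c' h
    have := congrArg (fun z => z.2.1 (L.b j + 1)) h
    simp only [W_snd hij] at this
    omega
  have irr : ∀ α β, ∀ s ∈ L.cd.A 0, ∀ a ∈ L.cd.A 0,
      L.unk i j (s + a) = L.unk i j (L.W i j N0 1 α β) →
      L.unk i j s = 0 ∨ L.unk i j a = 0 := fun α β =>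
    Oth.irr hij (W_oth hij _ _ _ _) (W_thd hij _ _ _ _)
  have ne0 : ∀ α β, L.unk i j (L.W i j N0 1 α β) ≠ 0 := by
    intro α β h
    have := congrArg (fun z => z.2.2) h
    simp [W_thd hij] at this
  have hX : ∀ α β : ℤ, 0 ≤ α → α ≤ 1 → 0 ≤ β → β ≤ 1 → L.W i j N0 1 α β ∈ L.cd.A 0 :=
    fun α β x1 x2 x3 x4 => hN0 α β x1 x2 x3 x4 (by simpa using x2) (by simpa using x4)
  have a00 := hN 0 0 (by omega) (by omega) (by omega) (by omega) (by omega) (by omega)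
  have b00 := hN' 0 0 (by omega) (by omega) (by omega) (by omega) (by omega) (by omega)
  have x00 := hX 0 0 (by omega) (by omega) (by omega) (by omega)
  have x01 := hX 0 1 (by omega) (by omega) (by omega) (by omega)
  have x10 := hX 1 0 (by omega) (by omega) (by omega) (by omega)
  have x11 := hX 1 1 (by omega) (by omega) (by omega) (by omega)
  rcases hA with hA | hA <;> rcases hA' with hA' | hA'
  · have a1 := hN 1 0 (by omega) (by omega) (by omega) (by omega) (by omega) (by omega)
    have b1 := hN' 1 0 (by omega) (by omega) (by omega) (by omega) (by omega) (by omega)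
    exact F1 h1 (L.unk i j) a00 a1 b00 b1 (by rw [W_add, W_add]; rfl) (ne1 _ _ _ _) (hmin _ _) (hmin' _ _)
  · have a1 := hN 1 0 (by omega) (by omega) (by omega) (by omega) (by omega) (by omega)
    have b1 := hN' 0 1 (by omega) (by omega) (by omega) (by omega) (by omega) (by omega)
    exact F2 h2 (L.unk i j) a00 a1 b00 b1 x00 x10 x01 x11 (by rw [W_add, W_add]; rfl)
      (by rw [W_add, W_add]; rfl) (by rw [W_add, W_add]; rfl) (by rw [W_add, W_add]; rfl)
      (ne1 _ _ _ _) (ne2 _ _ _ _).symm (hmin _ _) (hmin' _ _) (ne0 _ _) (irr _ _)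
  · have a1 := hN 0 1 (by omega) (by omega) (by omega) (by omega) (by omega) (by omega)
    have b1 := hN' 1 0 (by omega) (by omega) (by omega) (by omega) (by omega) (by omega)
    exact F2 h2 (L.unk i j) a00 a1 b00 b1 x00 x01 x10 x11 (by rw [W_add, W_add]; rfl)
      (by rw [W_add, W_add]; rfl) (by rw [W_add, W_add]; rfl) (by rw [W_add, W_add]; rfl)
      (ne2 _ _ _ _) (ne1 _ _ _ _).symm (hmin _ _) (hmin' _ _) (ne0 _ _) (irr _ _)
  · have a1 := hN 0 1 (by omega) (by omega) (by omega) (by omega) (by omega) (by omega)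
    have b1 := hN' 0 1 (by omega) (by omega) (by omega) (by omega) (by omega) (by omega)
    exact F1 h1 (L.unk i j) a00 a1 b00 b1 (by rw [W_add, W_add]; rfl) (ne2 _ _ _ _) (hmin _ _) (hmin' _ _)

theorem const [Finite Λ] [IsDomain (AddMonoidAlgebra k G)] {hR : RData k L.cd R} {d d' : Λ → ℤ}
    [Module.Finite R (Ib hR d)] (h1 : M1 hR d d') (h2 : M2 hR d d') :
    (∃ c, ∀ l, d l = c) ∨ ∃ c, ∀ l, d' l = c := by
  have h : ∀ i j, d i = d j ∨ d' i = d' j := by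
    intro i j
    rcases lt_trichotomy i j with h | h | h
    · exact pair h1 h2 h
    · subst h; exact Or.inl rfl
    · exact (pair h1 h2 h).imp Eq.symm Eq.symm
  by_contra! hc
  obtain ⟨l, hl⟩ := hc.1 (d L.bot)
  obtain ⟨l', hl'⟩ := hc.2 (d' L.bot)
  have e1 := h l L.bot
  have e2 := h l' L.bot
  have e3 := h l l'
  grind

end LD
end

end

section
open scoped TensorProduct

section
variable {P R C N : Type} [CommRing P] [CommRing R] [Algebra P R]
  [AddCommGroup C] [Module R C] [Module P C] [IsScalarTower P R C]
  [AddCommGroup N] [Module R N] [Module P N] [IsScalarTower P R N]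

theorem exists_mu {β : C →ₗ[P] N →ₗ[P] P} (hβ : Perfect β R) :
    ∃ μ : C ⊗[R] N →ₗ[R] DualM P R R, ∀ c n, DualM.ev P R R (μ (c ⊗ₜ n)) 1 = β c n := by
  let f : C → N → DualM P R R := fun c n =>
    (β.flip n ∘ₗ (LinearMap.toSpanSingleton R C c).restrictScalars P : R →ₗ[P] P)
  have hf : ∀ c n r, DualM.ev P R R (f c n) r = β (r • c) n := fun _ _ _ => rfl
  let g : C →ₗ[R] N →ₗ[R] DualM P R R := LinearMap.mk₂ R f
    (fun c c' n => DualM.ext fun r => by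
      rw [map_add, LinearMap.add_apply, hf, hf, hf, smul_add, map_add, LinearMap.add_apply])
    (fun s c n => DualM.ext fun r => by
      rw [DualM.ev_smul, hf, hf, smul_smul, smul_eq_mul, mul_comm])
    (fun c n n' => DualM.ext fun r => by
      rw [map_add, LinearMap.add_apply, hf, hf, hf, map_add])
    (fun s c n => DualM.ext fun r => by
      rw [DualM.ev_smul, hf, hf, ← hβ.bal, smul_smul, smul_eq_mul])
  refine ⟨TensorProduct.lift g, fun c n => ?_⟩
  rw [TensorProduct.lift.tmul]
  change DualM.ev P R R (f c n) 1 = _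
  rw [hf, one_smul]

theorem proj_pi_tensor [Module.Free P N] (J : Type) [Fintype J] :
    Module.Projective P ((J → R) ⊗[R] N) := by
  classical
  let e : (J → R) ⊗[R] N ≃ₗ[R] (J → N) :=
    (TensorProduct.comm R (J → R) N).trans (TensorProduct.piScalarRight R R N J)
  exact Module.Projective.of_equiv (e.restrictScalars P).symm

end

section
variable {k : Type} [Field k] {m n : ℕ} {G Λ : Type} [AddCommGroup G] [LinearOrder Λ] {L : LD m n G Λ}
  {R : Type} [CommRing R] [Algebra k R] [Algebra R (AddMonoidAlgebra k G)]
  [IsScalarTower k R (AddMonoidAlgebra k G)]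

theorem Ib_const (hR : RData k L.cd R) {d : Λ → ℤ} {c : ℤ} (hd : ∀ l, d l = c) :
    Nonempty (R ≃ₗ[R] Ib hR d) := by
  have hT : ∀ z : ℤ, z • L.E 0 0 ∈ L.T := by
    intro z
    rcases Int.eq_nat_or_neg z with ⟨w, rfl | rfl⟩
    · rw [natCast_zsmul]; exact L.T.nsmul_mem L.cd.hx w
    · rw [neg_smul, natCast_zsmul, ← smul_neg]; exact L.T.nsmul_mem L.cd.hnx w
  have hκ : ∀ l (z : ℤ), L.κ l (z • L.E 0 0) = z := fun l z => by
    have := L.cd.κx l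
    change L.κ l (L.E 0 0) = 1 at this
    rw [map_zsmul, this]; simp
  let f : R →ₗ[R] Ib hR d := (LinearMap.toSpanSingleton R _ (XX k (c • L.E 0 0))).codRestrict _ (by
    intro r
    rw [LinearMap.toSpanSingleton_apply, Algebra.smul_def, mul_comm]
    refine XX_mul_mem (hR.mem r) fun a ha => ⟨L.T.add_mem (hT _) ha.1, fun l => ?_⟩
    change d l ≤ L.κ l _
    have : 0 ≤ L.κ l a := ha.2 l
    rw [map_add, hκ, hd]; omega)
  have hf : ∀ r, (f r : AddMonoidAlgebra k G) = XX k (c • L.E 0 0) * algebraMap R _ r := by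
    intro r
    change r • XX k (c • L.E 0 0) = _
    rw [Algebra.smul_def, mul_comm]
  refine ⟨LinearEquiv.ofBijective f ⟨fun r r' h => ?_, fun z => ?_⟩⟩
  · have h1 := congrArg Subtype.val h
    rw [hf, hf] at h1
    apply hR.inj
    rw [← XX_cancel (c • L.E 0 0) (algebraMap R _ r), h1, XX_cancel]
  · obtain ⟨r, hr⟩ := hR.surj (XX k (-(c • L.E 0 0)) * z) (by
      refine XX_mul_mem (mem_Ib.1 z.2) fun a ha => ⟨L.T.add_mem ?_ ha.1, fun l => ?_⟩
      · rw [← neg_smul]; exact hT _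
      · change 0 ≤ L.κ l _
        have : d l ≤ L.κ l a := ha.2 l
        rw [map_add, map_neg, hκ]
        rw [hd] at this; omega)
    exact ⟨r, Subtype.ext (by rw [hf, hr, XX_cancel'])⟩

variable {c : ℕ} {y : ℕ → R}
  [Algebra (MvPolynomial (Fin c) k) R] [Algebra (MvPolynomial (Fin c) k) (AddMonoidAlgebra k G)]
  [IsScalarTower (MvPolynomial (Fin c) k) R (AddMonoidAlgebra k G)]

theorem coeff_P (hR : RData k L.cd R) (hy : IsY k L y)
    (hP : ∀ p : MvPolynomial (Fin c) k, algebraMap _ R p = MvPolynomial.aeval (fun j : Fin c => y j) p)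
    (p : MvPolynomial (Fin c) k) :
    (algebraMap R (AddMonoidAlgebra k G) (algebraMap _ R p)).coeff 0 = MvPolynomial.constantCoeff p := by
  classical
  have key : algebraMap R (AddMonoidAlgebra k G) (algebraMap _ R p) -
      MvPolynomial.constantCoeff p • XX k (0 : G) ∈ mon k {g : G | 1 ≤ L.deg g} := by
    induction p using MvPolynomial.induction_on with
    | C a =>
      rw [hP, MvPolynomial.aeval_C, ← IsScalarTower.algebraMap_apply, MvPolynomial.constantCoeff_C,
        XX_zero, ← Algebra.algebraMap_eq_smul_one, sub_self]
      exact zero_mem _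
    | add p q hp hq =>
      rw [map_add, map_add, map_add, add_smul, add_sub_add_comm]
      exact add_mem hp hq
    | mul_X p i hp =>
      rw [map_mul, map_mul, map_mul, MvPolynomial.constantCoeff_X, mul_zero, zero_smul, sub_zero,
        hP (MvPolynomial.X i), MvPolynomial.aeval_X, hy]
      refine mon_mul (A' := {g | 1 ≤ L.deg g}) (hR.mem _) (sum_mem fun x hx => XX_mem.2 ?_) ?_
      · have := (LD.mem_diag.1 hx).1
        change 1 ≤ L.deg _
        rw [L.degE this.1 this.2.1]
      · intro a ha a' ha'
        have := L.deg_nonneg ha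
        change 1 ≤ L.deg a' at ha'
        change 1 ≤ L.deg (a + a')
        rw [map_add]; omega
  have h0 : (algebraMap R (AddMonoidAlgebra k G) (algebraMap _ R p) -
      MvPolynomial.constantCoeff p • XX k (0 : G)).coeff 0 = 0 := by
    by_contra h
    have := key 0 h
    simp at this
  rw [AddMonoidAlgebra.coeff_sub, AddMonoidAlgebra.coeff_smul, Finsupp.sub_apply, Finsupp.smul_apply,
    coeff_XX] at h0
  simp at h0
  exact sub_eq_zero.1 h0

theorem mem_m_smul {C : Type} [AddCommGroup C] [Module R C] [Module (MvPolynomial (Fin c) k) C]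
    [IsScalarTower (MvPolynomial (Fin c) k) R C]
    (hP : ∀ p : MvPolynomial (Fin c) k, algebraMap _ R p = MvPolynomial.aeval (fun j : Fin c => y j) p)
    (x : C) : x ∈ Ideal.span (y '' Set.Iio c) • (⊤ : Submodule R C) ↔
      x ∈ (RingHom.ker (MvPolynomial.constantCoeff (σ := Fin c) (R := k))) •
        (⊤ : Submodule (MvPolynomial (Fin c) k) C) := by
  constructor
  · intro hx
    obtain ⟨f, rfl⟩ := mem_span_smul_top hx
    refine sum_mem fun j _ => ?_
    have : y j • f j = (MvPolynomial.X j : MvPolynomial (Fin c) k) • f j := by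
      rw [← algebraMap_smul R (MvPolynomial.X j : MvPolynomial (Fin c) k), hP, MvPolynomial.aeval_X]
    rw [this]
    exact Submodule.smul_mem_smul (by simp [RingHom.mem_ker]) trivial
  · intro hx
    have key : ∀ p : MvPolynomial (Fin c) k, algebraMap _ R p -
        algebraMap k R (MvPolynomial.constantCoeff p) ∈ Ideal.span (y '' Set.Iio c) := by
      intro p
      induction p using MvPolynomial.induction_on with
      | C a =>
        rw [hP, MvPolynomial.aeval_C, MvPolynomial.constantCoeff_C, sub_self]
        exact zero_mem _
      | add p q hp hq =>
        rw [map_add, map_add, map_add, add_sub_add_comm]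
        exact add_mem hp hq
      | mul_X p i hp =>
        rw [map_mul, map_mul, MvPolynomial.constantCoeff_X, mul_zero, map_zero, sub_zero,
          hP (MvPolynomial.X i), MvPolynomial.aeval_X]
        exact Ideal.mul_mem_left _ _ (Ideal.subset_span ⟨i, i.2, rfl⟩)
    refine Submodule.smul_induction_on hx (fun p hp z _ => ?_) fun _ _ => add_mem
    rw [← algebraMap_smul R p]
    refine Submodule.smul_mem_smul ?_ trivial
    have := key p
    rwa [RingHom.mem_ker.1 hp, map_zero, sub_zero] at this

end

end

section
open scoped TensorProduct

section
variable {k : Type} [Field k] {m n : ℕ} {G Λ : Type} [AddCommGroup G] [LinearOrder Λ] {L : LD m n G Λ}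
  {R : Type} [CommRing R] [Algebra k R] [Algebra R (AddMonoidAlgebra k G)]
  [IsScalarTower k R (AddMonoidAlgebra k G)] {y : ℕ → R}
  [Algebra (MvPolynomial (Fin (m + n + 1)) k) R]
  [Algebra (MvPolynomial (Fin (m + n + 1)) k) (AddMonoidAlgebra k G)]
  [IsScalarTower (MvPolynomial (Fin (m + n + 1)) k) R (AddMonoidAlgebra k G)]

theorem R_free (hR : RData k L.cd R) (hy : IsY k L y)
    (hP : ∀ p : MvPolynomial (Fin (m + n + 1)) k, algebraMap _ R p = MvPolynomial.aeval (fun j : Fin (m + n + 1) => y j) p) :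
    Module.Free (MvPolynomial (Fin (m + n + 1)) k) R ∧ Module.Finite (MvPolynomial (Fin (m + n + 1)) k) R := by
  obtain ⟨e⟩ := Ib_const hR (d := 0) (c := 0) fun _ => rfl
  have hW : WReg k (m + n + 1) y (⊤ : Submodule R (Ib hR 0)) ⊥ :=
    WReg.transfer (U := (⊤ : Submodule R R)) (V := ⊥) e.toLinearMap _ y (fun _ _ => trivial) (fun v hv => by
      rw [Submodule.mem_bot] at *; rw [hv, map_zero])
      (fun u' _ => ⟨e.symm u', Submodule.mem_top, by simp⟩) (fun u _ hu => by simpa using hu) (LD.wreg hR hy)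
  obtain ⟨h1, h2⟩ := Ib_free hR hy hP 0 hW
  let e' := e.restrictScalars (MvPolynomial (Fin (m + n + 1)) k)
  exact ⟨Module.Free.of_equiv e'.symm, Module.Finite.equiv e'.symm⟩

theorem SD.classify [Finite Λ] [IsDomain (AddMonoidAlgebra k G)] [IsNoetherianRing R]
    (hR : RData k L.cd R) (hy : IsY k L y)
    (hP : ∀ p : MvPolynomial (Fin (m + n + 1)) k, algebraMap _ R p = MvPolynomial.aeval (fun j : Fin (m + n + 1) => y j) p)
    {C : Type} [AddCommGroup C] [Module R C] (h : SD R C) :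
    Nonempty (C ≃ₗ[R] R) ∨ Nonempty (C ≃ₗ[R] DualM (MvPolynomial (Fin (m + n + 1)) k) R R) := by
  classical
  haveI : IsDomain R := hR.inj.isDomain (algebraMap R (AddMonoidAlgebra k G))
  obtain ⟨hfr, hfi⟩ := R_free hR hy hP
  haveI : Algebra.IsIntegral (MvPolynomial (Fin (m + n + 1)) k) R := Algebra.IsIntegral.of_finite _ _
  haveI : FaithfulSMul (MvPolynomial (Fin (m + n + 1)) k) R := inferInstance
  haveI := h.fin
  haveI := h.nontrivial
  obtain ⟨θ, hθ⟩ := h.embed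
  obtain ⟨d, ⟨e⟩⟩ := S2.exists_iso hR L.udata θ hθ h.s2
  have hd : SD R (Ib hR d) := h.congr e
  haveI := hd.fin
  haveI := hd.nontrivial
  obtain ⟨Q, hQ⟩ := Good.of_sd hd
  obtain ⟨hW, M, _, _, π, hπ⟩ := WReg.good (k := k) hd.faithful (m + n + 1) y ⊥ _ _ hQ (LD.wreg hR hy)
  rw [Submodule.bot_smul] at hW
  rw [bot_sup_eq] at hπ
  obtain ⟨hIfr, hIfi⟩ := Ib_free hR hy hP d hW
  obtain ⟨θ', hθ'⟩ := hd.embed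
  obtain ⟨hnt, η, hη⟩ := DualM.embed (P := MvPolynomial (Fin (m + n + 1)) k) θ' hθ'
  haveI : Module.Finite R (DualM (MvPolynomial (Fin (m + n + 1)) k) R (Ib hR d)) :=
    Module.Finite.of_restrictScalars_finite (MvPolynomial (Fin (m + n + 1)) k) _ _
  obtain ⟨d', ⟨e'⟩⟩ := S2.exists_iso hR L.udata η hη DualM.s2
  haveI : Module.Finite R (Ib hR d') := Module.Finite.equiv e'
  haveI : Module.Free (MvPolynomial (Fin (m + n + 1)) k) (Ib hR d') :=
    Module.Free.of_equiv (e'.restrictScalars (MvPolynomial (Fin (m + n + 1)) k))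
  obtain ⟨β, hβ, -⟩ := DualM.perfect e'.symm
  let 𝔪 : Ideal (MvPolynomial (Fin (m + n + 1)) k) :=
    RingHom.ker (MvPolynomial.constantCoeff (σ := Fin (m + n + 1)) (R := k))
  haveI : 𝔪.IsMaximal := RingHom.ker_isMaximal_of_surjective _ fun a => ⟨MvPolynomial.C a, by simp⟩
  have hπ' : ∀ c, π c = 0 ↔ c ∈ 𝔪 • (⊤ : Submodule (MvPolynomial (Fin (m + n + 1)) k) (Ib hR d)) := by
    intro c
    rw [← mem_m_smul hP, ← hπ.ker, LinearMap.mem_ker]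
  have hc : ∀ g : MvPolynomial (Fin (m + n + 1)) k, g ∉ 𝔪 →
      (algebraMap R (AddMonoidAlgebra k G) (algebraMap _ R g)).coeff 0 ≠ 0 := by
    intro g hg h0
    rw [coeff_P hR hy hP] at h0
    exact hg (RingHom.mem_ker.2 h0)
  haveI : Module.Finite (MvPolynomial (Fin (m + n + 1)) k) (Ib hR d ⊗[R] Ib hR d') :=
    Module.Finite.trans R _
  have hM1 : M1 hR d d' := by
    obtain ⟨μ, hμ⟩ := exists_mu hβ
    obtain ⟨g, hg, hz⟩ := factor_one hβ hπ' hπ.hom μ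
      ((LinearMap.flip (DualM.ev (MvPolynomial (Fin (m + n + 1)) k) R R)) 1) hμ
    refine ⟨algebraMap _ R g, hc g hg, ?_⟩
    rintro z ⟨r, hr, hrz⟩
    rw [algebraMap_smul]
    refine hz z (DualM.torsionFree hr ?_)
    rw [← LinearMap.map_smul μ, hrz, map_zero]
  have hM2 : M2 hR d d' := by
    intro J p _ hps
    haveI : Module.Projective (MvPolynomial (Fin (m + n + 1)) k) ((J → R) ⊗[R] Ib hR d') :=
      proj_pi_tensor J
    haveI : Module.Finite (MvPolynomial (Fin (m + n + 1)) k) (LinearMap.ker p ⊗[R] Ib hR d') :=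
      Module.Finite.trans R _
    obtain ⟨g, hg, hz⟩ := factor_two hβ hπ.surj hπ' (LinearMap.ker p)
      (fun φ => ExtVan.extend hπ.ext p hps φ)
    refine ⟨algebraMap _ R g, hc g hg, fun z h0 => ?_⟩
    rw [algebraMap_smul]
    exact hz z h0
  rcases LD.const hM1 hM2 with ⟨c, hcd⟩ | ⟨c, hcd⟩
  · obtain ⟨e1⟩ := Ib_const hR hcd
    exact Or.inl ⟨e.trans e1.symm⟩
  · obtain ⟨e1⟩ := Ib_const hR hcd
    obtain ⟨e2⟩ := DualM.bidual (P := MvPolynomial (Fin (m + n + 1)) k) (R := R) (C := Ib hR d)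
    exact Or.inr ⟨(e.trans e2).trans (DualM.congr (e'.trans e1.symm))⟩

end

section
variable {k : Type} [Field k] {m n : ℕ} {G Λ : Type} [AddCommGroup G] [LinearOrder Λ] {L : LD m n G Λ}
  {R : Type} [CommRing R] [Algebra k R] [Algebra R (AddMonoidAlgebra k G)]
  [IsScalarTower k R (AddMonoidAlgebra k G)]

theorem RData.main [Finite Λ] [IsDomain (AddMonoidAlgebra k G)] [IsNoetherianRing R]
    (hR : RData k L.cd R) (C : Fin 3 → ModuleCat.{0} R) (hC : ∀ i, IsSemidualizing (C i)) :
    ∃ i j, i ≠ j ∧ Nonempty (C i ≅ C j) := by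
  obtain ⟨y, hy⟩ := LD.exists_y hR
  let f : MvPolynomial (Fin (m + n + 1)) k →ₐ[k] R := MvPolynomial.aeval (fun j : Fin (m + n + 1) => y j)
  letI i1 : Algebra (MvPolynomial (Fin (m + n + 1)) k) R := f.toRingHom.toAlgebra
  letI i2 : Algebra (MvPolynomial (Fin (m + n + 1)) k) (AddMonoidAlgebra k G) :=
    ((algebraMap R (AddMonoidAlgebra k G)).comp f.toRingHom).toAlgebra
  haveI i3 : IsScalarTower (MvPolynomial (Fin (m + n + 1)) k) R (AddMonoidAlgebra k G) :=
    IsScalarTower.of_algebraMap_eq fun _ => rfl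
  have key := fun i => SD.classify (L := L) hR hy (fun _ => rfl) (hC i).sd
  have fin : ∀ i j, i ≠ j → (C i ≃ₗ[R] C j) → ∃ i j, i ≠ j ∧ Nonempty (C i ≅ C j) :=
    fun i j hij e => ⟨i, j, hij, ⟨e.toModuleIso⟩⟩
  have pig : ∀ p : Fin 3 → Prop, ∃ i j, i ≠ j ∧ (p i ↔ p j) := by
    intro p
    by_cases h0 : p 0 <;> by_cases h1 : p 1 <;> by_cases h2 : p 2
    all_goals first
      | exact ⟨0, 1, by decide, by tauto⟩
      | exact ⟨0, 2, by decide, by tauto⟩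
      | exact ⟨1, 2, by decide, by tauto⟩
  obtain ⟨i, j, hij, h⟩ := pig fun i => Nonempty (C i ≃ₗ[R] R)
  by_cases hi : Nonempty (C i ≃ₗ[R] R)
  · obtain ⟨e⟩ := hi
    obtain ⟨e'⟩ := h.1 ⟨e⟩
    exact fin i j hij (e.trans e'.symm)
  · obtain ⟨e⟩ := (key i).resolve_left hi
    obtain ⟨e'⟩ := (key j).resolve_left fun hj => hi (h.2 hj)
    exact fin i j hij (e.trans e'.symm)

end

end


section
variable {k : Type} [Field k] {m n : ℕ} {G Λ : Type} [AddCommGroup G] [LinearOrder Λ] (L : LD m n G Λ)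

namespace LD

/-- exponent of a product of variables -/
def esum (l : Multiset (ℕ × ℕ)) : G := (l.map fun a => L.E a.1 a.2).sum

/-- all the positions lie in the ladder -/
def InY (l : Multiset (ℕ × ℕ)) : Prop := ∀ a ∈ l, L.Y a.1 a.2

variable {L}

theorem esum_cons (a : ℕ × ℕ) (l : Multiset (ℕ × ℕ)) : L.esum (a ::ₘ l) = L.E a.1 a.2 + L.esum l := by
  simp [esum]

theorem InY.cons {a : ℕ × ℕ} {l : Multiset (ℕ × ℕ)} : L.InY (a ::ₘ l) ↔ L.Y a.1 a.2 ∧ L.InY l := by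
  simp [InY]

theorem InY.mem {l : Multiset (ℕ × ℕ)} (h : L.InY l) : L.esum l ∈ L.S := by
  induction l using Multiset.induction with
  | empty =>
    rw [mem_S]; simp [esum]
  | cons a l ih =>
    rw [InY.cons] at h
    have h1 := L.E_mem_S h.1
    have h2 := ih h.2
    rw [esum_cons]
    rw [mem_S] at *
    refine ⟨fun i hi => ?_, fun j hj => ?_, fun c => ?_⟩
    · rw [map_add]; exact add_nonneg (h1.1 i hi) (h2.1 i hi)
    · rw [map_add]; exact add_nonneg (h1.2.1 j hj) (h2.2.1 j hj)
    · rw [map_add]; exact add_nonneg (h1.2.2 c) (h2.2.2 c)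

theorem InY.deg {l : Multiset (ℕ × ℕ)} (h : L.InY l) : L.deg (L.esum l) = l.card := by
  induction l using Multiset.induction with
  | empty => simp [esum]
  | cons a l ih =>
    rw [InY.cons] at h
    rw [esum_cons, map_add, ih h.2, L.degE h.1.1 h.1.2.1, Multiset.card_cons]
    push_cast; ring

theorem InY.exists_s {l : Multiset (ℕ × ℕ)} (h : L.InY l) {p : ℕ} (hp : 0 < L.s p (L.esum l)) :
    ∃ j, (p, j) ∈ l := by
  induction l using Multiset.induction with
  | empty => simp [esum] at hp
  | cons a l ih =>
    rw [InY.cons] at h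
    rw [esum_cons, map_add, L.sE _ _ _ h.1.1 h.1.2.1] at hp
    split_ifs at hp with hc
    · exact ⟨a.2, by subst hc; exact Multiset.mem_cons_self _ _⟩
    · obtain ⟨j, hj⟩ := ih h.2 (by simpa using hp)
      exact ⟨j, Multiset.mem_cons_of_mem hj⟩

theorem InY.exists_t {l : Multiset (ℕ × ℕ)} (h : L.InY l) {q : ℕ} (hq : 0 < L.t q (L.esum l)) :
    ∃ i, (i, q) ∈ l := by
  induction l using Multiset.induction with
  | empty => simp [esum] at hq
  | cons a l ih =>
    rw [InY.cons] at h
    rw [esum_cons, map_add, L.tE _ _ _ h.1.1 h.1.2.1] at hq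
    split_ifs at hq with hc
    · exact ⟨a.1, by subst hc; exact Multiset.mem_cons_self _ _⟩
    · obtain ⟨j, hj⟩ := ih h.2 (by simpa using hq)
      exact ⟨j, Multiset.mem_cons_of_mem hj⟩

theorem InY.s_pos {l : Multiset (ℕ × ℕ)} (h : L.InY l) {a : ℕ × ℕ} (ha : a ∈ l) :
    0 < L.s a.1 (L.esum l) ∧ 0 < L.t a.2 (L.esum l) := by
  obtain ⟨l, rfl⟩ := Multiset.exists_cons_of_mem ha
  rw [InY.cons] at h
  have h2 := L.mem_S.1 h.2.mem
  rw [esum_cons, map_add, map_add, L.sE _ _ _ h.1.1 h.1.2.1, L.tE _ _ _ h.1.1 h.1.2.1]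
  have h3 := h2.1 a.1 h.1.1
  have h4 := h2.2.1 a.2 h.1.2.1
  simp only [if_true]
  omega

theorem Y_anti {p q i j : ℕ} (h : L.Y p q) (hi : i ≤ p) (hj : j ≤ q) : L.Y i j :=
  ⟨hi.trans h.1, hj.trans h.2.1, fun c => (h.2.2 c).imp hi.trans hj.trans⟩

theorem E_rel {p q i j : ℕ} (hp : p ≤ m) (hq : q ≤ n) (hi : i ≤ m) (hj : j ≤ n) :
    L.E p q + L.E i j = L.E p j + L.E i q := by
  rw [← sub_eq_zero]
  refine L.ext _ (fun r _ => ?_) fun c _ => ?_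
  · rw [map_sub, map_add, map_add, L.sE _ _ _ hp hq, L.sE _ _ _ hi hj, L.sE _ _ _ hp hj, L.sE _ _ _ hi hq]
    ring
  · rw [map_sub, map_add, map_add, L.tE _ _ _ hp hq, L.tE _ _ _ hi hj, L.tE _ _ _ hp hj, L.tE _ _ _ hi hq]
    ring

section
variable {R : Type} [CommRing R] {x : ℕ → ℕ → R}

/-- product of the residues of variables -/
def xprod (x : ℕ → ℕ → R) (l : Multiset (ℕ × ℕ)) : R := (l.map fun a => x a.1 a.2).prod

theorem xprod_cons (a : ℕ × ℕ) (l : Multiset (ℕ × ℕ)) : xprod x (a ::ₘ l) = x a.1 a.2 * xprod x l := by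
  simp [xprod]

theorem InY.extract
    (rel : ∀ p q i j, L.Y p q → L.Y i j → L.Y p j → L.Y i q → x p q * x i j = x p j * x i q)
    {l : Multiset (ℕ × ℕ)} (h : L.InY l) {p q : ℕ} (hY : L.Y p q) (hs : 0 < L.s p (L.esum l))
    (ht : 0 < L.t q (L.esum l)) (hs' : ∀ i ≤ m, p < i → L.s i (L.esum l) = 0)
    (ht' : ∀ j < q, L.t j (L.esum l) = 0) :
    ∃ l', L.InY l' ∧ l'.card + 1 = l.card ∧ L.esum l = L.E p q + L.esum l' ∧
      xprod x l = x p q * xprod x l' := by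
  obtain ⟨j, hj⟩ := h.exists_s hs
  obtain ⟨i, hi⟩ := h.exists_t ht
  obtain ⟨l1, rfl⟩ := Multiset.exists_cons_of_mem hj
  by_cases hjq : j = q
  · subst hjq
    exact ⟨l1, (InY.cons.1 h).2, by simp, esum_cons _ _, xprod_cons _ _⟩
  have hi' : (i, q) ∈ l1 := by
    rcases Multiset.mem_cons.1 hi with h1 | h1
    · simp only [Prod.mk.injEq] at h1; omega
    · exact h1
  obtain ⟨l2, rfl⟩ := Multiset.exists_cons_of_mem hi'
  have hYpj := h _ hj
  have hYiq := h _ hi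
  have hip : i ≤ p := by
    by_contra hc
    have := hs' i hYiq.1 (by simpa using hc)
    have := (h.s_pos hi).1
    simp only at this; omega
  have hYij : L.Y i j := Y_anti hYpj hip le_rfl
  have h2 : L.InY l2 := (InY.cons.1 (InY.cons.1 h).2).2
  refine ⟨(i, j) ::ₘ l2, InY.cons.2 ⟨hYij, h2⟩, by simp, ?_, ?_⟩
  · simp only [esum_cons]
    rw [← add_assoc, ← add_assoc, E_rel hY.1 hY.2.1 hYij.1 hYij.2.1]
  · simp only [xprod_cons]
    rw [← mul_assoc, ← mul_assoc, rel p q i j hY hYij hYpj hYiq]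

theorem InY.unique
    (rel : ∀ p q i j, L.Y p q → L.Y i j → L.Y p j → L.Y i q → x p q * x i j = x p j * x i q) :
    ∀ (c : ℕ) {l l' : Multiset (ℕ × ℕ)}, l.card = c → L.InY l → L.InY l' → L.esum l = L.esum l' →
    xprod x l = xprod x l' := by
  intro c
  induction c with
  | zero =>
    intro l l' hc h h' he
    have h1 := h'.deg
    rw [← he, h.deg, hc] at h1
    rw [Multiset.card_eq_zero.1 hc, Multiset.card_eq_zero.1 (Nat.cast_injective h1.symm)]
  | succ c ih =>
    intro l l' hc h h' he
    have h0 : L.esum l ≠ 0 := by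
      intro h0
      have := h.deg
      rw [h0, map_zero, hc] at this
      push_cast at this; omega
    obtain ⟨p, q, hY, hs, ht, hs', ht'⟩ := L.exists_extreme h.mem h0
    obtain ⟨l1, h1, hc1, he1, hx1⟩ := h.extract rel hY hs ht hs' ht'
    rw [he] at hs ht hs' ht'
    obtain ⟨l2, h2, hc2, he2, hx2⟩ := h'.extract rel hY hs ht hs' ht'
    rw [hx1, hx2, ih (by omega) h1 h2]
    rw [he1, he2] at he
    exact add_left_cancel he

theorem exists_InY {g : G} (hg : g ∈ L.S) : ∃ l, L.InY l ∧ L.esum l = g := by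
  have key : ∀ c : ℕ, ∀ g ∈ L.S, L.deg g = c → ∃ l, L.InY l ∧ L.esum l = g := by
    intro c
    induction c with
    | zero =>
      intro g hg hc
      by_cases h0 : g = 0
      · exact ⟨0, by simp [InY], by simp [esum, h0]⟩
      · obtain ⟨p, q, hY, hs, ht, hs', ht'⟩ := L.exists_extreme hg h0
        have := L.deg_nonneg (L.sub_E_mem hg hY hs ht hs' ht')
        rw [map_sub, hc, L.degE hY.1 hY.2.1] at this
        simp at this
    | succ c ih =>
      intro g hg hc
      by_cases h0 : g = 0
      · exact ⟨0, by simp [InY], by simp [esum, h0]⟩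
      · obtain ⟨p, q, hY, hs, ht, hs', ht'⟩ := L.exists_extreme hg h0
        obtain ⟨l, hl, he⟩ := ih _ (L.sub_E_mem hg hY hs ht hs' ht')
          (by rw [map_sub, hc, L.degE hY.1 hY.2.1]; push_cast; ring)
        exact ⟨(p, q) ::ₘ l, InY.cons.2 ⟨hY, hl⟩, by rw [esum_cons, he]; simp⟩
  obtain ⟨c, hc⟩ := Int.eq_ofNat_of_zero_le (L.deg_nonneg hg)
  exact key c g hg hc

variable [Algebra k R] [Algebra R (AddMonoidAlgebra k G)] [IsScalarTower k R (AddMonoidAlgebra k G)]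

theorem map_xprod (hx : ∀ p q, L.Y p q → algebraMap R (AddMonoidAlgebra k G) (x p q) = XX k (L.E p q))
    {l : Multiset (ℕ × ℕ)} (h : L.InY l) :
    algebraMap R (AddMonoidAlgebra k G) (xprod x l) = XX k (L.esum l) := by
  induction l using Multiset.induction with
  | empty => simp [xprod, esum, XX_zero]
  | cons a l ih =>
    rw [InY.cons] at h
    rw [xprod_cons, esum_cons, map_mul, ih h.2, hx _ _ h.1, XX_mul]

theorem rdata (hx : ∀ p q, L.Y p q → algebraMap R (AddMonoidAlgebra k G) (x p q) = XX k (L.E p q))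
    (rel : ∀ p q i j, L.Y p q → L.Y i j → L.Y p j → L.Y i q → x p q * x i j = x p j * x i q)
    (gen : Algebra.adjoin k {r | ∃ p q, L.Y p q ∧ r = x p q} = ⊤) : RData k L.cd R := by
  classical
  have hspan : Submodule.span k {r | ∃ l, L.InY l ∧ r = xprod x l} = ⊤ := by
    rw [← top_le_iff, ← Algebra.top_toSubmodule, ← gen, Algebra.adjoin_eq_span]
    refine Submodule.span_mono fun r hr => ?_
    induction hr using Submonoid.closure_induction with
    | mem r hr =>
      obtain ⟨p, q, hY, rfl⟩ := hr
      exact ⟨{(p, q)}, by simpa [InY] using hY, by simp [xprod]⟩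
    | one => exact ⟨0, by simp [InY], by simp [xprod]⟩
    | mul r r' _ _ h h' =>
      obtain ⟨l, hl, rfl⟩ := h
      obtain ⟨l', hl', rfl⟩ := h'
      refine ⟨l + l', fun a ha => ?_, by simp [xprod]⟩
      rcases Multiset.mem_add.1 ha with ha | ha
      exacts [hl a ha, hl' a ha]
  have ind : ∀ {P : R → Prop}, P 0 → (∀ r r', P r → P r' → P (r + r')) → (∀ (c : k) r, P r → P (c • r)) →
      (∀ l, L.InY l → P (xprod x l)) → ∀ r, P r := by
    intro P h0 ha hs hp r
    have hr : r ∈ Submodule.span k {r | ∃ l, L.InY l ∧ r = xprod x l} := hspan ▸ Submodule.mem_top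
    induction hr using Submodule.span_induction with
    | mem r hr => obtain ⟨l, hl, rfl⟩ := hr; exact hp l hl
    | zero => exact h0
    | add r r' _ _ h h' => exact ha _ _ h h'
    | smul c r _ h => exact hs _ _ h
  have hsm : ∀ (c : k) (r : R), algebraMap R (AddMonoidAlgebra k G) (c • r) =
      c • algebraMap R (AddMonoidAlgebra k G) r := by
    intro c r
    rw [Algebra.algebraMap_eq_smul_one, Algebra.algebraMap_eq_smul_one, smul_assoc]
  refine ⟨?_, ?_, ?_⟩
  · let θ : G → R := fun g => if h : ∃ l, L.InY l ∧ L.esum l = g then xprod x h.choose else 0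
    have hθ : ∀ l, L.InY l → θ (L.esum l) = xprod x l := by
      intro l hl
      have hex : ∃ l', L.InY l' ∧ L.esum l' = L.esum l := ⟨l, hl, rfl⟩
      simp only [θ, dif_pos hex]
      exact InY.unique rel _ rfl hex.choose_spec.1 hl hex.choose_spec.2
    let Θ : AddMonoidAlgebra k G → R := fun f => Finsupp.linearCombination k θ f.coeff
    refine Function.LeftInverse.injective (g := Θ) fun r => ?_
    refine ind (P := fun r => Θ (algebraMap R (AddMonoidAlgebra k G) r) = r) ?_ ?_ ?_ ?_ r
    · simp [Θ]
    · intro r r' h h'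
      simp only [Θ] at h h' ⊢
      rw [map_add, AddMonoidAlgebra.coeff_add, map_add, h, h']
    · intro c r h
      simp only [Θ] at h ⊢
      rw [hsm, AddMonoidAlgebra.coeff_smul, map_smul, h]
    · intro l hl
      simp only [Θ]
      rw [map_xprod hx hl, XX, AddMonoidAlgebra.coeff_single, Finsupp.linearCombination_single, one_smul, hθ l hl]
  · intro r
    refine ind (P := fun r => algebraMap R (AddMonoidAlgebra k G) r ∈ mon k (L.cd.A 0)) ?_ ?_ ?_ ?_ r
    · rw [map_zero]; exact zero_mem _
    · intro r r' h h'; rw [map_add]; exact add_mem h h'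
    · intro c r h; rw [hsm]; exact Submodule.smul_mem _ _ h
    · intro l hl; rw [map_xprod hx hl]; exact XX_mem.2 hl.mem
  · intro f hf
    refine mon_induction (p := fun f => ∃ r : R, algebraMap R (AddMonoidAlgebra k G) r = f) hf
      ⟨0, map_zero _⟩ ?_ ?_
    · rintro f g ⟨r, rfl⟩ ⟨r', rfl⟩
      exact ⟨r + r', map_add _ _ _⟩
    · intro c g hg
      obtain ⟨l, hl, rfl⟩ := exists_InY hg
      exact ⟨c • xprod x l, by rw [hsm, map_xprod hx hl]⟩

end
end LD
end


section
variable (k : Type) [Field k] {Y : Set (ℕ × ℕ)}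

open Classical in
/-- the residue of a variable, extended by zero -/
noncomputable def xr (Y : Set (ℕ × ℕ)) (p : ℕ × ℕ) : LadderRing k 2 Y :=
  if h : p ∈ Y then xres k 2 p h else 0

theorem xr_of_mem {p : ℕ × ℕ} (h : p ∈ Y) : xr k Y p = xres k 2 p h := dif_pos h

theorem xr_rel_lt {a b c d : ℕ} (hac : a < c) (hbd : b < d) (h1 : (a, b) ∈ Y) (h2 : (c, d) ∈ Y)
    (h3 : (a, d) ∈ Y) (h4 : (c, b) ∈ Y) :
    xr k Y (a, b) * xr k Y (c, d) = xr k Y (a, d) * xr k Y (c, b) := by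
  rw [xr_of_mem k h1, xr_of_mem k h2, xr_of_mem k h3, xr_of_mem k h4]
  simp only [xres]
  rw [← map_mul, ← map_mul, Ideal.Quotient.eq]
  refine Ideal.subset_span ⟨![a, c], ![b, d], ?_, ?_, ?_, ?_⟩
  · intro u v huv
    fin_cases u <;> fin_cases v <;> simp_all
  · intro u v huv
    fin_cases u <;> fin_cases v <;> simp_all
  · intro u v
    fin_cases u <;> fin_cases v <;> simp_all
  · rw [minorPoly, Matrix.det_fin_two]
    rfl

theorem xr_rel {a b c d : ℕ} (h1 : (a, b) ∈ Y) (h2 : (c, d) ∈ Y)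
    (h3 : (a, d) ∈ Y) (h4 : (c, b) ∈ Y) :
    xr k Y (a, b) * xr k Y (c, d) = xr k Y (a, d) * xr k Y (c, b) := by
  rcases lt_trichotomy a c with hac | rfl | hac
  · rcases lt_trichotomy b d with hbd | rfl | hbd
    · exact xr_rel_lt k hac hbd h1 h2 h3 h4
    · rfl
    · exact (xr_rel_lt k hac hbd h3 h4 h1 h2).symm
  · exact mul_comm _ _
  · rcases lt_trichotomy b d with hbd | rfl | hbd
    · rw [mul_comm, mul_comm (xr k Y (a, d))]
      exact (xr_rel_lt k hac hbd h4 h3 h2 h1).symm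
    · rfl
    · rw [mul_comm, mul_comm (xr k Y (a, d))]
      exact xr_rel_lt k hac hbd h2 h1 h4 h3

theorem xr_gen : Algebra.adjoin k {r | ∃ p ∈ Y, r = xr k Y p} = ⊤ := by
  have h1 := MvPolynomial.adjoin_range_X (R := k) (σ := Y)
  have h2 := congrArg (Subalgebra.map (Ideal.Quotient.mkₐ k (minorIdeal k 2 Y))) h1
  rw [AlgHom.map_adjoin, Algebra.map_top, (AlgHom.range_eq_top _).2 (Ideal.Quotient.mkₐ_surjective _ _)] at h2
  rw [← top_le_iff, ← h2]
  refine Algebra.adjoin_mono ?_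
  rintro _ ⟨_, ⟨p, rfl⟩, rfl⟩
  exact ⟨p.1, p.2, (xr_of_mem k p.2).symm⟩

variable {m n : ℕ} {G Λ : Type} [AddCommGroup G] [LinearOrder Λ] (L : LD m n G Λ)

/-- the map from the polynomial ring to the group algebra -/
noncomputable def toB0 (Y : Set (ℕ × ℕ)) (f g : ℕ → ℕ) : MvPolynomial Y k →ₐ[k] AddMonoidAlgebra k G :=
  MvPolynomial.aeval fun a : Y => XX k (L.E (f a.1.1) (g a.1.2))

theorem toB0_minor {f g : ℕ → ℕ} (h : ∀ i j, (i, j) ∈ Y → L.Y (f i) (g j)) :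
    ∀ a ∈ minorIdeal k 2 Y, toB0 k L Y f g a = 0 := by
  intro a ha
  have : minorIdeal k 2 Y ≤ RingHom.ker (toB0 k L Y f g).toRingHom := by
    refine Ideal.span_le.2 ?_
    rintro _ ⟨r, c, -, -, hY, rfl⟩
    change toB0 k L Y f g _ = 0
    rw [minorPoly, Matrix.det_fin_two]
    simp only [Matrix.of_apply, map_sub, map_mul, toB0, MvPolynomial.aeval_X, XX_mul]
    have h00 := h _ _ (hY 0 0)
    have h11 := h _ _ (hY 1 1)
    rw [LD.E_rel h00.1 h00.2.1 h11.1 h11.2.1, sub_self]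
  exact this ha

/-- the map from the ladder determinantal ring to the group algebra -/
noncomputable def toB {f g : ℕ → ℕ} (h : ∀ i j, (i, j) ∈ Y → L.Y (f i) (g j)) :
    LadderRing k 2 Y →ₐ[k] AddMonoidAlgebra k G :=
  Ideal.Quotient.liftₐ _ (toB0 k L Y f g) (toB0_minor k L h)

theorem toB_xr {f g : ℕ → ℕ} (h : ∀ i j, (i, j) ∈ Y → L.Y (f i) (g j)) {p : ℕ × ℕ} (hp : p ∈ Y) :
    toB k L h (xr k Y p) = XX k (L.E (f p.1) (g p.2)) := by
  rw [xr_of_mem k hp, xres, toB]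
  change toB0 k L Y f g _ = _
  rw [toB0, MvPolynomial.aeval_X]

theorem ladder_main [Finite Λ] [IsDomain (AddMonoidAlgebra k G)] (hfin : Y.Finite) {f g f' g' : ℕ → ℕ}
    (h : ∀ i j, (i, j) ∈ Y → L.Y (f i) (g j) ∧ f' (f i) = i ∧ g' (g j) = j)
    (h' : ∀ p q, L.Y p q → (f' p, g' q) ∈ Y ∧ f (f' p) = p ∧ g (g' q) = q)
    (C : Fin 3 → ModuleCat.{0} (LadderRing k 2 Y)) (hC : ∀ i, IsSemidualizing (C i)) :
    ∃ i j, i ≠ j ∧ Nonempty (C i ≅ C j) := by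
  have h1 : ∀ i j, (i, j) ∈ Y → L.Y (f i) (g j) := fun i j hij => (h i j hij).1
  letI alg : Algebra (LadderRing k 2 Y) (AddMonoidAlgebra k G) := (toB k L h1).toRingHom.toAlgebra
  haveI tower : IsScalarTower k (LadderRing k 2 Y) (AddMonoidAlgebra k G) :=
    IsScalarTower.of_algebraMap_eq fun c => ((toB k L h1).commutes c).symm
  haveI : Finite Y := hfin
  haveI : IsNoetherianRing (LadderRing k 2 Y) := inferInstance
  have hR : RData k L.cd (LadderRing k 2 Y) := by
    refine LD.rdata (x := fun p q => xr k Y (f' p, g' q)) ?_ ?_ ?_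
    · intro p q hpq
      obtain ⟨h2, h3, h4⟩ := h' p q hpq
      change toB k L h1 _ = _
      rw [toB_xr k L h1 h2, h3, h4]
    · intro p q i j hpq hij hpj hiq
      exact xr_rel k (h' _ _ hpq).1 (h' _ _ hij).1 (h' _ _ hpj).1 (h' _ _ hiq).1
    · rw [← top_le_iff, ← xr_gen k]
      refine Algebra.adjoin_mono ?_
      rintro _ ⟨⟨i, j⟩, hp, rfl⟩
      obtain ⟨h2, h3, h4⟩ := h i j hp
      exact ⟨f i, g j, h2, by rw [h3, h4]⟩
  exact RData.main hR C hC

end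


section

/-- the lattice of exponents -/
def Lat (m n : ℕ) : AddSubgroup ((ℕ → ℤ) × (ℕ → ℤ)) where
  carrier := {w | (∀ i, m < i → w.1 i = 0) ∧ (∀ j, n < j → w.2 j = 0) ∧
    ∑ i ∈ Finset.range (m + 1), w.1 i = ∑ j ∈ Finset.range (n + 1), w.2 j}
  zero_mem' := by simp
  add_mem' := by
    rintro w v ⟨h1, h2, h3⟩ ⟨h4, h5, h6⟩
    refine ⟨fun i hi => ?_, fun j hj => ?_, ?_⟩
    · simp [h1 i hi, h4 i hi]
    · simp [h2 j hj, h5 j hj]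
    · simp [Finset.sum_add_distrib, h3, h6]
  neg_mem' := by
    rintro w ⟨h1, h2, h3⟩
    refine ⟨fun i hi => ?_, fun j hj => ?_, ?_⟩
    · simp [h1 i hi]
    · simp [h2 j hj]
    · simp [h3]

instance (m n : ℕ) : TwoUniqueSums (Lat m n) :=
  TwoUniqueSums.of_injective_addHom (Lat m n).subtype.toAddHom Subtype.val_injective inferInstance

instance (k : Type) [Field k] (m n : ℕ) : IsDomain (AddMonoidAlgebra k (Lat m n)) := inferInstance

/-- the exponent of a variable -/
def LatE (m n p q : ℕ) : Lat m n :=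
  if h : p ≤ m ∧ q ≤ n then ⟨(Pi.single p 1, Pi.single q 1), by
    refine ⟨fun i hi => ?_, fun j hj => ?_, ?_⟩
    · exact Pi.single_eq_of_ne (by omega) _
    · exact Pi.single_eq_of_ne (by omega) _
    · simp only [Pi.single_apply, Finset.sum_ite_eq', Finset.mem_range]
      rw [if_pos (by omega), if_pos (by omega)]⟩
  else 0

/-- the row functionals -/
def LatS (m n i : ℕ) : Lat m n →+ ℤ where
  toFun w := w.1.1 i
  map_zero' := rfl
  map_add' _ _ := rfl

/-- the column functionals -/
def LatT (m n i : ℕ) : Lat m n →+ ℤ where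
  toFun w := w.1.2 i
  map_zero' := rfl
  map_add' _ _ := rfl

open Classical in
/-- greatest column index of row `p + 1` -/
noncomputable def rho (m n : ℕ) (D : ℕ → ℕ → Prop) (p : ℕ) : ℕ :=
  if m ≤ p then 0 else Nat.findGreatest (fun q => D (p + 1) q) n

/-- the corners -/
def Cor (m n : ℕ) (D : ℕ → ℕ → Prop) : Type := {p : ℕ // p ≤ m ∧ ∀ p' < p, rho m n D p < rho m n D p'}

noncomputable instance (m n : ℕ) (D : ℕ → ℕ → Prop) : LinearOrder (Cor m n D) :=
  inferInstanceAs (LinearOrder {p : ℕ // p ≤ m ∧ ∀ p' < p, rho m n D p < rho m n D p'})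

instance (m n : ℕ) (D : ℕ → ℕ → Prop) : Finite (Cor m n D) :=
  Finite.of_injective (fun c : Cor m n D => (⟨c.1, Nat.lt_succ_of_le c.2.1⟩ : Fin (m + 1))) (by
    rintro ⟨a, ha⟩ ⟨b, hb⟩ h
    simp only [Fin.mk.injEq] at h
    subst h; rfl)

theorem rho_le (m n : ℕ) (D : ℕ → ℕ → Prop) (p : ℕ) : rho m n D p ≤ n := by
  classical
  rw [rho]; split_ifs
  · exact Nat.zero_le _
  · exact Nat.findGreatest_le _

theorem le_rho {m n : ℕ} {D : ℕ → ℕ → Prop} (hD : ∀ p q, D p q → p ≤ m ∧ q ≤ n) {p q : ℕ}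
    (h : D (p + 1) q) : q ≤ rho m n D p := by
  classical
  have := hD _ _ h
  rw [rho, if_neg (by omega)]
  exact Nat.le_findGreatest this.2 h

theorem rho_spec {m n : ℕ} {D : ℕ → ℕ → Prop} {p q : ℕ} (hp : p < m)
    (h : D (p + 1) q) (hq : q ≤ n) : D (p + 1) (rho m n D p) := by
  classical
  rw [rho, if_neg (by omega)]
  exact Nat.findGreatest_spec (P := fun q => D (p + 1) q) hq h

theorem exists_LD {m n : ℕ} {D : ℕ → ℕ → Prop} (hD : ∀ p q, D p q → p ≤ m ∧ q ≤ n)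
    (hdown : ∀ p q i j, D p q → i ≤ p → j ≤ q → D i j)
    (h : (m = 0 ∧ n = 0 ∧ D 0 0) ∨ (1 ≤ m ∧ 1 ≤ n ∧ D 1 n ∧ D m 1)) :
    ∃ L : LD m n (Lat m n) (Cor m n D), ∀ p q, L.Y p q ↔ D p q := by
  have hn : rho m n D 0 = n := by
    rcases h with ⟨rfl, rfl, h⟩ | ⟨h1, h2, h3, h4⟩
    · have := rho_le 0 0 D 0; omega
    · exact le_antisymm (rho_le _ _ _ _) (le_rho hD h3)
  have hm : rho m n D m = 0 := by rw [rho, if_pos le_rfl]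
  have htop : ∀ p' < m, rho m n D m < rho m n D p' := by
    intro p' hp'
    rcases h with ⟨rfl, rfl, h⟩ | ⟨h1, h2, h3, h4⟩
    · omega
    · have := le_rho hD (hdown _ _ (p' + 1) 1 h4 (by omega) le_rfl)
      omega
  have h0 : D 0 n := by
    rcases h with ⟨rfl, rfl, h⟩ | ⟨h1, h2, h3, h4⟩
    · exact h
    · exact hdown _ _ _ _ h3 (by omega) le_rfl
  have hcol : ∀ p ≤ m, D p 0 := by
    intro p hp
    rcases h with ⟨rfl, rfl, h⟩ | ⟨h1, h2, h3, h4⟩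
    · exact hdown _ _ _ _ h (by omega) le_rfl
    · exact hdown _ _ _ _ h4 (by omega) (by omega)
  refine ⟨{ s := LatS m n
            t := LatT m n
            E := LatE m n
            sE := ?_
            tE := ?_
            sum := fun g => g.2.2.2
            ext := ?_
            a := fun l => l.1
            b := fun l => rho m n D l.1
            ha := fun _ _ h => h
            hb := fun l l' h => l'.2.2 _ h
            am := fun l => l.2.1
            bn := fun l => rho_le _ _ _ _
            bot := ⟨0, Nat.zero_le _, by simp⟩
            top := ⟨m, le_rfl, htop⟩
            abot := rfl
            bbot := hn
            atop := rfl
            btop := hm }, ?_⟩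
  · intro p q i hp hq
    simp only [LatE, dif_pos (And.intro hp hq), LatS, AddMonoidHom.coe_mk, ZeroHom.coe_mk, Pi.single_apply]
  · intro p q i hp hq
    simp only [LatE, dif_pos (And.intro hp hq), LatT, AddMonoidHom.coe_mk, ZeroHom.coe_mk, Pi.single_apply]
  · intro g h1 h2
    apply Subtype.ext
    refine Prod.ext (funext fun i => ?_) (funext fun j => ?_)
    · by_cases hi : i ≤ m
      · exact h1 i hi
      · exact g.2.1 i (by omega)
    · by_cases hj : j ≤ n
      · exact h2 j hj
      · exact g.2.2.1 j (by omega)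
  · intro p q
    constructor
    · rintro ⟨hp, hq, hl⟩
      rcases Nat.eq_zero_or_pos p with rfl | hp0
      · exact hdown _ _ _ _ h0 le_rfl hq
      · classical
        have hex : ∃ l, rho m n D l ≤ rho m n D (p - 1) := ⟨p - 1, le_rfl⟩
        have hle := Nat.find_min' hex (le_refl (rho m n D (p - 1)))
        have hsp := Nat.find_spec hex
        have hmem : ∀ p' < Nat.find hex, rho m n D (Nat.find hex) < rho m n D p' := fun p' hp' =>
          lt_of_le_of_lt hsp (not_le.1 (Nat.find_min hex hp'))
        have hq' := (hl ⟨Nat.find hex, by omega, hmem⟩).resolve_left (by simp only; omega)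
        have h3 := rho_spec (p := p - 1) (q := 0) (n := n) (D := D) (m := m) (by omega) (hcol _ (by omega)) (Nat.zero_le _)
        rw [show p - 1 + 1 = p by omega] at h3
        exact hdown _ _ _ _ h3 le_rfl (hq'.trans hsp)
    · intro hpq
      refine ⟨(hD _ _ hpq).1, (hD _ _ hpq).2, fun l => ?_⟩
      by_cases hl : p ≤ l.1
      · exact Or.inl hl
      · exact Or.inr (le_rho hD (hdown _ _ (l.1 + 1) q hpq (by omega) le_rfl))

end


section
variable {m n : ℕ} {Y : Set (ℕ × ℕ)}

theorem StdLadder.row (h : StdLadder m n Y) {i j c q : ℕ} (h1 : (i, j) ∈ Y) (h2 : (i, q) ∈ Y)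
    (hc : j ≤ c) (hc' : c ≤ q) : (i, c) ∈ Y := by
  obtain ⟨⟨hg, hl⟩, -, -, -, hcol⟩ := h
  obtain ⟨g1, g2, g3, g4⟩ := hg _ h1
  obtain ⟨g1', g2', g3', g4'⟩ := hg _ h2
  simp only at g1 g2 g3 g4 g1' g2' g3' g4'
  obtain ⟨a, ha⟩ := hcol c (by omega) (by omega)
  rcases le_total i a with h | h
  · exact (hl _ _ _ _ h1 ha h hc).1
  · exact (hl _ _ _ _ ha h2 h hc').2

theorem StdLadder.col (h : StdLadder m n Y) {i j c q : ℕ} (h1 : (i, j) ∈ Y) (h2 : (q, j) ∈ Y)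
    (hc : i ≤ c) (hc' : c ≤ q) : (c, j) ∈ Y := by
  obtain ⟨⟨hg, hl⟩, -, -, hrow, -⟩ := h
  obtain ⟨g1, g2, g3, g4⟩ := hg _ h1
  obtain ⟨g1', g2', g3', g4'⟩ := hg _ h2
  simp only at g1 g2 g3 g4 g1' g2' g3' g4'
  obtain ⟨a, ha⟩ := hrow c (by omega) (by omega)
  rcases le_total j a with h | h
  · exact (hl _ _ _ _ h1 ha hc h).2
  · exact (hl _ _ _ _ ha h2 hc' h).1

theorem cross {r : ℕ} {x y : ℕ × ℕ}
    (h : Relation.ReflTransGen (fun a b => a ∈ Y ∧ b ∈ Y ∧ AdjStep a b) x y) (hx : x.1 ≤ r)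
    (hy : r < y.1) : ∃ c, (r, c) ∈ Y ∧ (r + 1, c) ∈ Y := by
  induction h with
  | refl => omega
  | @tail z y _ hz ih =>
    by_cases hzr : r < z.1
    · exact ih hzr
    · obtain ⟨h1, h2, h3⟩ := hz
      obtain ⟨z1, z2⟩ := z
      obtain ⟨y1, y2⟩ := y
      simp only [AdjStep] at h3 hzr hy
      obtain ⟨h4, h5⟩ : y2 = z2 ∧ y1 = z1 + 1 := by omega
      obtain rfl : z1 = r := by omega
      subst h4 h5
      exact ⟨_, h1, h2⟩

theorem StdLadder.one_one (h : StdLadder m n Y) (hp : PathConnected Y) (hc : ∀ p, ¬ IsLowerCorner Y p) :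
    (1, 1) ∈ Y := by
  classical
  by_contra h11
  have hex : ∃ a, (a, 1) ∈ Y := ⟨m, h.2.2.1⟩
  obtain ⟨a, ha, hmin⟩ : ∃ a, (a, 1) ∈ Y ∧ ∀ a' < a, (a', 1) ∉ Y :=
    ⟨Nat.find hex, Nat.find_spec hex, fun _ => Nat.find_min hex⟩
  obtain ⟨g1, g2, -, -⟩ := h.1.1 _ ha
  simp only at g1 g2
  have ha1 : a ≠ 1 := by rintro rfl; exact h11 ha
  have hrow := h.2.2.2.1 (a - 1) (by omega) (by omega)
  obtain ⟨b, hb, hbmin⟩ : ∃ b, (a - 1, b) ∈ Y ∧ ∀ b' < b, (a - 1, b') ∉ Y :=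
    ⟨Nat.find hrow, Nat.find_spec hrow, fun _ => Nat.find_min hrow⟩
  obtain ⟨-, -, g3, -⟩ := h.1.1 _ hb
  simp only at g3
  have hb1 : b ≠ 1 := by rintro rfl; exact hmin _ (by omega) hb
  obtain ⟨-, -, hpath⟩ := hp _ h.2.1 _ h.2.2.1
  obtain ⟨c, hc1, hc2⟩ := cross (r := a - 1) hpath (by simp only; omega) (by simp only; omega)
  rw [show a - 1 + 1 = a by omega] at hc2
  have hbc : b ≤ c := by
    by_contra hlt
    exact hbmin c (by omega) hc1
  exact hc (a, b) ⟨h.row ha hc2 (by omega) hbc, hb, h.row ha hc2 (by omega) (by omega),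
    hbmin _ (by simp only; omega)⟩

theorem StdLadder.m_n (h : StdLadder m n Y) (hp : PathConnected Y) (hc : ∀ p, ¬ IsUpperCorner Y p) :
    (m, n) ∈ Y := by
  classical
  by_contra h11
  obtain ⟨e1, e2, e3, e4⟩ := h.1.1 _ h.2.1
  simp only at e1 e2 e3 e4
  obtain ⟨a, ha, ham, hmin⟩ : ∃ a, (a, n) ∈ Y ∧ a ≤ m ∧ ∀ a', a < a' → a' ≤ m → (a', n) ∉ Y :=
    ⟨Nat.findGreatest (fun a => (a, n) ∈ Y) m, Nat.findGreatest_spec (P := fun a => (a, n) ∈ Y) e2 h.2.1,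
      Nat.findGreatest_le _, fun _ h1 h2 => Nat.findGreatest_is_greatest h1 h2⟩
  obtain ⟨g1, g2, -, -⟩ := h.1.1 _ ha
  simp only at g1 g2
  have ha1 : a ≠ m := by rintro rfl; exact h11 ha
  obtain ⟨b0, hb0⟩ := h.2.2.2.1 (a + 1) (by omega) (by omega)
  obtain ⟨b, hb, hbn, hbmax⟩ : ∃ b, (a + 1, b) ∈ Y ∧ b ≤ n ∧ ∀ b', b < b' → b' ≤ n → (a + 1, b') ∉ Y :=
    ⟨Nat.findGreatest (fun b => (a + 1, b) ∈ Y) n,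
      Nat.findGreatest_spec (P := fun b => (a + 1, b) ∈ Y) (h.1.1 _ hb0).2.2.2 hb0,
      Nat.findGreatest_le _, fun _ h1 h2 => Nat.findGreatest_is_greatest h1 h2⟩
  have hb1 : b ≠ n := by rintro rfl; exact hmin _ (by omega) (by omega) hb
  obtain ⟨-, -, hpath⟩ := hp _ h.2.1 _ h.2.2.1
  obtain ⟨c, hc1, hc2⟩ := cross (r := a) hpath (by simp only; omega) (by simp only; omega)
  have hcn := (h.1.1 _ hc2).2.2.2
  simp only at hcn
  have hbc : c ≤ b := by
    by_contra hlt
    exact hbmax c (by omega) hcn hc2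
  exact hc (a, b) ⟨h.row hc1 ha (by omega) (by omega), hb, h.row hc1 ha (by omega) (by omega),
    hbmax _ (by simp only; omega) (by simp only; omega)⟩

theorem IsMinor.mk {a b c d : ℕ} (hac : a < c) (hbd : b < d) (h1 : (a, b) ∈ Y) (h2 : (c, d) ∈ Y)
    (h3 : (a, d) ∈ Y) (h4 : (c, b) ∈ Y) : ∃ M, IsMinor 2 Y M ∧ (a, d) ∈ M ∧ (c, b) ∈ M := by
  refine ⟨_, ⟨![a, c], ![b, d], ?_, ?_, ?_, rfl⟩, ⟨0, 1, rfl⟩, ⟨1, 0, rfl⟩⟩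
  · intro u v huv
    fin_cases u <;> fin_cases v <;> simp_all
  · intro u v huv
    fin_cases u <;> fin_cases v <;> simp_all
  · intro u v
    fin_cases u <;> fin_cases v <;> simp_all

/-- an entry of a connected ladder which is not the only one lies in a minor -/
theorem TConnected.exists_minor (hY : IsLadder m n Y) (hconn : TConnected m n 2 Y) {z : ℕ × ℕ} (hz : z ∈ Y)
    (hne : Y ≠ {z})
    (hlad : (∀ M, IsMinor 2 Y M → z ∉ M) → ∀ i j p q : ℕ, (i, j) ∈ Y → (p, q) ∈ Y → (i, j) ≠ z →
      (p, q) ≠ z → i ≤ p → j ≤ q → (i, q) ≠ z ∧ (p, j) ≠ z) : ∃ M, IsMinor 2 Y M ∧ z ∈ M := by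
  by_contra hno
  push Not at hno
  refine hconn ⟨{z}, Y \ {z}, ⟨z, rfl⟩, ?_, ?_, ?_, ?_, ?_, ?_⟩
  · by_contra he
    rw [Set.not_nonempty_iff_eq_empty, Set.sdiff_eq_empty] at he
    exact hne (Set.Subset.antisymm he (by simpa using hz))
  · refine ⟨fun p hp => hY.1 p (by rw [Set.mem_singleton_iff.1 hp]; exact hz), ?_⟩
    rintro i j p q h1 h2 - -
    rw [Set.mem_singleton_iff] at h1 h2
    subst h1
    simp only [Prod.mk.injEq] at h2
    obtain ⟨rfl, rfl⟩ := h2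
    exact ⟨rfl, rfl⟩
  · refine ⟨fun p hp => hY.1 p hp.1, ?_⟩
    intro i j p q h1 h2 hip hjq
    have h3 := hY.2 i j p q h1.1 h2.1 hip hjq
    have h4 := hlad hno i j p q h1.1 h2.1 h1.2 h2.2 hip hjq
    exact ⟨⟨h3.1, h4.1⟩, ⟨h3.2, h4.2⟩⟩
  · exact Set.inter_sdiff_self _ _
  · rw [Set.union_sdiff_self]
    exact Set.union_eq_right.2 (by simpa using hz)
  · intro M hM
    right
    intro p hp
    refine ⟨?_, fun hpz => ?_⟩
    · obtain ⟨r, c, -, -, hrc, rfl⟩ := hM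
      obtain ⟨u, v, rfl⟩ := hp
      exact hrc u v
    · rw [Set.mem_singleton_iff] at hpz
      exact hno M hM (hpz ▸ hp)

theorem StdLadder.corner1 (h : StdLadder m n Y) (hconn : TConnected m n 2 Y) (hne : ¬ (m = 1 ∧ n = 1)) :
    ∃ i j, 1 < i ∧ j < n ∧ (1, j) ∈ Y ∧ (i, n) ∈ Y := by
  obtain ⟨M, hM, hz⟩ := hconn.exists_minor h.1 (z := (1, n)) h.2.1 (by
    intro he
    have := h.2.2.1
    rw [he, Set.mem_singleton_iff, Prod.mk.injEq] at this
    omega) (by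
    intro hno i j p q h1 h2 h1' h2' hip hjq
    have h3 := h.1.2 i j p q h1 h2 hip hjq
    have g1 := h.1.1 _ h1
    have g2 := h.1.1 _ h2
    simp only [InGrid, ne_eq, Prod.mk.injEq] at *
    refine ⟨?_, by omega⟩
    rintro ⟨rfl, rfl⟩
    obtain ⟨M, hM, hm, -⟩ := IsMinor.mk (by omega : 1 < p) (by omega : j < q) h1 h2 h3.1 h3.2
    exact hno M hM hm)
  obtain ⟨r, c, hr, hc, hrc, rfl⟩ := hM
  obtain ⟨u, v, huv⟩ := hz
  rw [Prod.mk.injEq] at huv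
  have hr01 := hr (by decide : (0 : Fin 2) < 1)
  have hc01 := hc (by decide : (0 : Fin 2) < 1)
  have g00 := h.1.1 _ (hrc 0 0)
  have g11 := h.1.1 _ (hrc 1 1)
  simp only [InGrid] at g00 g11
  have hr0 : r 0 = 1 := by
    obtain ⟨hu, -⟩ := huv
    fin_cases u <;> simp at hu <;> omega
  have hc1 : c 1 = n := by
    obtain ⟨-, hv⟩ := huv
    fin_cases v <;> simp at hv <;> omega
  refine ⟨r 1, c 0, by omega, by omega, ?_, ?_⟩
  · have := hrc 0 0; rwa [hr0] at this
  · rw [← hc1]; exact hrc 1 1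

theorem StdLadder.corner2 (h : StdLadder m n Y) (hconn : TConnected m n 2 Y) (hne : ¬ (m = 1 ∧ n = 1)) :
    ∃ i j, i < m ∧ 1 < j ∧ (i, 1) ∈ Y ∧ (m, j) ∈ Y := by
  obtain ⟨M, hM, hz⟩ := hconn.exists_minor h.1 (z := (m, 1)) h.2.2.1 (by
    intro he
    have := h.2.1
    rw [he, Set.mem_singleton_iff, Prod.mk.injEq] at this
    omega) (by
    intro hno i j p q h1 h2 h1' h2' hip hjq
    have h3 := h.1.2 i j p q h1 h2 hip hjq
    have g1 := h.1.1 _ h1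
    have g2 := h.1.1 _ h2
    simp only [InGrid, ne_eq, Prod.mk.injEq] at *
    refine ⟨by omega, ?_⟩
    rintro ⟨rfl, rfl⟩
    obtain ⟨M, hM, -, hm⟩ := IsMinor.mk (by omega : i < p) (by omega : 1 < q) h1 h2 h3.1 h3.2
    exact hno M hM hm)
  obtain ⟨r, c, hr, hc, hrc, rfl⟩ := hM
  obtain ⟨u, v, huv⟩ := hz
  rw [Prod.mk.injEq] at huv
  have hr01 := hr (by decide : (0 : Fin 2) < 1)
  have hc01 := hc (by decide : (0 : Fin 2) < 1)
  have g00 := h.1.1 _ (hrc 0 0)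
  have g11 := h.1.1 _ (hrc 1 1)
  simp only [InGrid] at g00 g11
  have hr0 : r 1 = m := by
    obtain ⟨hu, -⟩ := huv
    fin_cases u <;> simp at hu <;> omega
  have hc1 : c 0 = 1 := by
    obtain ⟨-, hv⟩ := huv
    fin_cases v <;> simp at hv <;> omega
  refine ⟨r 0, c 1, by omega, by omega, ?_, ?_⟩
  · have := hrc 0 0; rwa [hc1] at this
  · rw [← hr0]; exact hrc 1 1

theorem StdLadder.down (h : StdLadder m n Y) (h11 : (1, 1) ∈ Y) {i j a b : ℕ} (hij : (i, j) ∈ Y) (ha : 1 ≤ a)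
    (hb : 1 ≤ b) (hai : a ≤ i) (hbj : b ≤ j) : (a, b) ∈ Y := by
  have g := h.1.1 _ hij
  simp only [InGrid] at g
  obtain ⟨h1, h2⟩ := h.1.2 1 1 i j h11 hij g.1 g.2.2.1
  exact h.col (h.row h11 h1 hb hbj) (h.row h2 hij hb hbj) ha hai

theorem StdLadder.up (h : StdLadder m n Y) (hmn : (m, n) ∈ Y) {i j a b : ℕ} (hij : (i, j) ∈ Y) (ha : i ≤ a)
    (hb : j ≤ b) (hai : a ≤ m) (hbj : b ≤ n) : (a, b) ∈ Y := by
  have g := h.1.1 _ hij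
  simp only [InGrid] at g
  obtain ⟨h1, h2⟩ := h.1.2 i j m n hij hmn g.2.1 g.2.2.2
  exact h.col (h.row hij h1 hb hbj) (h.row h2 hmn hb hbj) ha hai

end

/-- A one-sided `2`-connected ladder determinantal ring `R_2(Y)` has at
most two semidualizing modules up to isomorphism: among any three semidualizing modules,
two are isomorphic. -/
theorem oneSided_twoConnected_semidualizing (m n : ℕ) (k : Type) [Field k]
    (Y : Set (ℕ × ℕ)) (hY : StdLadder m n Y) (hone : OneSided Y)
    (hconn : TConnected m n 2 Y)
    (C : Fin 3 → ModuleCat.{0} (LadderRing k 2 Y))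
    (hC : ∀ i, IsSemidualizing (C i)) :
    ∃ i j, i ≠ j ∧ Nonempty (C i ≅ C j) := by
  have hfin : Y.Finite := by
    refine Set.Finite.subset ((Set.finite_Iic m).prod (Set.finite_Iic n)) fun p hp => ?_
    have := hY.1.1 p hp
    exact ⟨this.2.1, this.2.2.2⟩
  have hgr : ∀ i j, (i, j) ∈ Y → 1 ≤ i ∧ i ≤ m ∧ 1 ≤ j ∧ j ≤ n := fun i j hij => hY.1.1 _ hij
  have g := hgr _ _ hY.2.1
  obtain ⟨hpath, hc | hc⟩ := hone
  · have h11 := hY.one_one hpath hc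
    obtain ⟨L, hL⟩ := exists_LD (m := m - 1) (n := n - 1) (D := fun p q => (p + 1, q + 1) ∈ Y)
      (fun p q hpq => by have := hgr _ _ hpq; omega)
      (fun p q i j hpq hi hj => hY.down h11 hpq (by omega) (by omega) (by omega) (by omega))
      (by
        by_cases hmn : m = 1 ∧ n = 1
        · exact Or.inl ⟨by omega, by omega, h11⟩
        · right
          obtain ⟨i, j, hi, hj, h1, h2⟩ := hY.corner1 hconn hmn
          obtain ⟨i', j', hi', hj', h1', h2'⟩ := hY.corner2 hconn hmn
          have g1 := hgr _ _ h1
          have g2 := hgr _ _ h2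
          have g3 := hgr _ _ h1'
          have g4 := hgr _ _ h2'
          exact ⟨by omega, by omega, hY.down h11 h2 (by omega) (by omega) (by omega) (by omega),
            hY.down h11 h2' (by omega) (by omega) (by omega) (by omega)⟩)
    refine ladder_main k L hfin (f := fun i => i - 1) (g := fun i => i - 1) (f' := fun i => i + 1)
      (g' := fun i => i + 1) ?_ ?_ C hC
    · intro i j hij
      have g1 := hgr _ _ hij
      rw [hL]
      have e1 : i - 1 + 1 = i := by omega
      have e2 : j - 1 + 1 = j := by omega
      rw [e1, e2]
      exact ⟨hij, rfl, rfl⟩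
    · intro p q hpq
      rw [hL] at hpq
      exact ⟨hpq, by simp, by simp⟩
  · have h11 := hY.m_n hpath hc
    obtain ⟨L, hL⟩ := exists_LD (m := m - 1) (n := n - 1) (D := fun p q => (m - p, n - q) ∈ Y)
      (fun p q hpq => by have := hgr _ _ hpq; omega)
      (fun p q i j hpq hi hj => hY.up h11 hpq (by omega) (by omega) (by omega) (by omega))
      (by
        by_cases hmn : m = 1 ∧ n = 1
        · exact Or.inl ⟨by omega, by omega, h11⟩
        · right
          obtain ⟨i, j, hi, hj, h1, h2⟩ := hY.corner1 hconn hmn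
          obtain ⟨i', j', hi', hj', h1', h2'⟩ := hY.corner2 hconn hmn
          have g1 := hgr _ _ h1
          have g2 := hgr _ _ h2
          have g3 := hgr _ _ h1'
          have g4 := hgr _ _ h2'
          exact ⟨by omega, by omega, hY.up h11 h1' (by omega) (by omega) (by omega) (by omega),
            hY.up h11 h1 (by omega) (by omega) (by omega) (by omega)⟩)
    refine ladder_main k L hfin (f := fun i => m - i) (g := fun i => n - i) (f' := fun i => m - i)
      (g' := fun i => n - i) ?_ ?_ C hC
    · intro i j hij
      have g1 := hgr _ _ hij
      rw [hL]
      have e1 : m - (m - i) = i := by omega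
      have e2 : n - (n - j) = j := by omega
      rw [e1, e2]
      exact ⟨hij, rfl, rfl⟩
    · intro p q hpq
      rw [hL] at hpq
      have g1 := hgr _ _ hpq
      exact ⟨hpq, by omega, by omega⟩


end LadderDet
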